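/- Suppose (A1)-(A4) hold and all coordinates of the mean vector M are nonnegative. Then: (i) the function h_M(x) = Π_{i∈Λ(M)} x^i − E_x(Π_{i∈Λ(M)} S^i(τ)) is strictly positive and harmonic for the Markov chain (Z(t)); (ii) every sequence x_n ∈ ℤ_+^d with |x_n| → ∞ and x_n/|x_n| → M/|M| is fundamental for (Z(t)), and for every x ∈ ℤ_+^d, lim_n G(x,x_n)/G(x_0,x_n) = h_M(x)/h_M(x_0). -/

import Mathlib

open Filter Topology

attribute [local instance] Classical.propDecidable

noncomputable section

variable {V : Type*} [AddCommGroup V]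

/-- `n`-step transition kernel of the random walk with step distribution `μ`,
killed upon leaving the set `A` : `kern μ A n x y = P_x(S n = y, τ_A > n)`,
where `τ_A` is the first exit time from `A`. -/
def kern (μ : V → ℝ) (A : Set V) : ℕ → V → V → ℝ
  | 0 => fun x y => if x = y ∧ x ∈ A then 1 else 0
  | n + 1 => fun x y => ∑' z : V, (if x ∈ A then μ (z - x) else 0) * kern μ A n z y

/-- Green function of the walk killed outside `A`. -/
def green (μ : V → ℝ) (A : Set V) (x y : V) : ℝ :=
  ∑' n : ℕ, kern μ A n x y

/-- `E_x [ g(S τ) ; S τ ∈ B, τ < ∞ ]`, where `τ` is the first exit time from `A`. -/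
def exitExp (μ : V → ℝ) (A B : Set V) (g : V → ℝ) (x : V) : ℝ :=
  ∑' n : ℕ, ∑' z : V, kern μ A n x z *
    ∑' y : V, (if y ∉ A ∧ y ∈ B then μ (y - z) else 0) * g y

/-- `ℝ≥0∞`-valued version of `exitExp`. -/
def exitExpE (μ : V → ℝ) (A B : Set V) (g : V → ℝ) (x : V) : ENNReal :=
  ∑' n : ℕ, ∑' z : V, ENNReal.ofReal (kern μ A n x z) *
    ∑' y : V, ENNReal.ofReal ((if y ∉ A ∧ y ∈ B then μ (y - z) else 0) * g y)

/-- `P_x(S t = y for some t ≥ 0)` for the walk killed outside `A`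
(first passage decomposition). -/
def hitProb (μ : V → ℝ) (A : Set V) (x y : V) : ℝ :=
  (if x = y ∧ x ∈ A then 1 else 0) +
    ∑' n : ℕ, ∑' z : V, kern μ (A \ {y}) n x z * (if y ∈ A then μ (y - z) else 0)

/-- `h` is (strictly speaking, satisfies the mean value property of a) harmonic
function on `A` for the walk with step distribution `μ` killed outside `A`. -/
def HarmOn (μ : V → ℝ) (A : Set V) (h : V → ℝ) : Prop :=
  ∀ x ∈ A, h x = ∑' y : V, if y ∈ A then μ (y - x) * h y else 0

/-- Irreducibility of the walk killed outside `A`. -/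
def Irred (μ : V → ℝ) (A : Set V) : Prop :=
  ∀ x ∈ A, ∀ x' ∈ A, ∃ (k : ℕ) (c : ℕ → V), c 0 = x ∧ c k = x' ∧
    (∀ j ≤ k, c j ∈ A) ∧ ∀ j < k, 0 < μ (c (j + 1) - c j)

/-- A sequence `xs` is fundamental for the walk killed outside `A` :
the Martin kernels `G(x, xs n)/G(x₀, xs n)` converge for every `x ∈ A`. -/
def Fundamental (μ : V → ℝ) (A : Set V) (x₀ : V) (xs : ℕ → V) : Prop :=
  ∀ x ∈ A, ∃ L : ℝ,
    Tendsto (fun n => green μ A x (xs n) / green μ A x₀ (xs n)) atTop (𝓝 L)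

/-- ℓ¹-norm of an integer vector. -/
def znorm {ι : Type*} [Fintype ι] (x : ι → ℤ) : ℝ := ∑ i, |(x i : ℝ)|

/-- ℓ¹-norm of a real vector. -/
def rnorm {ι : Type*} [Fintype ι] (q : ι → ℝ) : ℝ := ∑ i, |q i|

variable {d : ℕ}

/-- `ℤ^{Λ,d}_+ = {x ∈ ℤ^d : xⁱ > 0 for all i ∈ Λ}`. -/
def posDom (Λ : Set (Fin d)) : Set (Fin d → ℤ) := {x | ∀ i ∈ Λ, 0 < x i}

/-- `ℤ^d_+ = {x ∈ ℤ^d : xⁱ > 0 for all i}`. -/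
def posAll : Set (Fin d → ℤ) := {x | ∀ i, 0 < x i}

/-- `a · z` for `a ∈ ℝ^d`, `z ∈ ℤ^d`. -/
def dotZ (a : Fin d → ℝ) (z : Fin d → ℤ) : ℝ := ∑ i, a i * (z i : ℝ)

/-- `a · q` for `a, q ∈ ℝ^d`. -/
def dotR (a q : Fin d → ℝ) : ℝ := ∑ i, a i * q i

/-- jump generating function `φ(a) = Σ_z μ(z) exp(a·z)` (valued in `ℝ≥0∞`). -/
def phiE (μ : (Fin d → ℤ) → ℝ) (a : Fin d → ℝ) : ENNReal :=
  ∑' z : Fin d → ℤ, ENNReal.ofReal (μ z * Real.exp (dotZ a z))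

/-- `D = {a ∈ ℝ^d : φ(a) ≤ 1}`. -/
def Dset (μ : (Fin d → ℤ) → ℝ) : Set (Fin d → ℝ) := {a | phiE μ a ≤ 1}

/-- mean vector `M = Σ_z μ(z) z`. -/
def Mvec (μ : (Fin d → ℤ) → ℝ) : Fin d → ℝ := fun i => ∑' z : Fin d → ℤ, μ z * (z i : ℝ)

/-- `Λ(M) = {i : Mⁱ = 0}`. -/
def LambdaM (μ : (Fin d → ℤ) → ℝ) : Set (Fin d) := {i | Mvec μ i = 0}

/-- Assumption (A1) : irreducibility on every `ℤ^{Λ,d}_+`. -/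
def A1 (μ : (Fin d → ℤ) → ℝ) : Prop := ∀ Λ : Set (Fin d), Irred μ (posDom Λ)

/-- Assumption (A2) : `φ` is finite on a neighborhood of the set `D`. -/
def A2 (μ : (Fin d → ℤ) → ℝ) : Prop :=
  ∃ U : Set (Fin d → ℝ), IsOpen U ∧ Dset μ ⊆ U ∧ ∀ a ∈ U, phiE μ a ≠ ⊤

/-- Assumption (A3) : `M ≠ 0`. -/
def A3 (μ : (Fin d → ℤ) → ℝ) : Prop := Mvec μ ≠ 0

/-- projection `x ↦ x^Λ`. -/
def projL (Λ : Set (Fin d)) (x : Fin d → ℤ) : ↥Λ → ℤ := fun i => x (i : Fin d)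

/-- jump distribution `μ_Λ(v) = Σ_{x : x^Λ = v} μ(x)` of the projected walk. -/
def muL (μ : (Fin d → ℤ) → ℝ) (Λ : Set (Fin d)) (v : ↥Λ → ℤ) : ℝ :=
  ∑' x : Fin d → ℤ, if projL Λ x = v then μ x else 0

/-- `ℤ^Λ_+`. -/
def posL (Λ : Set (Fin d)) : Set (↥Λ → ℤ) := {u | ∀ i, 0 < u i}

end

/-- `Π_{i ∈ Λ(M)} xⁱ`. -/
noncomputable def prodLam {d : ℕ} (μ : (Fin d → ℤ) → ℝ) (x : Fin d → ℤ) : ℝ :=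
  ∏ i, if Mvec μ i = 0 then (x i : ℝ) else 1

/-- `h_M(x) = Π_{i∈Λ(M)} xⁱ − E_x(Π_{i∈Λ(M)} Sⁱ(τ))`. -/
noncomputable def hM3 {d : ℕ} (μ : (Fin d → ℤ) → ℝ) (x : Fin d → ℤ) : ℝ :=
  prodLam μ x - exitExp μ posAll Set.univ (prodLam μ) x

namespace KilledWalk
open scoped ENNReal

noncomputable section

section Kernels
variable {X : Type*}

/-- The operator `f ↦ (x ↦ ∑ y, k x y * f y)` attached to a nonnegative kernel. -/
def kop (k : X → X → ℝ≥0∞) : Module.End ℝ≥0∞ (X → ℝ≥0∞) where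
  toFun f x := ∑' y, k x y * f y
  map_add' f g := by
    funext x
    simp only [Pi.add_apply, mul_add]
    exact ENNReal.tsum_add
  map_smul' c f := by
    funext x
    simp only [Pi.smul_apply, smul_eq_mul, RingHom.id_apply]
    rw [← ENNReal.tsum_mul_left]
    exact tsum_congr fun y => by ring

theorem kop_apply (k : X → X → ℝ≥0∞) (f : X → ℝ≥0∞) (x : X) :
    kop k f x = ∑' y, k x y * f y := rfl

theorem kop_mono (k : X → X → ℝ≥0∞) : Monotone (kop k) := fun _ _ h _ =>
  ENNReal.tsum_le_tsum fun y => mul_le_mul_right (h y) _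

theorem kop_le_kop {k k' : X → X → ℝ≥0∞} (h : ∀ x y, k x y ≤ k' x y) (f : X → ℝ≥0∞) :
    kop k f ≤ kop k' f := fun x =>
  ENNReal.tsum_le_tsum fun y => mul_le_mul_left (h x y) _

theorem pow_mono_of_mono {T : Module.End ℝ≥0∞ (X → ℝ≥0∞)} (hT : Monotone T) (n : ℕ) :
    Monotone (T ^ n) := by
  induction n with
  | zero => intro f g h; simpa using h
  | succ n ih =>
    intro f g h
    rw [pow_succ', Module.End.mul_apply, Module.End.mul_apply]
    exact hT (ih h)

theorem kop_pow_mono (k : X → X → ℝ≥0∞) (n : ℕ) : Monotone (kop k ^ n) :=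
  pow_mono_of_mono (kop_mono k) n

theorem kop_pow_le_kop_pow {k k' : X → X → ℝ≥0∞} (h : ∀ x y, k x y ≤ k' x y) (n : ℕ)
    (f : X → ℝ≥0∞) : (kop k ^ n) f ≤ (kop k' ^ n) f := by
  induction n with
  | zero => simp
  | succ n ih =>
    rw [pow_succ', pow_succ', Module.End.mul_apply, Module.End.mul_apply]
    exact (kop_mono k ih).trans (kop_le_kop h _)

theorem kop_tsum {ι : Type*} (k : X → X → ℝ≥0∞) (f : ι → X → ℝ≥0∞) :
    kop k (fun x => ∑' i, f i x) = fun x => ∑' i, kop k (f i) x := by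
  funext x
  simp only [kop_apply, ← ENNReal.tsum_mul_left]
  exact ENNReal.tsum_comm

theorem kop_pow_tsum {ι : Type*} (k : X → X → ℝ≥0∞) (n : ℕ) (f : ι → X → ℝ≥0∞) :
    (kop k ^ n) (fun x => ∑' i, f i x) = fun x => ∑' i, (kop k ^ n) (f i) x := by
  induction n with
  | zero => simp
  | succ n ih =>
    rw [pow_succ', Module.End.mul_apply, ih, kop_tsum]
    rfl

/-- The indicator function of a point. -/
def dl (y : X) : X → ℝ≥0∞ := fun x => if x = y then 1 else 0

@[simp] theorem dl_self (y : X) : dl y y = 1 := by simp [dl]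

theorem tsum_mul_dl (g : X → ℝ≥0∞) (x : X) : ∑' y, g y * dl y x = g x := by
  rw [tsum_eq_single x]
  · simp [dl]
  · intro y hy
    simp [dl, hy.symm]

theorem kop_dl (k : X → X → ℝ≥0∞) (x y : X) : kop k (dl y) x = k x y := by
  rw [kop_apply, tsum_eq_single y]
  · simp [dl]
  · intro z hz
    simp [dl, hz]

theorem kop_pow_eq_tsum (k : X → X → ℝ≥0∞) (n : ℕ) (g : X → ℝ≥0∞) (x : X) :
    (kop k ^ n) g x = ∑' y, (kop k ^ n) (dl y) x * g y := by
  have h : g = fun x => ∑' y, (g y • dl y) x := by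
    funext x
    simp only [Pi.smul_apply, smul_eq_mul, tsum_mul_dl]
  conv_lhs => rw [h, kop_pow_tsum]
  refine tsum_congr fun y => ?_
  rw [map_smul, Pi.smul_apply, smul_eq_mul, mul_comm]

theorem le_kop_pow (k : X → X → ℝ≥0∞) (n : ℕ) (g : X → ℝ≥0∞) (x y : X) :
    (kop k ^ n) (dl y) x * g y ≤ (kop k ^ n) g x := by
  rw [kop_pow_eq_tsum k n g x]
  exact ENNReal.le_tsum (f := fun y => (kop k ^ n) (dl y) x * g y) y

theorem kop_pow_eq_kop (k : X → X → ℝ≥0∞) (n : ℕ) :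
    kop k ^ n = kop fun x y => (kop k ^ n) (dl y) x := by
  ext g x
  rw [kop_pow_eq_tsum, kop_apply]

theorem kop_pow_le_of_le {k : X → X → ℝ≥0∞} {u : X → ℝ≥0∞} (h : kop k u ≤ u) (n : ℕ) :
    (kop k ^ n) u ≤ u := by
  induction n with
  | zero => simp
  | succ n ih =>
    rw [pow_succ', Module.End.mul_apply]
    exact (kop_mono k ih).trans h

theorem kop_pow_le_smul {k : X → X → ℝ≥0∞} {u : X → ℝ≥0∞} {c : ℝ≥0∞} (h : kop k u ≤ c • u)
    (n : ℕ) : (kop k ^ n) u ≤ c ^ n • u := by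
  induction n with
  | zero => simp
  | succ n ih =>
    rw [pow_succ', Module.End.mul_apply]
    refine (kop_mono k ih).trans ?_
    rw [map_smul, pow_succ, mul_smul]
    exact smul_le_smul_of_nonneg_left h (zero_le)

/-- The potential `∑ n, k ^ n r`. -/
def pot (k : X → X → ℝ≥0∞) (r : X → ℝ≥0∞) : X → ℝ≥0∞ := fun x => ∑' n : ℕ, (kop k ^ n) r x

theorem kop_pow_pot (k : X → X → ℝ≥0∞) (r : X → ℝ≥0∞) (n : ℕ) (x : X) :
    (kop k ^ n) (pot k r) x = ∑' m : ℕ, (kop k ^ (m + n)) r x := by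
  unfold pot
  rw [kop_pow_tsum]
  refine tsum_congr fun m => ?_
  rw [add_comm, pow_add, Module.End.mul_apply]

theorem pot_eq (k : X → X → ℝ≥0∞) (r : X → ℝ≥0∞) : pot k r = r + kop k (pot k r) := by
  funext x
  have h := kop_pow_pot k r 1 x
  rw [pow_one] at h
  rw [Pi.add_apply, h]
  exact tsum_eq_zero_add' ENNReal.summable

theorem kop_pot_le (k : X → X → ℝ≥0∞) (r : X → ℝ≥0∞) : kop k (pot k r) ≤ pot k r := by
  conv_rhs => rw [pot_eq]
  exact le_add_self

theorem sum_add_pow_of_eq {k : X → X → ℝ≥0∞} {r u : X → ℝ≥0∞} (h : u = r + kop k u) (n : ℕ) :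
    u = (∑ j ∈ Finset.range n, (kop k ^ j) r) + (kop k ^ n) u := by
  induction n with
  | zero => simp
  | succ n ih =>
    conv_lhs => rw [ih]
    rw [Finset.sum_range_succ, add_assoc]
    congr 1
    conv_lhs => rw [h]
    rw [map_add, pow_succ, Module.End.mul_apply]

theorem sum_add_pow_of_le {k : X → X → ℝ≥0∞} {r u : X → ℝ≥0∞} (h : r + kop k u ≤ u) (n : ℕ) :
    (∑ j ∈ Finset.range n, (kop k ^ j) r) + (kop k ^ n) u ≤ u := by
  induction n with
  | zero => simp
  | succ n ih =>
    refine le_trans ?_ ih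
    rw [Finset.sum_range_succ, add_assoc]
    refine add_le_add le_rfl ?_
    refine le_trans ?_ (kop_pow_mono k n h)
    rw [map_add, pow_succ, Module.End.mul_apply]

theorem pot_le {k : X → X → ℝ≥0∞} {r u : X → ℝ≥0∞} (h : r + kop k u ≤ u) : pot k r ≤ u := by
  intro x
  refine ENNReal.tsum_le_of_sum_range_le fun n => ?_
  have := (le_self_add).trans (sum_add_pow_of_le h n)
  simpa [Finset.sum_apply] using this x

theorem pot_mono (k : X → X → ℝ≥0∞) : Monotone (pot k) := fun _ _ h x =>
  ENNReal.tsum_le_tsum fun n => kop_pow_mono k n h x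

theorem pot_le_pot {k k' : X → X → ℝ≥0∞} (h : ∀ x y, k x y ≤ k' x y) (r : X → ℝ≥0∞) :
    pot k r ≤ pot k' r := fun x =>
  ENNReal.tsum_le_tsum fun n => kop_pow_le_kop_pow h n r x

theorem tendsto_kop_pow_pot {k : X → X → ℝ≥0∞} {r : X → ℝ≥0∞} {x : X} (h : pot k r x ≠ ⊤) :
    Tendsto (fun n => (kop k ^ n) (pot k r) x) atTop (𝓝 0) := by
  simp only [kop_pow_pot]
  exact ENNReal.tendsto_sum_nat_add _ h

theorem eq_pot_of_tendsto {k : X → X → ℝ≥0∞} {r u : X → ℝ≥0∞} (h : u = r + kop k u) {x : X}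
    (h0 : Tendsto (fun n => (kop k ^ n) u x) atTop (𝓝 0)) : u x = pot k r x := by
  have h1 : Tendsto (fun n => (∑ j ∈ Finset.range n, (kop k ^ j) r) x + (kop k ^ n) u x) atTop
      (𝓝 (pot k r x + 0)) := by
    refine Tendsto.add ?_ h0
    simp only [Finset.sum_apply]
    exact ENNReal.tendsto_nat_tsum _
  rw [add_zero] at h1
  refine tendsto_nhds_unique (tendsto_const_nhds.congr fun n => ?_) h1
  have := congrFun (sum_add_pow_of_eq h n) x
  simpa using this

theorem pot_smul (k : X → X → ℝ≥0∞) (c : ℝ≥0∞) (f : X → ℝ≥0∞) (x : X) :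
    pot k (c • f) x = c * pot k f x := by
  unfold pot
  simp only [map_smul, Pi.smul_apply, smul_eq_mul]
  exact ENNReal.tsum_mul_left

end Kernels

end

noncomputable section

section Chernoff
variable {X : Type*}

theorem add_pow_apply {A B : Module.End ℝ≥0∞ (X → ℝ≥0∞)} (h : Commute A B) (n : ℕ)
    (f : X → ℝ≥0∞) (x : X) :
    ((A + B) ^ n) f x =
      ∑ m ∈ Finset.range (n + 1), (n.choose m : ℝ≥0∞) * (A ^ m * B ^ (n - m)) f x := by
  rw [h.add_pow, LinearMap.sum_apply, Finset.sum_apply]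
  refine Finset.sum_congr rfl fun m _ => ?_
  rw [← Nat.cast_comm, ← nsmul_eq_mul, LinearMap.smul_apply, Pi.smul_apply, nsmul_eq_mul]

theorem choose_le_chernoff {lam γ : ℝ} (hl : 0 < lam) (hγ : 0 ≤ γ) (t k : ℕ) :
    (t.choose k : ℝ) ≤ γ * (t + 1).choose (k + 1) +
      Real.exp (-(lam * γ)) ^ (t + 1) * Real.exp lam ^ (k + 1) * (t + 1).choose (k + 1) := by
  have h1 : ((t : ℝ) + 1) * t.choose k = (t + 1).choose (k + 1) * (k + 1) := by
    exact_mod_cast Nat.add_one_mul_choose_eq t k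
  have ht : (0 : ℝ) < (t : ℝ) + 1 := by positivity
  have h2 : (t.choose k : ℝ) = (t + 1).choose (k + 1) * ((k + 1) / (t + 1)) := by
    field_simp
    linarith
  rcases Nat.lt_or_ge t k with hkt | hkt
  · rw [Nat.choose_eq_zero_of_lt hkt, Nat.cast_zero]
    positivity
  have h3 : ((k : ℝ) + 1) / (t + 1) ≤
      γ + Real.exp (-(lam * γ)) ^ (t + 1) * Real.exp lam ^ (k + 1) := by
    rw [← Real.exp_nat_mul, ← Real.exp_nat_mul, ← Real.exp_add]
    push_cast
    have e : ((t : ℝ) + 1) * -(lam * γ) + (k + 1) * lam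
        = lam * ((t + 1) * ((k + 1) / (t + 1) - γ)) := by
      field_simp
      ring
    rw [e]
    rcases le_total (((k : ℝ) + 1) / (t + 1)) γ with hle | hle
    · have := Real.exp_pos (lam * ((t + 1) * (((k : ℝ) + 1) / (t + 1) - γ)))
      linarith
    · have h5 : ((k : ℝ) + 1) / (t + 1) ≤ 1 := by
        rw [div_le_one ht]
        exact_mod_cast Nat.succ_le_succ hkt
      have h6 : 0 ≤ lam * ((t + 1) * (((k : ℝ) + 1) / (t + 1) - γ)) := by
        have := sub_nonneg.2 hle
        positivity
      have := Real.one_le_exp h6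
      linarith
  rw [h2]
  have h7 : (0 : ℝ) ≤ (t + 1).choose (k + 1) := by positivity
  calc _ ≤ ((t + 1).choose (k + 1) : ℝ) *
        (γ + Real.exp (-(lam * γ)) ^ (t + 1) * Real.exp lam ^ (k + 1)) := by gcongr
    _ = _ := by ring

theorem mul_pow_le_chernoff {A B : Module.End ℝ≥0∞ (X → ℝ≥0∞)} (h : Commute A B)
    {lam γ : ℝ} (hl : 0 < lam) (hγ : 0 ≤ γ) (t : ℕ) (f : X → ℝ≥0∞) (x : X) :
    (A * (A + B) ^ t) f x ≤ ENNReal.ofReal γ * ((A + B) ^ (t + 1)) f x +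
      ENNReal.ofReal (Real.exp (-(lam * γ))) ^ (t + 1) *
        ((ENNReal.ofReal (Real.exp lam) • A + B) ^ (t + 1)) f x := by
  set L := ENNReal.ofReal (Real.exp lam)
  set c := ENNReal.ofReal (Real.exp (-(lam * γ)))
  have hc : Commute (L • A) B := h.smul_left L
  have e1 : (A * (A + B) ^ t) f x =
      ∑ m ∈ Finset.range (t + 1), (t.choose m : ℝ≥0∞) * (A ^ (m + 1) * B ^ (t - m)) f x := by
    have hcomm : Commute A ((A + B) ^ t) :=
      ((Commute.refl A).add_right h).pow_right t
    rw [hcomm.eq, Module.End.mul_apply, add_pow_apply h]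
    refine Finset.sum_congr rfl fun m _ => ?_
    have : (A ^ m * B ^ (t - m)) * A = A ^ (m + 1) * B ^ (t - m) := by
      rw [mul_assoc, (h.symm.pow_left (t - m)).eq, ← mul_assoc, pow_succ]
    rw [← this]
    rfl
  rw [e1, add_pow_apply h, add_pow_apply hc, Finset.sum_range_succ' _ (t + 1),
    Finset.sum_range_succ' _ (t + 1)]
  refine le_trans ?_ (add_le_add (mul_le_mul_right le_self_add _) (mul_le_mul_right le_self_add _))
  rw [Finset.mul_sum, Finset.mul_sum, ← Finset.sum_add_distrib]
  refine Finset.sum_le_sum fun m _ => ?_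
  have e2 : t + 1 - (m + 1) = t - m := by omega
  rw [e2, smul_pow, smul_mul_assoc, LinearMap.smul_apply, Pi.smul_apply, smul_eq_mul]
  set Q := (A ^ (m + 1) * B ^ (t - m)) f x
  have key : (t.choose m : ℝ≥0∞) ≤ ENNReal.ofReal γ * ((t + 1).choose (m + 1) : ℝ≥0∞) +
      c ^ (t + 1) * L ^ (m + 1) * ((t + 1).choose (m + 1) : ℝ≥0∞) := by
    have := ENNReal.ofReal_le_ofReal (choose_le_chernoff hl hγ t m)
    rw [ENNReal.ofReal_add (by positivity) (by positivity), ENNReal.ofReal_mul hγ,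
      ENNReal.ofReal_mul (by positivity), ENNReal.ofReal_mul (by positivity),
      ENNReal.ofReal_pow (by positivity), ENNReal.ofReal_pow (by positivity),
      ENNReal.ofReal_natCast, ENNReal.ofReal_natCast] at this
    exact this
  calc (t.choose m : ℝ≥0∞) * Q ≤ _ * Q := mul_le_mul_left key _
    _ = _ := by ring

/-- Comparison of the potential `u = ∑ₜ pᵗ f` with `a u`, when `p = a + b` with commuting
`a` and `b` : up to a geometrically decaying error, `a u ≤ γ u`. -/
theorem kop_pot_le_of_commute {a b p : X → X → ℝ≥0∞} (hp : kop p = kop a + kop b)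
    (hab : Commute (kop a) (kop b)) {lam γ : ℝ} (hl : 0 < lam) (hγ : 0 ≤ γ)
    {e f : X → ℝ≥0∞} {α' φ' ρ C : ℝ≥0∞}
    (ha : kop a e ≤ α' • e) (hpe : kop p e ≤ φ' • e) (hf : f ≤ C • e)
    (hρ : ENNReal.ofReal (Real.exp (-(lam * γ))) *
      (φ' + ENNReal.ofReal (Real.exp lam - 1) * α') ≤ ρ) (x : X) :
    kop a (pot p f) x ≤ ENNReal.ofReal γ * pot p f x + C * (1 - ρ)⁻¹ * e x := by
  set c := ENNReal.ofReal (Real.exp (-(lam * γ)))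
  set L := ENNReal.ofReal (Real.exp lam)
  have hL : L = ENNReal.ofReal (Real.exp lam - 1) + 1 := by
    rw [← ENNReal.ofReal_one, ← ENNReal.ofReal_add (by simpa using hl.le) zero_le_one]
    simp [L]
  have hY : kop (fun x y => L * a x y + b x y) = L • kop a + kop b := by
    ext g x
    simp only [LinearMap.add_apply, LinearMap.smul_apply, Pi.add_apply, Pi.smul_apply, smul_eq_mul,
      kop_apply, add_mul, mul_assoc]
    rw [ENNReal.tsum_add, ENNReal.tsum_mul_left]
  have hYe : kop (fun x y => L * a x y + b x y) e ≤
      (φ' + ENNReal.ofReal (Real.exp lam - 1) * α') • e := by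
    rw [hY, hL, add_smul, one_smul, add_assoc, ← hp, LinearMap.add_apply, LinearMap.smul_apply,
      add_comm, add_smul, mul_smul]
    exact add_le_add hpe (smul_le_smul_of_nonneg_left ha zero_le)
  have step : ∀ t : ℕ, (kop a * kop p ^ t) f x ≤ ENNReal.ofReal γ * (kop p ^ (t + 1)) f x +
      C * ρ ^ (t + 1) * e x := by
    intro t
    have h1 := mul_pow_le_chernoff hab hl hγ t f x
    rw [← hp, ← hY] at h1
    refine h1.trans (add_le_add le_rfl ?_)
    have h2 : ((kop fun x y => L * a x y + b x y) ^ (t + 1)) f ≤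
        C • ((φ' + ENNReal.ofReal (Real.exp lam - 1) * α') ^ (t + 1) • e) := by
      refine (kop_pow_mono _ (t + 1) hf).trans ?_
      rw [map_smul]
      exact smul_le_smul_of_nonneg_left (kop_pow_le_smul hYe (t + 1)) zero_le
    have h3 := mul_le_mul_right (h2 x) (c ^ (t + 1))
    refine h3.trans ?_
    simp only [Pi.smul_apply, smul_eq_mul]
    calc _ = C * (c * (φ' + ENNReal.ofReal (Real.exp lam - 1) * α')) ^ (t + 1) * e x := by
          rw [mul_pow]
          ring
      _ ≤ _ := by gcongr
  have h4 : kop a (pot p f) x = ∑' t : ℕ, (kop a * kop p ^ t) f x := by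
    unfold pot
    rw [kop_tsum]
    rfl
  rw [h4]
  refine (ENNReal.tsum_le_tsum step).trans ?_
  rw [ENNReal.tsum_add, ENNReal.tsum_mul_left]
  refine add_le_add (mul_le_mul_right ?_ _) ?_
  · exact ENNReal.tsum_comp_le_tsum_of_injective (add_left_injective 1)
      (fun t => (kop p ^ t) f x)
  · rw [ENNReal.tsum_mul_right, ENNReal.tsum_mul_left]
    gcongr
    rw [← ENNReal.tsum_geometric]
    exact ENNReal.tsum_comp_le_tsum_of_injective (add_left_injective 1) (fun t => ρ ^ t)

end Chernoff

end

noncomputable section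

section Walk
variable {V : Type*} [AddCommGroup V]

/-- One-step kernel of the walk with step weights `m`, killed outside `S`. -/
def ks (m : V → ℝ≥0∞) (S : Set V) (x y : V) : ℝ≥0∞ :=
  if x ∈ S ∧ y ∈ S then m (y - x) else 0

theorem ks_mono {m m' : V → ℝ≥0∞} (hm : ∀ z, m z ≤ m' z) {S S' : Set V} (hS : S ⊆ S') (x y : V) :
    ks m S x y ≤ ks m' S' x y := by
  unfold ks
  split_ifs with h1 h2 h2
  · exact hm _
  · exact absurd ⟨hS h1.1, hS h1.2⟩ h2
  · exact zero_le
  · exact zero_le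

theorem kop_ks_apply (m : V → ℝ≥0∞) (S : Set V) (f : V → ℝ≥0∞) (x : V) :
    kop (ks m S) f x = if x ∈ S then ∑' z, m z * (if x + z ∈ S then f (x + z) else 0) else 0 := by
  rw [kop_apply]
  split_ifs with h
  · rw [← (Equiv.addLeft x).tsum_eq]
    refine tsum_congr fun z => ?_
    simp only [Equiv.coe_addLeft, ks, h, true_and, add_sub_cancel_left]
    split_ifs <;> simp
  · simp [ks, h]

theorem kop_ks_of_notMem {m : V → ℝ≥0∞} {S : Set V} {x : V} (h : x ∉ S) (f : V → ℝ≥0∞) :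
    kop (ks m S) f x = 0 := by
  rw [kop_ks_apply, if_neg h]

theorem kop_ks_of_mem {m : V → ℝ≥0∞} {S : Set V} {x : V} (h : x ∈ S) {f : V → ℝ≥0∞}
    (hf : ∀ y, y ∉ S → f y = 0) : kop (ks m S) f x = ∑' z, m z * f (x + z) := by
  rw [kop_ks_apply, if_pos h]
  refine tsum_congr fun z => ?_
  split_ifs with hz
  · rfl
  · rw [hf _ hz]

theorem kop_ks_le (m : V → ℝ≥0∞) (S : Set V) (f : V → ℝ≥0∞) (x : V) :
    kop (ks m S) f x ≤ ∑' z, m z * f (x + z) := by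
  rw [kop_ks_apply]
  split_ifs with h
  · refine ENNReal.tsum_le_tsum fun z => ?_
    split_ifs <;> simp
  · exact zero_le

theorem kop_ks_pow_of_notMem {m : V → ℝ≥0∞} {S : Set V} {f : V → ℝ≥0∞}
    (hf : ∀ y, y ∉ S → f y = 0) (n : ℕ) {x : V} (h : x ∉ S) : (kop (ks m S) ^ n) f x = 0 := by
  cases n with
  | zero => exact hf x h
  | succ n => rw [pow_succ', Module.End.mul_apply, kop_ks_of_notMem h]

theorem pot_ks_of_notMem {m : V → ℝ≥0∞} {S : Set V} {f : V → ℝ≥0∞}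
    (hf : ∀ y, y ∉ S → f y = 0) {x : V} (h : x ∉ S) : pot (ks m S) f x = 0 := by
  simp [pot, kop_ks_pow_of_notMem hf _ h]

theorem dl_of_notMem {X : Type*} {S : Set X} {y : X} (hy : y ∈ S) (x : X) (hx : x ∉ S) : dl y x = 0 := by
  have : x ≠ y := fun h => hx (h ▸ hy)
  simp [dl, this]

theorem kop_ks_one_le {m : V → ℝ≥0∞} (hm : ∑' z, m z ≤ 1) (S : Set V) :
    kop (ks m S) 1 ≤ 1 := fun x => by
  refine (kop_ks_le m S 1 x).trans ?_
  simpa using hm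

theorem kop_ks_pow_dl_le_one {m : V → ℝ≥0∞} (hm : ∑' z, m z ≤ 1) (S : Set V) (n : ℕ) (y x : V) :
    (kop (ks m S) ^ n) (dl y) x ≤ 1 := by
  have h1 : dl y ≤ 1 := fun x => by
    simp only [dl, Pi.one_apply]
    split_ifs <;> simp
  exact (kop_pow_mono _ n h1 x).trans (kop_pow_le_of_le (kop_ks_one_le hm S) n x)

/-- The step weights as extended nonnegative reals. -/
def wt {X : Type*} (μ : X → ℝ) (z : X) : ℝ≥0∞ := ENNReal.ofReal (μ z)

theorem tsum_wt {X : Type*} {μ : X → ℝ} (hnn : ∀ z, 0 ≤ μ z) (hsum : HasSum μ 1) : ∑' z, wt μ z = 1 := by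
  unfold wt
  rw [← ENNReal.ofReal_tsum_of_nonneg hnn hsum.summable, hsum.tsum_eq, ENNReal.ofReal_one]

theorem kern_eq {μ : V → ℝ} (hnn : ∀ z, 0 ≤ μ z) (hsum : HasSum μ 1) {S : Set V} {y : V}
    (hy : y ∈ S) (n : ℕ) (x : V) :
    kern μ S n x y = ((kop (ks (wt μ) S) ^ n) (dl y) x).toReal := by
  induction n generalizing x with
  | zero =>
    simp only [kern, pow_zero, Module.End.one_apply, dl]
    by_cases h : x = y
    · simp [h, hy]
    · simp [h]
  | succ n ih =>
    have hfin : ∀ z, (kop (ks (wt μ) S) ^ n) (dl y) z ≠ ⊤ := fun z =>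
      ne_top_of_le_ne_top ENNReal.one_ne_top (kop_ks_pow_dl_le_one (tsum_wt hnn hsum).le S n y z)
    rw [pow_succ', Module.End.mul_apply, kop_apply, ENNReal.tsum_toReal_eq]
    · simp only [kern]
      refine tsum_congr fun z => ?_
      rw [ENNReal.toReal_mul, ih]
      by_cases hz : z ∈ S
      · by_cases hx : x ∈ S
        · simp [ks, hx, hz, wt, ENNReal.toReal_ofReal (hnn _)]
        · simp [ks, hx]
      · rw [kop_ks_pow_of_notMem (dl_of_notMem hy) n hz]
        simp
    · intro z
      refine ENNReal.mul_ne_top ?_ (hfin z)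
      unfold ks wt
      split_ifs <;> simp

theorem green_eq {μ : V → ℝ} (hnn : ∀ z, 0 ≤ μ z) (hsum : HasSum μ 1) {S : Set V} {y : V}
    (hy : y ∈ S) (x : V) : green μ S x y = (pot (ks (wt μ) S) (dl y) x).toReal := by
  unfold green pot
  rw [ENNReal.tsum_toReal_eq]
  · exact tsum_congr fun n => kern_eq hnn hsum hy n x
  · exact fun n => ne_top_of_le_ne_top ENNReal.one_ne_top
      (kop_ks_pow_dl_le_one (tsum_wt hnn hsum).le S n y x)

/-- A path with positive step probabilities which stays in a translate of the domain. -/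
theorem exists_pow_pos_of_path {μ : V → ℝ} {S : Set V} {k : ℕ} {c : ℕ → V}
    (hS : ∀ j ≤ k, c j ∈ S) (hpos : ∀ j < k, 0 < μ (c (j + 1) - c j)) :
    ∃ δ : ℝ≥0∞, δ ≠ 0 ∧ ∀ T : Set V, ∀ v : V, (∀ s ∈ S, s + v ∈ T) →
      δ ≤ (kop (ks (wt μ) T) ^ k) (dl (c k + v)) (c 0 + v) := by
  induction k generalizing c with
  | zero => exact ⟨1, one_ne_zero, fun T v _ => by simp⟩
  | succ k ih =>
    obtain ⟨δ, hδ, h⟩ := ih (c := fun j => c (j + 1)) (fun j hj => hS _ (by omega))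
      (fun j hj => hpos _ (by omega))
    refine ⟨wt μ (c 1 - c 0) * δ, mul_ne_zero ?_ hδ, fun T v hT => ?_⟩
    · simpa [wt] using hpos 0 (by omega)
    · rw [pow_succ', Module.End.mul_apply, kop_apply]
      refine le_trans ?_ (ENNReal.le_tsum (c 1 + v))
      refine mul_le_mul' ?_ (h T v hT)
      have h0 := hT _ (hS 0 (by omega))
      have h1 := hT _ (hS 1 (by omega))
      simp [ks, h0, h1]

end Walk

section Exponentials
variable {d : ℕ}

/-- The exponential function `x ↦ exp (a · x)`. -/
def ex (a : Fin d → ℝ) (x : Fin d → ℤ) : ℝ≥0∞ := ENNReal.ofReal (Real.exp (dotZ a x))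

theorem dotZ_add (a : Fin d → ℝ) (x y : Fin d → ℤ) : dotZ a (x + y) = dotZ a x + dotZ a y := by
  simp only [dotZ, Pi.add_apply, Int.cast_add, mul_add, Finset.sum_add_distrib]

theorem ex_add (a : Fin d → ℝ) (x y : Fin d → ℤ) : ex a (x + y) = ex a x * ex a y := by
  rw [ex, ex, ex, dotZ_add, Real.exp_add, ENNReal.ofReal_mul (Real.exp_pos _).le]

/-- The jump generating function of the step weights `m`. -/
def mgf (m : (Fin d → ℤ) → ℝ≥0∞) (a : Fin d → ℝ) : ℝ≥0∞ := ∑' z, m z * ex a z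

theorem kop_ks_ex_le (m : (Fin d → ℤ) → ℝ≥0∞) (S : Set (Fin d → ℤ)) (a : Fin d → ℝ) :
    kop (ks m S) (ex a) ≤ mgf m a • ex a := fun x => by
  refine (kop_ks_le m S _ x).trans (le_of_eq ?_)
  simp only [Pi.smul_apply, smul_eq_mul, mgf, ← ENNReal.tsum_mul_right, ex_add]
  exact tsum_congr fun z => by ring

theorem znorm_nonneg {ι : Type*} [Fintype ι] (z : ι → ℤ) : 0 ≤ znorm z :=
  Finset.sum_nonneg fun _ _ => abs_nonneg _

theorem abs_le_znorm {ι : Type*} [Fintype ι] (z : ι → ℤ) (i : ι) : |(z i : ℝ)| ≤ znorm z :=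
  Finset.single_le_sum (f := fun i => |(z i : ℝ)|) (fun _ _ => abs_nonneg _) (Finset.mem_univ i)

theorem znorm_add_le {ι : Type*} [Fintype ι] (y z : ι → ℤ) : znorm (y + z) ≤ znorm y + znorm z := by
  unfold znorm
  rw [← Finset.sum_add_distrib]
  refine Finset.sum_le_sum fun i _ => ?_
  push_cast [Pi.add_apply]
  exact abs_add_le _ _

theorem znorm_neg {ι : Type*} [Fintype ι] (z : ι → ℤ) : znorm (-z) = znorm z := by
  simp [znorm]

theorem znorm_sub_comm {ι : Type*} [Fintype ι] (y z : ι → ℤ) : znorm (y - z) = znorm (z - y) := by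
  rw [← znorm_neg, neg_sub]

theorem abs_dotZ_le {a : Fin d → ℝ} {κ : ℝ} (ha : ∀ i, |a i| ≤ κ) (z : Fin d → ℤ) :
    |dotZ a z| ≤ κ * znorm z := by
  unfold dotZ znorm
  rw [Finset.mul_sum]
  refine (Finset.abs_sum_le_sum_abs _ _).trans (Finset.sum_le_sum fun i _ => ?_)
  rw [abs_mul]
  exact mul_le_mul_of_nonneg_right (ha i) (abs_nonneg _)

/-- The vector of signs of `z`. -/
def sgn (z : Fin d → ℤ) : Fin d → ℝ := fun i => if 0 ≤ z i then 1 else -1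

theorem abs_sgn (z : Fin d → ℤ) (i : Fin d) : |sgn z i| = 1 := by
  unfold sgn
  split_ifs <;> simp

theorem dotZ_smul_sgn (κ : ℝ) (z : Fin d → ℤ) : dotZ (κ • sgn z) z = κ * znorm z := by
  unfold dotZ znorm
  rw [Finset.mul_sum]
  refine Finset.sum_congr rfl fun i _ => ?_
  simp only [Pi.smul_apply, smul_eq_mul, sgn, mul_assoc]
  congr 1
  split_ifs with h
  · rw [one_mul, abs_of_nonneg (by exact_mod_cast h)]
  · rw [abs_of_neg (by exact_mod_cast not_le.1 h)]
    ring

end Exponentials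

end

noncomputable section

theorem exists_chernoff_const {α γ : ℝ} (hα : 0 ≤ α) (hγ : α < γ) :
    ∃ lam > 0, ∃ ε > 0, ∃ ρ < 1, 0 < ρ ∧
      Real.exp (-(lam * γ)) * ((1 + ε) + (Real.exp lam - 1) * (α + ε)) ≤ ρ := by
  set lam := min 1 ((γ - α) / (2 * (α + 1))) with hlam
  have hl0 : 0 < lam := lt_min one_pos (div_pos (by linarith) (by linarith))
  have hl1 : lam ≤ 1 := min_le_left _ _
  have hl2 : lam * (2 * (α + 1)) ≤ γ - α := by
    rw [← le_div_iff₀ (by linarith)]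
    exact min_le_right _ _
  have h1 : Real.exp lam - 1 ≤ lam + lam ^ 2 := by
    have := Real.abs_exp_sub_one_sub_id_le (x := lam) (by rwa [abs_of_pos hl0])
    have := (abs_le.1 this).2
    linarith
  have h2 : 1 + (Real.exp lam - 1) * α < Real.exp (lam * γ) := by
    have h3 := Real.add_one_le_exp (lam * γ)
    nlinarith [mul_le_mul_of_nonneg_right h1 hα]
  have h4 : Tendsto (fun ε : ℝ => Real.exp (-(lam * γ)) * ((1 + ε) + (Real.exp lam - 1) * (α + ε)))
      (𝓝[>] 0) (𝓝 (Real.exp (-(lam * γ)) * ((1 + 0) + (Real.exp lam - 1) * (α + 0)))) := by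
    refine tendsto_nhdsWithin_of_tendsto_nhds ?_
    exact Continuous.tendsto (by fun_prop) 0
  have h5 : Real.exp (-(lam * γ)) * ((1 + 0) + (Real.exp lam - 1) * (α + 0)) < 1 := by
    rw [Real.exp_neg, inv_mul_lt_iff₀ (Real.exp_pos _), mul_one]
    simpa using h2
  obtain ⟨ρ, hρ1, hρ2⟩ := exists_between h5
  obtain ⟨ε, hε, hε0⟩ := ((h4.eventually_le_const hρ1).and self_mem_nhdsWithin).exists
  refine ⟨lam, hl0, ε, hε0, ρ, hρ2, ?_, hε⟩
  refine lt_of_lt_of_le ?_ hε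
  have := Real.add_one_le_exp lam
  have hε0' : (0 : ℝ) < ε := hε0
  have h6 : 0 ≤ (Real.exp lam - 1) * (α + ε) := mul_nonneg (by linarith) (by linarith)
  exact mul_pos (Real.exp_pos _) (by linarith)

/-- Uniform version of `kop_pot_le_of_commute`. -/
theorem exists_kop_pot_le_of_commute {α γ : ℝ} (hα : 0 ≤ α) (hγ : α < γ) :
    ∃ ε > 0, ∃ D : ℝ≥0∞, D ≠ ⊤ ∧ ∀ (X : Type) (a b p : X → X → ℝ≥0∞), kop p = kop a + kop b →
      Commute (kop a) (kop b) → ∀ (e f : X → ℝ≥0∞) (C : ℝ≥0∞),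
      kop a e ≤ ENNReal.ofReal (α + ε) • e → kop p e ≤ ENNReal.ofReal (1 + ε) • e →
      f ≤ C • e → ∀ x, kop a (pot p f) x ≤ ENNReal.ofReal γ * pot p f x + C * D * e x := by
  obtain ⟨lam, hl, ε, hε, ρ, hρ1, hρ0, h⟩ := exists_chernoff_const hα hγ
  refine ⟨ε, hε, (1 - ENNReal.ofReal ρ)⁻¹, ?_, ?_⟩
  · rw [ne_eq, ENNReal.inv_eq_top, tsub_eq_zero_iff_le, not_le]
    simpa using hρ1
  · intro X a b p hp hab e f C ha hpe hf x
    have := Real.add_one_le_exp lam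
    refine kop_pot_le_of_commute hp hab hl (hα.trans hγ.le) ha hpe hf ?_ x
    rw [← ENNReal.ofReal_mul (by linarith), ← ENNReal.ofReal_add (by linarith)
      (mul_nonneg (by linarith) (by linarith)), ← ENNReal.ofReal_mul (Real.exp_pos _).le]
    exact ENNReal.ofReal_le_ofReal h

theorem exp_le_quadratic (t : ℝ) : Real.exp t ≤ 1 + t + |t| ^ 2 * Real.exp |t| := by
  have h1 := Real.one_le_exp (abs_nonneg t)
  have h2 : |t| ^ 2 ≤ |t| ^ 2 * Real.exp |t| := le_mul_of_one_le_right (by positivity) h1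
  rcases le_or_gt |t| 1 with h | h
  · have := (abs_le.1 (Real.abs_exp_sub_one_sub_id_le h)).2
    rw [← sq_abs] at this
    linarith
  · rcases le_or_gt 0 t with h0 | h0
    · rw [abs_of_nonneg h0] at *
      have h3 : Real.exp t ≤ t ^ 2 * Real.exp t :=
        le_mul_of_one_le_left (Real.exp_pos t).le (by nlinarith)
      linarith
    · have := Real.exp_le_one_iff.2 h0.le
      rw [abs_of_neg h0] at *
      nlinarith

variable {d : ℕ}

/-- The standing assumptions on the step distribution. -/
structure Standing (μ : (Fin d → ℤ) → ℝ) : Prop where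
  nonneg : ∀ z, 0 ≤ μ z
  sum : HasSum μ 1
  irred : A1 μ
  expMoment : A2 μ
  drift : A3 μ
  mixed : ∀ z i j, i ≠ j → Mvec μ i = 0 → Mvec μ j = 0 → z i ≠ 0 → z j ≠ 0 → μ z = 0
  driftNonneg : ∀ i, 0 ≤ Mvec μ i

theorem eq_zero_of_muL {μ : (Fin d → ℤ) → ℝ} (hnn : ∀ z, 0 ≤ μ z) (hsum : HasSum μ 1)
    (hA4 : ∀ u : ↥(LambdaM μ) → ℤ,
      (∃ i j : ↥(LambdaM μ), i ≠ j ∧ u i ≠ 0 ∧ u j ≠ 0) → muL μ (LambdaM μ) u = 0)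
    (z : Fin d → ℤ) (i j : Fin d) (hij : i ≠ j) (hi : Mvec μ i = 0) (hj : Mvec μ j = 0)
    (hzi : z i ≠ 0) (hzj : z j ≠ 0) : μ z = 0 := by
  have h := hA4 (projL (LambdaM μ) z) ⟨⟨i, hi⟩, ⟨j, hj⟩, fun e => hij (congrArg Subtype.val e), hzi, hzj⟩
  have hs : Summable fun x => if projL (LambdaM μ) x = projL (LambdaM μ) z then μ x else 0 :=
    Summable.of_nonneg_of_le (fun x => by split_ifs <;> simp [hnn])
      (fun x => by split_ifs <;> simp [hnn]) hsum.summable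
  have h0 := (hasSum_zero_iff_of_nonneg fun x => by
    show 0 ≤ if projL (LambdaM μ) x = projL (LambdaM μ) z then μ x else 0
    split_ifs <;> simp [hnn]).1 ((hs.hasSum_iff).2 h)
  simpa using congrFun h0 z

namespace Standing
variable {μ : (Fin d → ℤ) → ℝ}

theorem tsum_wt (h : Standing μ) : ∑' z, wt μ z = 1 := KilledWalk.tsum_wt h.nonneg h.sum

theorem exists_summable_exp (h : Standing μ) :
    ∃ c > 0, Summable fun z => μ z * Real.exp (c * znorm z) := by
  obtain ⟨U, hU, hDU, hfin⟩ := h.expMoment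
  have h0 : (0 : Fin d → ℝ) ∈ U := by
    apply hDU
    have : phiE μ 0 = 1 := by
      simp only [phiE, dotZ, Pi.zero_apply, zero_mul, Finset.sum_const_zero, Real.exp_zero, mul_one]
      exact h.tsum_wt
    exact this.le
  obtain ⟨r, hr, hball⟩ := Metric.isOpen_iff.1 hU 0 h0
  have hsumm : ∀ s : Finset (Fin d), Summable fun z =>
      μ z * Real.exp (dotZ (fun i => if i ∈ s then r / 2 else -(r / 2)) z) := by
    intro s
    have hmem : (fun i => if i ∈ s then r / 2 else -(r / 2)) ∈ U := by
      apply hball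
      rw [mem_ball_zero_iff, pi_norm_lt_iff hr]
      intro i
      rw [Real.norm_eq_abs]
      split_ifs
      · rw [abs_of_pos (by linarith)]; linarith
      · rw [abs_neg, abs_of_pos (by linarith)]; linarith
    have := ENNReal.summable_toReal (hfin _ hmem)
    refine this.congr fun z => ?_
    exact ENNReal.toReal_ofReal (mul_nonneg (h.nonneg z) (Real.exp_pos _).le)
  refine ⟨r / 2, by linarith, Summable.of_nonneg_of_le
    (fun z => mul_nonneg (h.nonneg z) (Real.exp_pos _).le) (fun z => ?_)
    (summable_sum (s := Finset.univ) fun s _ => hsumm s)⟩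
  have hz : r / 2 * znorm z =
      dotZ (fun i => if i ∈ Finset.univ.filter (fun i => 0 ≤ z i) then r / 2 else -(r / 2)) z := by
    rw [← dotZ_smul_sgn]
    congr 1
    funext i
    simp only [Pi.smul_apply, smul_eq_mul, sgn, Finset.mem_filter, Finset.mem_univ, true_and]
    split_ifs <;> ring
  rw [hz]
  exact Finset.single_le_sum
    (f := fun s : Finset (Fin d) =>
      μ z * Real.exp (dotZ (fun i => if i ∈ s then r / 2 else -(r / 2)) z))
    (fun s _ => mul_nonneg (h.nonneg z) (Real.exp_pos _).le) (Finset.mem_univ _)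

theorem summable_mean (h : Standing μ) (i : Fin d) : Summable fun z => μ z * (z i : ℝ) := by
  obtain ⟨c, hc, hs⟩ := h.exists_summable_exp
  refine Summable.of_norm_bounded (hs.mul_left (1 / c)) fun z => ?_
  rw [Real.norm_eq_abs, abs_mul, abs_of_nonneg (h.nonneg z)]
  have h1 := abs_le_znorm z i
  have h2 := Real.add_one_le_exp (c * znorm z)
  have h3 : znorm z ≤ 1 / c * Real.exp (c * znorm z) := by
    rw [one_div, ← div_eq_inv_mul, le_div_iff₀ hc]
    linarith
  calc μ z * |(z i : ℝ)| ≤ μ z * (1 / c * Real.exp (c * znorm z)) :=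
        mul_le_mul_of_nonneg_left (h1.trans h3) (h.nonneg z)
    _ = _ := by ring

theorem hasSum_dotZ (h : Standing μ) (a : Fin d → ℝ) :
    HasSum (fun z => μ z * dotZ a z) (dotR a (Mvec μ)) := by
  have := hasSum_sum (s := Finset.univ) (f := fun i z => a i * (μ z * (z i : ℝ)))
    (fun i _ => ((h.summable_mean i).hasSum.mul_left (a i)))
  have e : (fun z => μ z * dotZ a z) = fun z => ∑ i, a i * (μ z * (z i : ℝ)) := by
    funext z
    unfold dotZ
    rw [Finset.mul_sum]
    exact Finset.sum_congr rfl fun i _ => by ring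
  rw [e]
  exact this

theorem exists_mgf_le (h : Standing μ) : ∃ c > 0, ∃ C > 0, ∀ κ ≤ c, ∀ a : Fin d → ℝ,
    (∀ i, |a i| ≤ κ) → mgf (wt μ) a ≤ ENNReal.ofReal (Real.exp (dotR a (Mvec μ) + C * κ ^ 2)) := by
  obtain ⟨c, hc, hs⟩ := h.exists_summable_exp
  set C := 16 / c ^ 2 * ∑' z, μ z * Real.exp (c * znorm z)
  have hC0 : 0 ≤ C := mul_nonneg (by positivity)
    (tsum_nonneg fun z => mul_nonneg (h.nonneg z) (Real.exp_pos _).le)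
  refine ⟨c / 2, by linarith, C + 1, by linarith, fun κ hκ a ha => ?_⟩
  have hpt : ∀ z, μ z * Real.exp (dotZ a z) ≤ μ z + μ z * dotZ a z +
      κ ^ 2 * (16 / c ^ 2 * (μ z * Real.exp (c * znorm z))) := by
    intro z
    have hN := znorm_nonneg z
    have ht := abs_dotZ_le ha z
    have hκN : κ * znorm z ≤ c / 2 * znorm z := mul_le_mul_of_nonneg_right hκ hN
    have h0 : 0 ≤ κ * znorm z := (abs_nonneg _).trans ht
    have h1 : Real.exp (dotZ a z) ≤ 1 + dotZ a z + |dotZ a z| ^ 2 * Real.exp |dotZ a z| := by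
      exact exp_le_quadratic _
    have h2 : |dotZ a z| ^ 2 * Real.exp |dotZ a z| ≤ (κ * znorm z) ^ 2 * Real.exp (c / 2 * znorm z) := by
      gcongr
      exact ht.trans hκN
    have h3 : znorm z ^ 2 ≤ 16 / c ^ 2 * Real.exp (c / 2 * znorm z) := by
      have h4 := Real.add_one_le_exp (c / 4 * znorm z)
      have h5 : c / 4 * znorm z ≤ Real.exp (c / 4 * znorm z) := by linarith
      have h6 : (c / 4 * znorm z) ^ 2 ≤ Real.exp (c / 4 * znorm z) ^ 2 := by gcongr
      rw [← Real.exp_nat_mul] at h6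
      have h7 : ((2 : ℕ) : ℝ) * (c / 4 * znorm z) = c / 2 * znorm z := by push_cast; ring
      rw [h7] at h6
      rw [div_mul_eq_mul_div, le_div_iff₀ (by positivity)]
      nlinarith
    have h8 : Real.exp (c * znorm z) = Real.exp (c / 2 * znorm z) * Real.exp (c / 2 * znorm z) := by
      rw [← Real.exp_add]
      ring_nf
    have h9 : (κ * znorm z) ^ 2 * Real.exp (c / 2 * znorm z) ≤
        κ ^ 2 * (16 / c ^ 2 * Real.exp (c * znorm z)) := by
      rw [h8, mul_pow, mul_assoc]
      refine mul_le_mul_of_nonneg_left ?_ (sq_nonneg κ)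
      rw [← mul_assoc]
      exact mul_le_mul_of_nonneg_right h3 (Real.exp_pos _).le
    calc μ z * Real.exp (dotZ a z) ≤
          μ z * (1 + dotZ a z + κ ^ 2 * (16 / c ^ 2 * Real.exp (c * znorm z))) :=
          mul_le_mul_of_nonneg_left (by linarith) (h.nonneg z)
      _ = _ := by ring
  have hsum := (h.sum.add (h.hasSum_dotZ a)).add ((hs.hasSum.mul_left (16 / c ^ 2)).mul_left (κ ^ 2))
  have hs' : Summable fun z => μ z * Real.exp (dotZ a z) :=
    Summable.of_nonneg_of_le (fun z => mul_nonneg (h.nonneg z) (Real.exp_pos _).le) hpt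
      hsum.summable
  have hle := hasSum_le hpt hs'.hasSum hsum
  have hm : mgf (wt μ) a = ENNReal.ofReal (∑' z, μ z * Real.exp (dotZ a z)) := by
    rw [ENNReal.ofReal_tsum_of_nonneg (fun z => mul_nonneg (h.nonneg z) (Real.exp_pos _).le) hs']
    exact tsum_congr fun z => (ENNReal.ofReal_mul (h.nonneg z)).symm
  rw [hm]
  refine ENNReal.ofReal_le_ofReal (hle.trans ?_)
  have := Real.add_one_le_exp (dotR a (Mvec μ) + (C + 1) * κ ^ 2)
  have hC : κ ^ 2 * (16 / c ^ 2 * ∑' z, μ z * Real.exp (c * znorm z)) = C * κ ^ 2 := by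
    simp only [C]; ring
  rw [hC]
  nlinarith [sq_nonneg κ]

theorem exists_tsum_exp_le (h : Standing μ) : ∃ c > 0, ∃ C ≥ 0, ∀ κ ≥ 0, κ ≤ c →
    ∀ m : (Fin d → ℤ) → ℝ≥0∞, (∀ z, m z ≤ wt μ z) →
    ∑' z, m z * ENNReal.ofReal (Real.exp (κ * znorm z)) ≤ ∑' z, m z + ENNReal.ofReal (κ * C) := by
  obtain ⟨c, hc, hs⟩ := h.exists_summable_exp
  have hnn : ∀ z, 0 ≤ 2 / c * (μ z * Real.exp (c * znorm z)) := fun z =>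
    mul_nonneg (by positivity) (mul_nonneg (h.nonneg z) (Real.exp_pos _).le)
  refine ⟨c / 2, by linarith, ∑' z, 2 / c * (μ z * Real.exp (c * znorm z)), tsum_nonneg hnn,
    fun κ hκ0 hκ m hm => ?_⟩
  rw [ENNReal.ofReal_mul hκ0, ENNReal.ofReal_tsum_of_nonneg hnn (hs.mul_left _),
    ← ENNReal.tsum_mul_left, ← ENNReal.tsum_add]
  refine ENNReal.tsum_le_tsum fun z => ?_
  have hN := znorm_nonneg z
  have h1 : Real.exp (κ * znorm z) ≤ 1 + κ * (2 / c * Real.exp (c * znorm z)) := by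
    have h2 : Real.exp (κ * znorm z) - 1 ≤ κ * znorm z * Real.exp (κ * znorm z) := by
      have := Real.add_one_le_exp (-(κ * znorm z))
      have h3 : Real.exp (-(κ * znorm z)) * Real.exp (κ * znorm z) = 1 := by
        rw [← Real.exp_add]; simp
      nlinarith [Real.exp_pos (κ * znorm z)]
    have h4 : Real.exp (κ * znorm z) ≤ Real.exp (c / 2 * znorm z) := by gcongr
    have h5 : znorm z ≤ 2 / c * Real.exp (c / 2 * znorm z) := by
      have := Real.add_one_le_exp (c / 2 * znorm z)
      rw [div_mul_eq_mul_div, le_div_iff₀ hc]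
      linarith
    have h8 : Real.exp (c * znorm z) = Real.exp (c / 2 * znorm z) * Real.exp (c / 2 * znorm z) := by
      rw [← Real.exp_add]
      ring_nf
    have h6 : znorm z * Real.exp (κ * znorm z) ≤ 2 / c * Real.exp (c * znorm z) := by
      rw [h8, ← mul_assoc]
      gcongr
    nlinarith [mul_le_mul_of_nonneg_left h6 hκ0]
  calc m z * ENNReal.ofReal (Real.exp (κ * znorm z))
      ≤ m z * ENNReal.ofReal (1 + κ * (2 / c * Real.exp (c * znorm z))) := by gcongr
    _ = m z + ENNReal.ofReal κ * (m z * ENNReal.ofReal (2 / c * Real.exp (c * znorm z))) := by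
        rw [ENNReal.ofReal_add zero_le_one (by positivity), ENNReal.ofReal_mul hκ0,
          ENNReal.ofReal_one]
        ring
    _ ≤ _ := by
        gcongr
        have e : 2 / c * (μ z * Real.exp (c * znorm z)) =
          μ z * (2 / c * Real.exp (c * znorm z)) := by ring
        rw [e, ENNReal.ofReal_mul (h.nonneg z)]
        gcongr
        exact hm z

end Standing

end

noncomputable section

variable {d : ℕ} {μ : (Fin d → ℤ) → ℝ}

namespace Standing

theorem exists_pow_pos (h : Standing μ) (Λ : Set (Fin d)) (e : Fin d → ℤ) :
    ∃ k : ℕ, ∃ δ : ℝ≥0∞, δ ≠ 0 ∧ (e ≠ 0 → k ≠ 0) ∧ ∀ x ∈ posDom Λ, x + e ∈ posDom Λ →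
      δ ≤ (kop (ks (wt μ) (posDom Λ)) ^ k) (dl (x + e)) x := by
  set b : Fin d → ℤ := fun i => max 1 (1 - e i)
  have hb : b ∈ posDom Λ := fun i _ => lt_of_lt_of_le one_pos (le_max_left _ _)
  have hbe : b + e ∈ posDom Λ := fun i _ => by
    have := le_max_right 1 (1 - e i)
    simp only [Pi.add_apply, b]
    omega
  obtain ⟨k, c, h0, hk, hS, hpos⟩ := h.irred Λ b hb (b + e) hbe
  obtain ⟨δ, hδ, H⟩ := exists_pow_pos_of_path hS hpos
  refine ⟨k, δ, hδ, ?_, fun x hx hxe => ?_⟩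
  · rintro he rfl
    apply he
    rw [h0] at hk
    simpa using hk
  · have := H (posDom Λ) (x - b) (fun s hs i hi => by
      have h1 := hs i hi
      have h2 := hx i hi
      have h3 := hxe i hi
      simp only [Pi.add_apply, Pi.sub_apply, b] at h3 ⊢
      have h4 : max 1 (1 - e i) ≤ x i := max_le (by omega) (by omega)
      omega)
    rw [h0, hk] at this
    convert this using 2
    · congr 1
      abel
    · abel

theorem exists_harnack_step (h : Standing μ) (Λ : Set (Fin d)) (e : Fin d → ℤ) :
    ∃ θ ≥ 0, ∀ u : (Fin d → ℤ) → ℝ≥0∞, kop (ks (wt μ) (posDom Λ)) u ≤ u →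
      ∀ x ∈ posDom Λ, x + e ∈ posDom Λ → u (x + e) ≤ ENNReal.ofReal (Real.exp θ) * u x := by
  obtain ⟨k, δ, hδ, -, H⟩ := h.exists_pow_pos Λ e
  have hδ' : min δ 1 ≠ 0 := by simp [hδ]
  have hδt : min δ 1 ≠ ⊤ := by simp
  have hpos : 0 < (min δ 1).toReal := ENNReal.toReal_pos hδ' hδt
  refine ⟨-Real.log (min δ 1).toReal, ?_, fun u hu x hx hxe => ?_⟩
  · have : (min δ 1).toReal ≤ 1 := by
      rw [← ENNReal.toReal_one]
      exact ENNReal.toReal_mono ENNReal.one_ne_top (min_le_right _ _)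
    have := Real.log_nonpos hpos.le this
    linarith
  · rw [Real.exp_neg, Real.exp_log hpos, ENNReal.ofReal_inv_of_pos hpos, ENNReal.ofReal_toReal hδt,
      mul_comm, ← div_eq_mul_inv, ENNReal.le_div_iff_mul_le (Or.inl hδ') (Or.inl hδt), mul_comm]
    calc min δ 1 * u (x + e) ≤ (kop (ks (wt μ) (posDom Λ)) ^ k) (dl (x + e)) x * u (x + e) := by
          gcongr
          exact (min_le_left _ _).trans (H x hx hxe)
      _ ≤ _ := le_kop_pow _ _ _ _ _
      _ ≤ u x := kop_pow_le_of_le hu k x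

theorem exists_harnack (h : Standing μ) (Λ : Set (Fin d)) :
    ∃ θ ≥ 0, ∀ u : (Fin d → ℤ) → ℝ≥0∞, kop (ks (wt μ) (posDom Λ)) u ≤ u →
      ∀ x ∈ posDom Λ, ∀ y ∈ posDom Λ,
        u y ≤ ENNReal.ofReal (Real.exp (θ * znorm (y - x))) * u x := by
  choose θ hθ H using h.exists_harnack_step Λ
  set Θ := ∑ i : Fin d, (θ (Pi.single i 1) + θ (Pi.single i (-1)))
  have hΘ : ∀ i, θ (Pi.single i 1) ≤ Θ ∧ θ (Pi.single i (-1)) ≤ Θ := fun i => by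
    have := Finset.single_le_sum
      (f := fun i : Fin d => θ (Pi.single i 1) + θ (Pi.single i (-1)))
      (fun i _ => add_nonneg (hθ _) (hθ _)) (Finset.mem_univ i)
    have h1 := hθ (Pi.single i 1)
    have h2 := hθ (Pi.single i (-1))
    constructor <;> simp only [Θ] <;> linarith
  have hΘ0 : 0 ≤ Θ := Finset.sum_nonneg fun i _ => add_nonneg (hθ _) (hθ _)
  refine ⟨Θ, hΘ0, fun u hu => ?_⟩
  have key : ∀ n : ℕ, ∀ x ∈ posDom Λ, ∀ y ∈ posDom Λ, ∑ i, (y i - x i).natAbs = n →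
      u y ≤ ENNReal.ofReal (Real.exp (Θ * n)) * u x := by
    intro n
    induction n with
    | zero =>
      intro x _ y _ hxy
      have : y = x := by
        funext i
        have := Finset.sum_eq_zero_iff.1 hxy i (Finset.mem_univ i)
        omega
      simp [this]
    | succ n ih =>
      intro x hx y hy hxy
      obtain ⟨i, hi⟩ : ∃ i, y i ≠ x i := by
        by_contra! hcon
        simp [hcon] at hxy
      have step : ∀ s : ℤ, (s = 1 ∨ s = -1) → x + Pi.single i s ∈ posDom Λ →
          (y i - x i).natAbs = (y i - (x i + s)).natAbs + 1 →
          u y ≤ ENNReal.ofReal (Real.exp (Θ * (n + 1 : ℕ))) * u x := by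
        intro s hs hmem hab
        have h1 := H (Pi.single i s) u hu x hx hmem
        have hsum : ∑ l, (y l - (x + Pi.single i s : Fin d → ℤ) l).natAbs = n := by
          rw [← Finset.add_sum_erase _ _ (Finset.mem_univ i)] at hxy ⊢
          have : ∑ l ∈ Finset.univ.erase i, (y l - (x + Pi.single i s : Fin d → ℤ) l).natAbs =
              ∑ l ∈ Finset.univ.erase i, (y l - x l).natAbs :=
            Finset.sum_congr rfl fun l hl => by simp [(Finset.mem_erase.1 hl).1]
          rw [this]
          simp only [Pi.add_apply, Pi.single_eq_same]
          omega
        have h2 := ih _ hmem y hy hsum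
        have h3 : θ (Pi.single i s) ≤ Θ := by
          rcases hs with rfl | rfl
          · exact (hΘ i).1
          · exact (hΘ i).2
        refine h2.trans ((mul_le_mul_right h1 _).trans ?_)
        rw [← mul_assoc, ← ENNReal.ofReal_mul (Real.exp_pos _).le, ← Real.exp_add]
        gcongr
        push_cast
        linarith
      rcases lt_or_gt_of_ne hi with hlt | hlt
      · refine step (-1) (Or.inr rfl) (fun l hl => ?_) (by omega)
        rcases eq_or_ne l i with rfl | hne
        · have := hy l hl
          simp only [Pi.add_apply, Pi.single_eq_same]
          omega
        · simpa [hne] using hx l hl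
      · refine step 1 (Or.inl rfl) (fun l hl => ?_) (by omega)
        rcases eq_or_ne l i with rfl | hne
        · have := hx l hl
          simp only [Pi.add_apply, Pi.single_eq_same]
          omega
        · simpa [hne] using hx l hl
  intro x hx y hy
  have := key _ x hx y hy rfl
  have e : ((∑ i, (y i - x i).natAbs : ℕ) : ℝ) = znorm (y - x) := by
    rw [Nat.cast_sum]
    refine Finset.sum_congr rfl fun i _ => ?_
    rw [Nat.cast_natAbs, Int.cast_abs]
    simp
  rwa [e] at this

end Standing

theorem one_mem_posDom (Λ : Set (Fin d)) : (1 : Fin d → ℤ) ∈ posDom Λ := fun _ _ => one_pos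

theorem posAll_eq : (posAll : Set (Fin d → ℤ)) = posDom Set.univ := by
  ext x
  simp [posAll, posDom]

theorem posDom_anti {Λ Λ' : Set (Fin d)} (h : Λ ⊆ Λ') : posDom Λ' ⊆ posDom Λ :=
  fun _ hx i hi => hx i (h hi)

theorem dl_le_pot {X : Type*} (k : X → X → ℝ≥0∞) (r : X → ℝ≥0∞) : r ≤ pot k r := by
  conv_rhs => rw [pot_eq]
  exact le_self_add

end

noncomputable section

variable {d : ℕ} {μ : (Fin d → ℤ) → ℝ}

theorem ex_sub_mul (a : Fin d → ℝ) (x y : Fin d → ℤ) :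
    ex (-a) y * ex a x = ENNReal.ofReal (Real.exp (dotZ a (x - y))) := by
  rw [ex, ex, ← ENNReal.ofReal_mul (Real.exp_pos _).le, ← Real.exp_add]
  congr 2
  simp only [dotZ, Pi.neg_apply, Pi.sub_apply, Int.cast_sub, ← Finset.sum_add_distrib]
  exact Finset.sum_congr rfl fun i _ => by ring

theorem dl_le_ex (a : Fin d → ℝ) (y : Fin d → ℤ) : dl y ≤ ex (-a) y • ex a := by
  intro x
  simp only [Pi.smul_apply, smul_eq_mul, ex_sub_mul]
  by_cases hxy : x = y
  · simp [hxy, dl, dotZ]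
  · simp [dl, hxy]

theorem pot_dl_le_of_mgf_lt_one {m : (Fin d → ℤ) → ℝ≥0∞} {a : Fin d → ℝ} (ha : mgf m a < 1)
    (S : Set (Fin d → ℤ)) (x y : Fin d → ℤ) :
    pot (ks m S) (dl y) x ≤ (1 - mgf m a)⁻¹ * ENNReal.ofReal (Real.exp (dotZ a (x - y))) := by
  have h1 : 1 - mgf m a ≠ 0 := (tsub_pos_of_lt ha).ne'
  have h2 : 1 - mgf m a ≠ ⊤ := ne_top_of_le_ne_top ENNReal.one_ne_top tsub_le_self
  set c := (1 - mgf m a)⁻¹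
  have hc : c = 1 + mgf m a * c := by
    have : (1 - mgf m a) + mgf m a = 1 := tsub_add_cancel_of_le ha.le
    calc c = ((1 - mgf m a) + mgf m a) * c := by rw [this, one_mul]
      _ = _ := by rw [add_mul, ENNReal.mul_inv_cancel h1 h2]
  have key : pot (ks m S) (dl y) ≤ c • ex (-a) y • ex a := by
    refine pot_le ?_
    rw [map_smul, map_smul]
    refine (add_le_add (dl_le_ex a y) (smul_le_smul_of_nonneg_left
      (smul_le_smul_of_nonneg_left (kop_ks_ex_le m S a) zero_le) zero_le)).trans (le_of_eq ?_)
    conv_rhs => rw [hc]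
    funext z
    simp only [Pi.add_apply, Pi.smul_apply, smul_eq_mul]
    ring
  refine (key x).trans (le_of_eq ?_)
  simp only [Pi.smul_apply, smul_eq_mul, ex_sub_mul]

namespace Standing

theorem exists_pos_drift (h : Standing μ) : ∃ j, 0 < Mvec μ j := by
  by_contra! hcon
  exact h.drift (funext fun j => le_antisymm (hcon j) (h.driftNonneg j))

theorem exists_mgf_neg_lt_one (h : Standing μ) {j : Fin d} (hj : 0 < Mvec μ j) :
    ∃ c > 0, ∀ κ > 0, κ ≤ c → mgf (wt μ) (Pi.single j (-κ)) < 1 := by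
  obtain ⟨c, hc, C, hC, H⟩ := h.exists_mgf_le
  refine ⟨min c (Mvec μ j / (2 * C)), by positivity, fun κ hκ hκc => ?_⟩
  refine (H κ (hκc.trans (min_le_left _ _)) _ fun i => ?_).trans_lt ?_
  · rcases eq_or_ne i j with rfl | hne
    · simp [abs_of_pos hκ]
    · simp [hne, hκ.le]
  · have e : dotR (Pi.single j (-κ)) (Mvec μ) = -κ * Mvec μ j := by
      unfold dotR
      rw [Finset.sum_eq_single j]
      · simp
      · intro i _ hi
        simp [hi]
      · simp
    rw [e, ENNReal.ofReal_lt_one, Real.exp_lt_one_iff]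
    have h1 : κ ≤ Mvec μ j / (2 * C) := hκc.trans (min_le_right _ _)
    rw [le_div_iff₀ (by positivity)] at h1
    nlinarith

/-- Transience, with subexponential bounds on the Green function. -/
theorem exists_green_le (h : Standing μ) {κ : ℝ} (hκ : 0 < κ) :
    ∃ C ≥ 0, ∀ S : Set (Fin d → ℤ), ∀ x y,
      pot (ks (wt μ) S) (dl y) x ≤ ENNReal.ofReal (C * Real.exp (κ * znorm (y - x))) := by
  obtain ⟨j, hj⟩ := h.exists_pos_drift
  obtain ⟨c, hc, H⟩ := h.exists_mgf_neg_lt_one hj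
  set κ' := min κ c
  have hκ' : 0 < κ' := lt_min hκ hc
  have hlt := H κ' hκ' (min_le_right _ _)
  have hfin : (1 - mgf (wt μ) (Pi.single j (-κ')))⁻¹ ≠ ⊤ :=
    ENNReal.inv_ne_top.2 (tsub_pos_of_lt hlt).ne'
  refine ⟨(1 - mgf (wt μ) (Pi.single j (-κ')))⁻¹.toReal, ENNReal.toReal_nonneg, fun S x y => ?_⟩
  refine (pot_dl_le_of_mgf_lt_one hlt S x y).trans ?_
  rw [ENNReal.ofReal_mul ENNReal.toReal_nonneg, ENNReal.ofReal_toReal hfin]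
  gcongr
  rw [znorm_sub_comm]
  have h1 : ∀ i, |(Pi.single j (-κ') : Fin d → ℝ) i| ≤ κ := fun i => by
    rcases eq_or_ne i j with rfl | hne
    · simp only [Pi.single_eq_same, abs_neg, abs_of_pos hκ']
      exact min_le_left _ _
    · simp [hne, hκ.le]
  exact (le_abs_self _).trans (abs_dotZ_le h1 _)

theorem green_ne_top (h : Standing μ) (S : Set (Fin d → ℤ)) (x y : Fin d → ℤ) :
    pot (ks (wt μ) S) (dl y) x ≠ ⊤ := by
  obtain ⟨C, -, H⟩ := h.exists_green_le one_pos
  exact ne_top_of_le_ne_top ENNReal.ofReal_ne_top (H S x y)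

theorem mgf_le (m : (Fin d → ℤ) → ℝ≥0∞) {a : Fin d → ℝ} {κ : ℝ} (ha : ∀ i, |a i| ≤ κ) :
    mgf m a ≤ ∑' z, m z * ENNReal.ofReal (Real.exp (κ * znorm z)) :=
  ENNReal.tsum_le_tsum fun z => by
    unfold ex
    gcongr
    exact (le_abs_self _).trans (abs_dotZ_le ha z)

/-- Off-diagonal comparison for the Green function. -/
theorem exists_kop_green_le (h : Standing μ) {k : ℕ} (hk : k ≠ 0) {α γ : ℝ} (hα : 0 ≤ α)
    (hγ : α < γ) : ∃ ε > 0, ∃ κ₀ > 0, ∀ κ > 0, κ ≤ κ₀ → ∃ D ≥ 0,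
      ∀ (S : Set (Fin d → ℤ)) (a b : (Fin d → ℤ) → (Fin d → ℤ) → ℝ≥0∞),
      kop (ks (wt μ) S) ^ k = kop a + kop b → Commute (kop a) (kop b) →
      (∀ v : Fin d → ℝ, (∀ i, |v i| ≤ κ) → kop a (ex v) ≤ ENNReal.ofReal (α + ε) • ex v) →
      ∀ y x, kop a (pot (ks (wt μ) S) (dl y)) x ≤
        ENNReal.ofReal γ * pot (ks (wt μ) S) (dl y) x +
          ENNReal.ofReal (D * Real.exp (-(κ * znorm (x - y)))) := by
  obtain ⟨ε, hε, D, hD, H⟩ := exists_kop_pot_le_of_commute hα hγ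
  obtain ⟨c, hc, C, hC, Hm⟩ := h.exists_tsum_exp_le
  have hcont : Tendsto (fun κ : ℝ => (1 + κ * C) ^ k) (𝓝[>] 0) (𝓝 ((1 + 0 * C) ^ k)) := by
    refine tendsto_nhdsWithin_of_tendsto_nhds ?_
    exact Continuous.tendsto (by fun_prop) 0
  have hev : ∀ᶠ κ : ℝ in 𝓝[>] 0, (1 + κ * C) ^ k ≤ 1 + ε :=
    hcont.eventually_le_const (by simpa using hε)
  obtain ⟨r, hr, hsub⟩ := mem_nhdsGT_iff_exists_Ioc_subset.1 hev
  refine ⟨ε, hε, min r c, lt_min hr hc, fun κ hκ hκ₀ => ?_⟩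
  have hpow : (1 + κ * C) ^ k ≤ 1 + ε := hsub ⟨hκ, hκ₀.trans (min_le_left _ _)⟩
  refine ⟨(k * (1 + ε)) * D.toReal, by positivity, fun S a b hab hcomm ha y x => ?_⟩
  set v : Fin d → ℝ := -κ • sgn (x - y)
  have hv : ∀ i, |v i| ≤ κ := fun i => by
    simp [v, abs_mul, abs_sgn, abs_of_pos hκ]
  have hmgf : mgf (wt μ) v ≤ ENNReal.ofReal (1 + κ * C) := by
    refine (mgf_le _ hv).trans ((Hm κ hκ.le (hκ₀.trans (min_le_right _ _)) _
      fun _ => le_rfl).trans ?_)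
    rw [h.tsum_wt, ENNReal.ofReal_add zero_le_one (by positivity), ENNReal.ofReal_one]
  have h1C : 1 ≤ 1 + κ * C := by
    have : 0 ≤ κ * C := by positivity
    linarith
  have hKj : ∀ j ≤ k, (kop (ks (wt μ) S) ^ j) (ex v) ≤ ENNReal.ofReal (1 + ε) • ex v := by
    intro j hj
    refine (kop_pow_le_smul (kop_ks_ex_le _ S v) j).trans ?_
    refine smul_le_smul_of_nonneg_right ?_ (fun _ => zero_le)
    refine (pow_le_pow_left' hmgf j).trans ?_
    rw [← ENNReal.ofReal_pow (by linarith)]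
    exact ENNReal.ofReal_le_ofReal ((pow_le_pow_right₀ h1C hj).trans hpow)
  set p := fun x y => (kop (ks (wt μ) S) ^ k) (dl y) x
  have hp : kop p = kop (ks (wt μ) S) ^ k := (kop_pow_eq_kop _ _).symm
  set G := pot (ks (wt μ) S) (dl y)
  set g := ∑ j ∈ Finset.range k, (kop (ks (wt μ) S) ^ j) (dl y)
  have hG : ∀ x, G x = pot p g x := by
    intro x
    refine eq_pot_of_tendsto ?_ ?_
    · rw [hp]
      exact sum_add_pow_of_eq (pot_eq _ _) k
    · simp only [hp, ← pow_mul]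
      exact (tendsto_kop_pow_pot (h.green_ne_top S x y)).comp
        (tendsto_id.const_mul_atTop' (Nat.pos_of_ne_zero hk))
  have hg : g ≤ (k * ENNReal.ofReal (1 + ε) * ex (-v) y) • ex v := by
    have : ∀ j ∈ Finset.range k, (kop (ks (wt μ) S) ^ j) (dl y) ≤
        (ENNReal.ofReal (1 + ε) * ex (-v) y) • ex v := by
      intro j hj
      refine (kop_pow_mono _ j (dl_le_ex v y)).trans ?_
      rw [map_smul, mul_comm, mul_smul]
      exact smul_le_smul_of_nonneg_left (hKj j (Finset.mem_range.1 hj).le) zero_le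
    refine (Finset.sum_le_card_nsmul _ _ _ this).trans (le_of_eq ?_)
    rw [Finset.card_range]
    funext z
    simp only [Pi.smul_apply, nsmul_eq_mul, smul_eq_mul]
    ring
  have hfinal := H _ a b p (hp.trans hab) hcomm (ex v) g _ (ha v hv)
    (by rw [hp]; exact hKj k le_rfl) hg x
  have hGfun : pot p g = G := funext fun x => (hG x).symm
  rw [hGfun] at hfinal
  refine hfinal.trans (add_le_add le_rfl (le_of_eq ?_))
  have e : Real.exp (-(κ * znorm (x - y))) = Real.exp (dotZ v (x - y)) := by
    rw [dotZ_smul_sgn, neg_mul]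
  rw [e, ENNReal.ofReal_mul (by positivity), ← ex_sub_mul, ENNReal.ofReal_mul (by positivity),
    ENNReal.ofReal_mul (by positivity), ENNReal.ofReal_toReal hD, ENNReal.ofReal_natCast]
  ring

end Standing

end

noncomputable section

variable {d : ℕ} {μ : (Fin d → ℤ) → ℝ}

theorem kop_ks_pow_shift {V : Type*} [AddCommGroup V] (m : V → ℝ≥0∞) {S : Set V} {w : V}
    (hS : ∀ x, x + w ∈ S ↔ x ∈ S) (n : ℕ) (f : V → ℝ≥0∞) (x : V) :
    (kop (ks m S) ^ n) f (x + w) = (kop (ks m S) ^ n) (fun x => f (x + w)) x := by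
  induction n generalizing x with
  | zero => simp
  | succ n ih =>
    rw [pow_succ', Module.End.mul_apply, Module.End.mul_apply, kop_ks_apply, kop_ks_apply]
    simp only [hS, add_right_comm x w, ih]

theorem kop_ks_pow_dl_shift {V : Type*} [AddCommGroup V] (m : V → ℝ≥0∞) {S : Set V} {w : V}
    (hS : ∀ x, x + w ∈ S ↔ x ∈ S) (n : ℕ) (x y : V) :
    (kop (ks m S) ^ n) (dl (y + w)) (x + w) = (kop (ks m S) ^ n) (dl y) x := by
  rw [kop_ks_pow_shift m hS]
  have e : (fun x => dl (y + w) (x + w)) = dl y := by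
    funext z
    simp [dl]
  rw [e]

theorem kop_ks_pow_dl_eq_zero {V : Type*} [AddCommGroup V] (m : V → ℝ≥0∞) {S : Set V} {n : ℕ}
    (hn : n ≠ 0) {x y : V} (hxy : ¬(x ∈ S ∧ y ∈ S)) : (kop (ks m S) ^ n) (dl y) x = 0 := by
  by_cases hy : y ∈ S
  · exact kop_ks_pow_of_notMem (dl_of_notMem hy) n fun hx => hxy ⟨hx, hy⟩
  · have h0 : kop (ks m S) (dl y) = 0 := by
      funext z
      simp [kop_dl, ks, hy]
    obtain ⟨n, rfl⟩ := Nat.exists_eq_succ_of_ne_zero hn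
    rw [Nat.succ_eq_add_one, pow_succ, Module.End.mul_apply, h0, map_zero]
    rfl

namespace Standing

/-- Slow variation of the Green function in the directions along which the domain is invariant. -/
theorem exists_green_shift_le (h : Standing μ) (Λ : Set (Fin d)) {w : Fin d → ℤ}
    (hw : ∀ i ∈ Λ, w i = 0) {η : ℝ} (hη : 0 < η) :
    ∃ κ > 0, ∃ D ≥ 0, ∀ x ∈ posDom Λ, ∀ y,
      pot (ks (wt μ) (posDom Λ)) (dl y) (x + w) ≤
        ENNReal.ofReal (1 + η) * pot (ks (wt μ) (posDom Λ)) (dl y) x +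
          ENNReal.ofReal (D * Real.exp (-(κ * znorm (x - y)))) := by
  set S : Set (Fin d → ℤ) := posDom Λ
  have hS : ∀ x, x + w ∈ S ↔ x ∈ S := fun x => by
    refine forall₂_congr fun i hi => ?_
    simp [hw i hi]
  rcases eq_or_ne w 0 with rfl | hw0
  · refine ⟨1, one_pos, 0, le_rfl, fun x _ y => ?_⟩
    rw [add_zero]
    refine le_trans ?_ le_self_add
    exact le_mul_of_one_le_left zero_le (by simpa using hη.le)
  obtain ⟨k, δ, hδ, hk, H⟩ := h.exists_pow_pos Λ w
  have hk0 := hk hw0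
  set δ' := (min δ 1).toReal
  have hδt : min δ 1 ≠ ⊤ := by simp
  have hδ'0 : 0 < δ' := ENNReal.toReal_pos (by simp [hδ]) hδt
  have hδ'e : ENNReal.ofReal δ' = min δ 1 := ENNReal.ofReal_toReal hδt
  obtain ⟨ε, hε, κ₀, hκ₀, Hg⟩ := h.exists_kop_green_le hk0 hδ'0.le
    (lt_mul_of_one_lt_left hδ'0 (by linarith : 1 < 1 + η))
  have hcont : Tendsto (fun κ : ℝ => δ' * Real.exp (κ * znorm w)) (𝓝[>] 0)
      (𝓝 (δ' * Real.exp (0 * znorm w))) := by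
    refine tendsto_nhdsWithin_of_tendsto_nhds ?_
    exact Continuous.tendsto (by fun_prop) 0
  have hev : ∀ᶠ κ : ℝ in 𝓝[>] 0, δ' * Real.exp (κ * znorm w) ≤ δ' + ε ∧ κ ≤ κ₀ :=
    (hcont.eventually_le_const (by simpa using hε)).and
      (tendsto_nhdsWithin_of_tendsto_nhds tendsto_id |>.eventually_le_const hκ₀)
  obtain ⟨κ, ⟨hκ1, hκ2⟩, hκ⟩ := (hev.and self_mem_nhdsWithin).exists
  replace hκ : 0 < κ := hκ
  obtain ⟨D, hD, HD⟩ := Hg κ hκ hκ2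
  set p : (Fin d → ℤ) → (Fin d → ℤ) → ℝ≥0∞ := fun x y => (kop (ks (wt μ) S) ^ k) (dl y) x
  set a : (Fin d → ℤ) → (Fin d → ℤ) → ℝ≥0∞ :=
    fun x y => if x ∈ S ∧ y = x + w then min δ 1 else 0
  set b : (Fin d → ℤ) → (Fin d → ℤ) → ℝ≥0∞ := fun x y => p x y - a x y
  have hap : ∀ x y, a x y ≤ p x y := by
    intro x y
    simp only [a]
    split_ifs with hxy
    · rw [hxy.2]
      exact (min_le_left _ _).trans (H x hxy.1 ((hS x).2 hxy.1))
    · exact zero_le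
  have ha : ∀ f x, kop a f x = if x ∈ S then min δ 1 * f (x + w) else 0 := by
    intro f x
    rw [kop_apply, tsum_eq_single (x + w)]
    · by_cases hx : x ∈ S <;> simp [a, hx]
    · intro y hy
      simp [a, hy]
  have hpab : kop (ks (wt μ) S) ^ k = kop a + kop b := by
    rw [kop_pow_eq_kop]
    ext f x
    rw [LinearMap.add_apply, Pi.add_apply, kop_apply, kop_apply, kop_apply, ← ENNReal.tsum_add]
    refine tsum_congr fun y => ?_
    rw [← add_mul]
    congr 1
    exact (add_tsub_cancel_of_le (hap x y)).symm
  have hbshift : ∀ x y, b (x + w) (y + w) = b x y := by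
    intro x y
    simp only [b, p, a]
    rw [kop_ks_pow_dl_shift _ hS]
    simp only [hS, add_left_inj]
  have hb0 : ∀ x y, ¬(x ∈ S ∧ y ∈ S) → b x y = 0 := by
    intro x y hxy
    simp only [b, p]
    rw [kop_ks_pow_dl_eq_zero _ hk0 hxy]
    simp
  have hcomm : Commute (kop a) (kop b) := by
    refine LinearMap.ext fun f => funext fun x => ?_
    rw [Module.End.mul_apply, Module.End.mul_apply, ha, kop_apply, kop_apply]
    have e1 : ∑' y, b x y * kop a f y = min δ 1 * ∑' y, b x y * f (y + w) := by
      rw [← ENNReal.tsum_mul_left]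
      refine tsum_congr fun y => ?_
      rw [ha]
      split_ifs with hy
      · ring
      · rw [hb0 x y fun hh => hy hh.2]
        simp
    rw [e1, ← (Equiv.addRight w).tsum_eq]
    simp only [Equiv.coe_addRight, hbshift]
    split_ifs with hx
    · rfl
    · simp [hb0 x _ fun hh => hx hh.1]
  refine ⟨κ, hκ, D / δ', by positivity, fun x hx y => ?_⟩
  have := HD S a b hpab hcomm (fun v hv z => by
    rw [ha]
    split_ifs with hz
    · rw [Pi.smul_apply, smul_eq_mul, ex_add, mul_comm (ex v z), ← mul_assoc, ← hδ'e]
      refine mul_le_mul_left ?_ _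
      rw [ex, ← ENNReal.ofReal_mul hδ'0.le]
      refine ENNReal.ofReal_le_ofReal (le_trans ?_ hκ1)
      gcongr
      exact (le_abs_self _).trans (abs_dotZ_le hv w)
    · exact zero_le) y x
  rw [ha, if_pos hx, ← hδ'e, ENNReal.ofReal_mul (by linarith)] at this
  have hδ0 : ENNReal.ofReal δ' ≠ 0 := by simpa using hδ'0
  rw [← ENNReal.mul_le_mul_iff_right hδ0 ENNReal.ofReal_ne_top]
  refine this.trans (le_of_eq ?_)
  rw [mul_add, ← ENNReal.ofReal_mul hδ'0.le]
  congr 1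
  · ring
  · congr 1
    field_simp

/-- The part of the step weights which moves (or does not move) the coordinate `i`. -/
def _root_.KilledWalk.restr (m : (Fin d → ℤ) → ℝ≥0∞) (P : (Fin d → ℤ) → Prop) (z : Fin d → ℤ) :
    ℝ≥0∞ := if P z then m z else 0

theorem _root_.KilledWalk.restr_le (m : (Fin d → ℤ) → ℝ≥0∞) (P : (Fin d → ℤ) → Prop)
    (z : Fin d → ℤ) : restr m P z ≤ m z := by
  unfold restr
  split_ifs
  · exact le_rfl
  · exact zero_le

theorem _root_.KilledWalk.kop_ks_restr_add (m : (Fin d → ℤ) → ℝ≥0∞) (P : (Fin d → ℤ) → Prop)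
    (S : Set (Fin d → ℤ)) :
    kop (ks m S) = kop (ks (restr m P) S) + kop (ks (restr m fun z => ¬P z) S) := by
  ext f x
  rw [LinearMap.add_apply, Pi.add_apply, kop_apply, kop_apply, kop_apply, ← ENNReal.tsum_add]
  refine tsum_congr fun y => ?_
  rw [← add_mul]
  congr 1
  unfold ks restr
  by_cases hP : P (y - x) <;> simp [hP]

theorem commute_restr (h : Standing μ) {Λ : Set (Fin d)} (hΛ : Λ ⊆ LambdaM μ) {i : Fin d}
    (hi : i ∈ Λ) : Commute (kop (ks (restr (wt μ) fun z => z i ≠ 0) (posDom Λ)))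
      (kop (ks (restr (wt μ) fun z => ¬z i ≠ 0) (posDom Λ))) := by
  set S : Set (Fin d → ℤ) := posDom Λ
  set m1 := restr (wt μ) fun z => z i ≠ 0
  set m2 := restr (wt μ) fun z => ¬z i ≠ 0
  have h1 : ∀ z, m1 z ≠ 0 → ∀ l ∈ Λ, l ≠ i → z l = 0 := by
    intro z hz l hl hli
    by_contra hzl
    apply hz
    simp only [m1, restr]
    split_ifs with hzi
    · simp [wt, h.mixed z l i hli (hΛ hl) (hΛ hi) hzl hzi]
    · rfl
  have h2 : ∀ z, m2 z ≠ 0 → z i = 0 := by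
    intro z hz
    by_contra hzi
    exact hz (by simp [m2, restr, hzi])
  have hmem1 : ∀ x z z', m1 z ≠ 0 → m2 z' ≠ 0 → x ∈ S → x + z + z' ∈ S → x + z ∈ S := by
    intro x z z' hz hz' hx hxz l hl
    rcases eq_or_ne l i with rfl | hli
    · have := hxz l hl
      simpa [h2 z' hz'] using this
    · simpa [h1 z hz l hl hli] using hx l hl
  have hmem2 : ∀ x z z', m1 z ≠ 0 → m2 z' ≠ 0 → x ∈ S → x + z + z' ∈ S → x + z' ∈ S := by
    intro x z z' hz hz' hx hxz l hl
    rcases eq_or_ne l i with rfl | hli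
    · simpa [h2 z' hz'] using hx l hl
    · have := hxz l hl
      simpa [h1 z hz l hl hli] using this
  refine LinearMap.ext fun f => funext fun x => ?_
  rw [Module.End.mul_apply, Module.End.mul_apply, kop_ks_apply, kop_ks_apply]
  split_ifs with hx
  · have e1 : ∀ z, m1 z * (if x + z ∈ S then kop (ks m2 S) f (x + z) else 0) =
        ∑' z', m1 z * m2 z' * if x + z + z' ∈ S then f (x + z + z') else 0 := by
      intro z
      rw [kop_ks_apply]
      by_cases hz : m1 z = 0
      · simp [hz]
      by_cases hxz : x + z ∈ S
      · simp only [hxz, if_true, ← ENNReal.tsum_mul_left, mul_assoc]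
      · simp only [hxz, if_false, mul_zero]
        rw [eq_comm, ENNReal.tsum_eq_zero]
        intro z'
        by_cases hz' : m2 z' = 0
        · simp [hz']
        · rw [if_neg fun hh => hxz (hmem1 x z z' hz hz' hx hh), mul_zero]
    have e2 : ∀ z', m2 z' * (if x + z' ∈ S then kop (ks m1 S) f (x + z') else 0) =
        ∑' z, m1 z * m2 z' * if x + z + z' ∈ S then f (x + z + z') else 0 := by
      intro z'
      rw [kop_ks_apply]
      by_cases hz' : m2 z' = 0
      · simp [hz']
      by_cases hxz : x + z' ∈ S
      · simp only [hxz, if_true, ← ENNReal.tsum_mul_left, add_right_comm x _ z']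
        exact tsum_congr fun z => by ring
      · simp only [hxz, if_false, mul_zero]
        rw [eq_comm, ENNReal.tsum_eq_zero]
        intro z
        by_cases hz : m1 z = 0
        · simp [hz]
        · rw [if_neg fun hh => hxz (hmem2 x z z' hz hz' hx hh), mul_zero]
    simp only [e1, e2]
    exact ENNReal.tsum_comm
  · rfl

theorem exists_mgf_restr_le (h : Standing μ) (P : (Fin d → ℤ) → Prop) {α : ℝ} {ε : ℝ}
    (hα0 : 0 ≤ α) (hε : 0 < ε)
    (hα : ∑' z, restr (wt μ) P z = ENNReal.ofReal α) : ∃ κ₀ > 0, ∀ κ > 0, κ ≤ κ₀ →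
      ∀ v : Fin d → ℝ, (∀ i, |v i| ≤ κ) → mgf (restr (wt μ) P) v ≤ ENNReal.ofReal (α + ε) := by
  obtain ⟨c, hc, C, hC, H⟩ := h.exists_tsum_exp_le
  refine ⟨min c (ε / (C + 1)), by positivity, fun κ hκ hκ₀ v hv => ?_⟩
  refine (mgf_le _ hv).trans ((H κ hκ.le (hκ₀.trans (min_le_left _ _)) _ (restr_le _ _)).trans ?_)
  rw [hα, ← ENNReal.ofReal_add hα0 (by positivity)]
  refine ENNReal.ofReal_le_ofReal ?_
  have := hκ₀.trans (min_le_right _ _)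
  rw [le_div_iff₀ (by linarith)] at this
  nlinarith

/-- Approximate harmonicity of the Green function for each of the two commuting parts of the
transition operator. -/
theorem exists_kop_restr_green_le (h : Standing μ) {Λ : Set (Fin d)} (hΛ : Λ ⊆ LambdaM μ)
    {i : Fin d} (hi : i ∈ Λ) {P : (Fin d → ℤ) → Prop}
    (hP : P = (fun z => z i ≠ 0) ∨ P = fun z => ¬z i ≠ 0) {α η : ℝ} (hα0 : 0 ≤ α) (hη : 0 < η)
    (hα : ∑' z, restr (wt μ) P z = ENNReal.ofReal α) :
    ∃ κ > 0, ∃ D ≥ 0, ∀ x y,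
      kop (ks (restr (wt μ) P) (posDom Λ)) (pot (ks (wt μ) (posDom Λ)) (dl y)) x ≤
        ENNReal.ofReal (α + η) * pot (ks (wt μ) (posDom Λ)) (dl y) x +
          ENNReal.ofReal (D * Real.exp (-(κ * znorm (x - y)))) := by
  obtain ⟨ε, hε, κ₀, hκ₀, H⟩ := h.exists_kop_green_le one_ne_zero hα0 (lt_add_of_pos_right α hη)
  obtain ⟨κ₁, hκ₁, H₁⟩ := h.exists_mgf_restr_le P hα0 hε hα
  have hκ : 0 < min κ₀ κ₁ := lt_min hκ₀ hκ₁
  obtain ⟨D, hD, HD⟩ := H _ hκ (min_le_left _ _)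
  refine ⟨_, hκ, D, hD, fun x y => ?_⟩
  have hadd : kop (ks (wt μ) (posDom Λ)) ^ 1 = kop (ks (restr (wt μ) P) (posDom Λ)) +
      kop (ks (restr (wt μ) fun z => ¬P z) (posDom Λ)) := by
    rw [pow_one, kop_ks_restr_add _ P]
  have hcomm : Commute (kop (ks (restr (wt μ) P) (posDom Λ)))
      (kop (ks (restr (wt μ) fun z => ¬P z) (posDom Λ))) := by
    rcases hP with rfl | rfl
    · exact h.commute_restr hΛ hi
    · simpa only [not_not] using (h.commute_restr hΛ hi).symm
  refine HD (posDom Λ) _ _ hadd hcomm (fun v hv => ?_) y x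
  refine (kop_ks_ex_le _ _ v).trans ?_
  exact smul_le_smul_of_nonneg_right (H₁ _ hκ (min_le_right _ _) v hv) fun _ => zero_le

end Standing

end

noncomputable section

variable {d : ℕ} {μ : (Fin d → ℤ) → ℝ}

theorem dotZ_single (i : Fin d) (s : ℝ) (x : Fin d → ℤ) : dotZ (Pi.single i s) x = s * x i := by
  unfold dotZ
  rw [Finset.sum_eq_single i]
  · simp
  · intro j _ hj
    simp [hj]
  · simp

theorem dotR_single (i : Fin d) (s : ℝ) (q : Fin d → ℝ) : dotR (Pi.single i s) q = s * q i := by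
  unfold dotR
  rw [Finset.sum_eq_single i]
  · simp
  · intro j _ hj
    simp [hj]
  · simp

/-- If the defect `W` is a supersolution in space-time which dominates `1` off the domain and
off the target at time zero, then it bounds the probability of missing the target. -/
theorem one_le_kop_pow_add {V : Type*} [AddCommGroup V] {m : V → ℝ≥0∞} (hm : ∑' z, m z = 1)
    {A : Set V} {B : V → ℝ≥0∞} {W : ℕ → V → ℝ≥0∞}
    (hW : ∀ t x, ∑' z, m z * W t (x + z) ≤ W (t + 1) x) (hoff : ∀ t x, x ∉ A → 1 ≤ W t x)
    (h0 : ∀ x ∈ A, 1 ≤ B x + W 0 x) (t : ℕ) (x : V) :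
    1 ≤ (kop (ks m A) ^ t) B x + W t x := by
  induction t generalizing x with
  | zero =>
    by_cases hx : x ∈ A
    · simpa using h0 x hx
    · exact (hoff 0 x hx).trans le_add_self
  | succ t ih =>
    by_cases hx : x ∈ A
    · rw [pow_succ', Module.End.mul_apply, kop_ks_apply, if_pos hx]
      refine le_trans ?_ (add_le_add le_rfl (hW t x))
      rw [← ENNReal.tsum_add, ← hm]
      refine ENNReal.tsum_le_tsum fun z => ?_
      rw [← mul_add]
      refine le_mul_of_one_le_right zero_le ?_
      split_ifs with hz
      · exact ih (x + z)
      · exact (hoff t _ hz).trans le_add_self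
    · exact (hoff _ x hx).trans le_add_self

theorem tsum_mul_exp_coord_le {m : (Fin d → ℤ) → ℝ≥0∞} {i : Fin d} {s r : ℝ}
    (hr : mgf m (Pi.single i s) ≤ ENNReal.ofReal (Real.exp r)) (c : ℝ) (t : ℕ) (x : Fin d → ℤ) :
    ∑' z, m z * ENNReal.ofReal (Real.exp (c + s * ((x + z) i : ℤ) + r * t)) ≤
      ENNReal.ofReal (Real.exp (c + s * x i + r * (t + 1 : ℕ))) := by
  have e : ∀ z : Fin d → ℤ, m z * ENNReal.ofReal (Real.exp (c + s * ((x + z) i : ℤ) + r * t)) =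
      ENNReal.ofReal (Real.exp (c + s * x i + r * t)) * (m z * ex (Pi.single i s) z) := by
    intro z
    rw [mul_left_comm, ex, dotZ_single, ← ENNReal.ofReal_mul (Real.exp_pos _).le, ← Real.exp_add]
    congr 3
    push_cast [Pi.add_apply]
    ring
  simp only [e]
  rw [ENNReal.tsum_mul_left]
  refine (mul_le_mul_right hr _).trans (le_of_eq ?_)
  rw [← ENNReal.ofReal_mul (Real.exp_pos _).le, ← Real.exp_add]
  congr 2
  push_cast
  ring

namespace Standing

theorem exists_mgf_single_le (h : Standing μ) {ε : ℝ} (hε : 0 < ε) :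
    ∃ κ > 0, ∀ i, ∀ s, |s| = κ →
      mgf (wt μ) (Pi.single i s) ≤ ENNReal.ofReal (Real.exp (s * Mvec μ i + κ * ε)) := by
  obtain ⟨c, hc, C, hC, H⟩ := h.exists_mgf_le
  have hκ : 0 < min c (ε / C) := lt_min hc (by positivity)
  refine ⟨min c (ε / C), hκ, fun i s hs => ?_⟩
  refine (H (min c (ε / C)) (min_le_left _ _) (Pi.single i s) fun j => ?_).trans ?_
  · rcases eq_or_ne j i with rfl | hne
    · simp [hs]
    · simpa [hne] using ⟨hc.le, by positivity⟩
  · rw [dotR_single]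
    refine ENNReal.ofReal_le_ofReal (Real.exp_le_exp.2 ?_)
    have := min_le_right c (ε / C)
    rw [le_div_iff₀ hC] at this
    nlinarith

theorem exists_hit_box (h : Standing μ) {β : ℝ} (hβ : 0 < β) :
    ∃ N₀ : ℝ, ∀ (N : ℝ) (T b : ℕ) (y : Fin d → ℤ), N₀ ≤ N → (T : ℝ) * rnorm (Mvec μ) ≤ N →
      β * N ≤ b → (b : ℝ) ≤ 2 * β * N → (∀ i, |T * Mvec μ i - y i| ≤ β * N) →
      2⁻¹ ≤ (kop (ks (wt μ) (posDom Set.univ)) ^ T)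
        (fun x => if x ∈ posDom Set.univ ∧ ∀ i, |(x i : ℝ) - y i| ≤ 4 * β * N then 1 else 0)
        (fun _ => (b : ℤ)) := by
  have hρ : 0 < rnorm (Mvec μ) := by
    obtain ⟨j, hj⟩ := h.exists_pos_drift
    exact Finset.sum_pos' (fun i _ => abs_nonneg _) ⟨j, Finset.mem_univ j, abs_pos.2 hj.ne'⟩
  obtain ⟨κ, hκ, H⟩ := h.exists_mgf_single_le (ε := β * rnorm (Mvec μ) / 2) (by positivity)
  set ρ := rnorm (Mvec μ)
  have hlim : Tendsto (fun N : ℝ => (3 * d : ℝ) * Real.exp (-(κ * β / 2 * N))) atTop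
      (𝓝 ((3 * d) * 0)) := by
    refine Tendsto.const_mul _ ?_
    refine Real.tendsto_exp_neg_atTop_nhds_zero.comp ?_
    exact tendsto_id.const_mul_atTop (by positivity)
  rw [mul_zero] at hlim
  obtain ⟨N₀, hN₀⟩ := eventually_atTop.1 (hlim.eventually_le_const (by norm_num : (0 : ℝ) < 2⁻¹))
  refine ⟨N₀, fun N T b y hN hT hb1 hb2 hy => ?_⟩
  set A : Set (Fin d → ℤ) := posDom Set.univ
  set R := 4 * β * N
  set ε := β * ρ / 2
  set F : ℕ → (Fin d → ℤ) → Fin d → ℝ≥0∞ := fun t x i =>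
    ENNReal.ofReal (Real.exp (0 + -κ * x i + κ * ε * t)) +
    ENNReal.ofReal (Real.exp (-κ * (y i + R) + κ * x i + (κ * Mvec μ i + κ * ε) * t)) +
    ENNReal.ofReal (Real.exp (κ * (y i - R) + -κ * x i + (-κ * Mvec μ i + κ * ε) * t))
  have habs : |-κ| = κ := by rw [abs_neg, abs_of_pos hκ]
  have hF : ∀ t x i, ∑' z, wt μ z * F t (x + z) i ≤ F (t + 1) x i := by
    intro t x i
    simp only [F, mul_add (wt μ _), ENNReal.tsum_add]
    refine add_le_add (add_le_add ?_ ?_) ?_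
    · refine tsum_mul_exp_coord_le ((H i _ habs).trans (ENNReal.ofReal_le_ofReal
        (Real.exp_le_exp.2 ?_))) _ t x
      nlinarith [h.driftNonneg i]
    · exact tsum_mul_exp_coord_le (H i κ (abs_of_pos hκ)) _ t x
    · exact tsum_mul_exp_coord_le (H i _ habs) _ t x
  have hFone : ∀ {r : ℝ}, 0 ≤ r → 1 ≤ ENNReal.ofReal (Real.exp r) := fun hr => by
    simpa using hr
  have key := one_le_kop_pow_add h.tsum_wt (A := A)
    (B := fun x => if x ∈ A ∧ ∀ i, |(x i : ℝ) - y i| ≤ R then 1 else 0)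
    (W := fun t x => ∑ i, F t x i) ?_ ?_ ?_ T (fun _ => (b : ℤ))
  · have hsmall : ∑ i, F T (fun _ => (b : ℤ)) i ≤ 2⁻¹ := by
      have hbd : ∀ i, F T (fun _ => (b : ℤ)) i ≤
          ENNReal.ofReal (3 * Real.exp (-(κ * β / 2 * N))) := by
        intro i
        have h1 := abs_le.1 (hy i)
        have hεT : ε * T ≤ β * N / 2 := by simp only [ε]; nlinarith
        have hexp : ∀ r : ℝ, r ≤ -(β / 2 * N) → Real.exp (κ * r) ≤
            Real.exp (-(κ * β / 2 * N)) := fun r hr => Real.exp_le_exp.2 (by nlinarith)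
        simp only [F]
        rw [← ENNReal.ofReal_add (Real.exp_pos _).le (Real.exp_pos _).le,
          ← ENNReal.ofReal_add (by positivity) (Real.exp_pos _).le]
        refine ENNReal.ofReal_le_ofReal ?_
        have e1 := hexp (-b + ε * T) (by linarith)
        have e2 := hexp (-(y i + R) + b + (Mvec μ i + ε) * T) (by simp only [R]; nlinarith)
        have e3 := hexp ((y i - R) + -b + (-Mvec μ i + ε) * T) (by simp only [R]; nlinarith)
        have f1 : 0 + -κ * ((b : ℤ) : ℝ) + κ * ε * T = κ * (-b + ε * T) := by push_cast; ring
        have f2 : -κ * (y i + R) + κ * ((b : ℤ) : ℝ) + (κ * Mvec μ i + κ * ε) * T =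
          κ * (-(y i + R) + b + (Mvec μ i + ε) * T) := by push_cast; ring
        have f3 : κ * (y i - R) + -κ * ((b : ℤ) : ℝ) + (-κ * Mvec μ i + κ * ε) * T =
          κ * ((y i - R) + -b + (-Mvec μ i + ε) * T) := by push_cast; ring
        rw [f1, f2, f3]
        linarith
      refine (Finset.sum_le_card_nsmul _ _ _ fun i _ => hbd i).trans ?_
      rw [Finset.card_univ, Fintype.card_fin, nsmul_eq_mul, ← ENNReal.ofReal_natCast,
        ← ENNReal.ofReal_mul (by positivity)]
      have e2 : (2⁻¹ : ℝ≥0∞) = ENNReal.ofReal 2⁻¹ := by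
        rw [ENNReal.ofReal_inv_of_pos two_pos]; simp
      rw [e2]
      refine ENNReal.ofReal_le_ofReal (le_trans (le_of_eq ?_) (hN₀ N hN))
      ring
    have h2 := key.trans (add_le_add le_rfl hsmall)
    exact (ENNReal.add_le_add_iff_right (by simp)).1 (ENNReal.inv_two_add_inv_two.le.trans h2)
  · intro t x
    simp only [Finset.mul_sum]
    rw [Summable.tsum_finsetSum fun i _ => ENNReal.summable]
    exact Finset.sum_le_sum fun i _ => hF t x i
  · intro t x hx
    obtain ⟨i, hi⟩ : ∃ i, x i ≤ 0 := by
      by_contra! hcon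
      exact hx fun i _ => hcon i
    refine le_trans ?_ (Finset.single_le_sum (fun _ _ => zero_le) (Finset.mem_univ i))
    refine le_trans (hFone ?_) (le_self_add.trans le_self_add)
    have hi' : (x i : ℝ) ≤ 0 := by exact_mod_cast hi
    have : 0 ≤ κ * ε * t := by positivity
    nlinarith
  · intro x hx
    by_cases hB : ∀ i, |(x i : ℝ) - y i| ≤ R
    · simp [hx, hB]
    · push Not at hB
      obtain ⟨i, hi⟩ := hB
      refine le_trans ?_ le_add_self
      refine le_trans ?_ (Finset.single_le_sum (fun _ _ => zero_le) (Finset.mem_univ i))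
      rcases lt_abs.1 hi with h1 | h1
      · refine le_trans (hFone ?_) (le_add_self.trans le_self_add)
        push_cast
        nlinarith
      · refine le_trans (hFone ?_) le_add_self
        push_cast
        nlinarith

/-- Along sequences in the direction of the drift, the Green function does not decay
exponentially fast. -/
theorem eventually_exp_le_green (h : Standing μ) {xs : ℕ → Fin d → ℤ}
    (hxs : ∀ n, xs n ∈ posDom Set.univ) (hinf : Tendsto (fun n => znorm (xs n)) atTop atTop)
    (hdir : Tendsto (fun n i => (xs n i : ℝ) / znorm (xs n)) atTop
      (𝓝 fun i => Mvec μ i / rnorm (Mvec μ))) {ε : ℝ} (hε : 0 < ε) :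
    ∀ᶠ n in atTop, ENNReal.ofReal (Real.exp (-(ε * znorm (xs n)))) ≤
      pot (ks (wt μ) (posDom Set.univ)) (dl (xs n)) 1 := by
  have hρ : 0 < rnorm (Mvec μ) := by
    obtain ⟨j, hj⟩ := h.exists_pos_drift
    exact Finset.sum_pos' (fun i _ => abs_nonneg _) ⟨j, Finset.mem_univ j, abs_pos.2 hj.ne'⟩
  set ρ := rnorm (Mvec μ)
  obtain ⟨θ, hθ, H⟩ := h.exists_harnack Set.univ
  set β := ε / (12 * (d + 1) * (θ + 1))
  have hβ : 0 < β := by positivity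
  have hβε : 12 * (d * θ) * β ≤ ε := by
    have : 12 * (d + 1) * (θ + 1) * β = ε := by simp only [β]; field_simp
    nlinarith [mul_nonneg (Nat.cast_nonneg (α := ℝ) d) hβ.le, mul_nonneg hθ hβ.le]
  obtain ⟨N₀, HN⟩ := h.exists_hit_box hβ
  have hdir' : ∀ᶠ n in atTop, ∀ i, |(xs n i : ℝ) / znorm (xs n) - Mvec μ i / ρ| ≤ β / 2 := by
    rw [eventually_all]
    intro i
    have := (tendsto_pi_nhds.1 hdir i).sub_const (Mvec μ i / ρ)
    rw [sub_self] at this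
    have := this.abs
    rw [abs_zero] at this
    exact this.eventually_le_const (by positivity)
  filter_upwards [hdir', hinf.eventually_ge_atTop N₀, hinf.eventually_ge_atTop 1,
    hinf.eventually_ge_atTop (2 * ρ / β), hinf.eventually_ge_atTop (2 / β),
    hinf.eventually_ge_atTop (2 * Real.log 2 / ε)] with n h1 h2 h3 h4 h5 h6
  set y := xs n
  set N := znorm y
  have hN : 0 < N := by linarith
  rw [div_le_iff₀ hβ] at h4 h5
  rw [div_le_iff₀ hε] at h6
  set T := ⌊N / ρ⌋₊
  set b := ⌈β * N⌉₊
  have hT1 : (T : ℝ) ≤ N / ρ := Nat.floor_le (by positivity)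
  have hT2 : N / ρ < T + 1 := Nat.lt_floor_add_one _
  rw [le_div_iff₀ hρ] at hT1
  rw [div_lt_iff₀ hρ] at hT2
  have hb1 : β * N ≤ b := Nat.le_ceil _
  have hb2 : (b : ℝ) < β * N + 1 := Nat.ceil_lt_add_one (by positivity)
  have hb3 : (b : ℝ) ≤ 2 * β * N := by nlinarith
  have hMρ : ∀ i, Mvec μ i ≤ ρ := fun i =>
    (le_abs_self _).trans (Finset.single_le_sum (f := fun i => |Mvec μ i|)
      (fun _ _ => abs_nonneg _) (Finset.mem_univ i))
  have hyT : ∀ i, |T * Mvec μ i - y i| ≤ β * N := by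
    intro i
    have h7 := abs_le.1 (h1 i)
    have e1 : (y i : ℝ) / N * N = y i := div_mul_cancel₀ _ hN.ne'
    have e2 : Mvec μ i / ρ * ρ = Mvec μ i := div_mul_cancel₀ _ hρ.ne'
    set q := Mvec μ i / ρ
    have hq0 : 0 ≤ q := div_nonneg (h.driftNonneg i) hρ.le
    have hq1 : q ≤ 1 := by
      rw [div_le_one hρ]
      exact hMρ i
    have e3 : (y i : ℝ) ≤ (q + β / 2) * N := by
      rw [← e1]; exact mul_le_mul_of_nonneg_right (by linarith) hN.le
    have e4 : (q - β / 2) * N ≤ (y i : ℝ) := by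
      rw [← e1]; exact mul_le_mul_of_nonneg_right (by linarith) hN.le
    rw [← e2, abs_le]
    have e5 : q * (T * ρ) ≤ q * N := mul_le_mul_of_nonneg_left hT1 hq0
    have e6 : q * (N - ρ) ≤ q * (T * ρ) := mul_le_mul_of_nonneg_left (by linarith) hq0
    have e7 : q * ρ ≤ ρ := mul_le_of_le_one_left hρ.le hq1
    constructor <;> nlinarith
  have hbox := HN N T b y h2 hT1 hb1 hb3 hyT
  set A : Set (Fin d → ℤ) := posDom Set.univ
  set u := pot (ks (wt μ) A) (dl y)
  have hu : kop (ks (wt μ) A) u ≤ u := kop_pot_le _ _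
  have huy : 1 ≤ u y := by
    have := dl_le_pot (ks (wt μ) A) (dl y) y
    rwa [dl_self] at this
  have hb0 : 1 ≤ b := by
    have : (0 : ℝ) < b := by nlinarith
    exact_mod_cast this
  have hbA : (fun _ => (b : ℤ) : Fin d → ℤ) ∈ A := fun i _ => by
    show (0 : ℤ) < b
    omega
  have hc : ∀ x, (if x ∈ A ∧ ∀ i, |(x i : ℝ) - y i| ≤ 4 * β * N then (1 : ℝ≥0∞) else 0) ≤
      ENNReal.ofReal (Real.exp (θ * (d * (4 * β * N)))) * u x := by
    intro x
    split_ifs with hx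
    · refine huy.trans ((H u hu x hx.1 y (hxs n)).trans ?_)
      gcongr
      rw [znorm_sub_comm]
      unfold znorm
      refine (Finset.sum_le_card_nsmul _ _ (4 * β * N) fun i _ => ?_).trans ?_
      · simpa using hx.2 i
      · simp
    · exact zero_le
  have hstep : 2⁻¹ ≤ ENNReal.ofReal (Real.exp (θ * (d * (4 * β * N)))) * u fun _ => (b : ℤ) := by
    refine hbox.trans ((kop_pow_mono _ T
      (b := ENNReal.ofReal (Real.exp (θ * (d * (4 * β * N)))) • u) hc _).trans ?_)
    rw [map_smul, Pi.smul_apply, smul_eq_mul]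
    exact mul_le_mul_right (kop_pow_le_of_le hu T _) _
  have hone : u (fun _ => (b : ℤ)) ≤ ENNReal.ofReal (Real.exp (θ * (d * (2 * β * N)))) * u 1 := by
    refine (H u hu 1 (one_mem_posDom _) _ hbA).trans ?_
    gcongr
    unfold znorm
    refine (Finset.sum_le_card_nsmul _ _ (2 * β * N) fun i _ => ?_).trans ?_
    · have : (1 : ℝ) ≤ b := by exact_mod_cast hb0
      simp only [Pi.sub_apply, Pi.one_apply]
      push_cast
      rw [abs_of_nonneg (by linarith)]
      linarith
    · simp
  have htot : 2⁻¹ ≤ ENNReal.ofReal (Real.exp (ε / 2 * N)) * u 1 := by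
    refine hstep.trans ((mul_le_mul_right hone _).trans ?_)
    rw [← mul_assoc, ← ENNReal.ofReal_mul (Real.exp_pos _).le, ← Real.exp_add]
    gcongr
    nlinarith
  have e2 : (2⁻¹ : ℝ≥0∞) = ENNReal.ofReal 2⁻¹ := by
    rw [ENNReal.ofReal_inv_of_pos two_pos]; simp
  calc ENNReal.ofReal (Real.exp (-(ε * N)))
      ≤ ENNReal.ofReal (Real.exp (-(ε / 2 * N)) * 2⁻¹) := by
        refine ENNReal.ofReal_le_ofReal ?_
        have h7 : Real.exp (-(ε / 2 * N)) ≤ 2⁻¹ := by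
          rw [← Real.exp_log (by norm_num : (0 : ℝ) < 2⁻¹), Real.log_inv]
          exact Real.exp_le_exp.2 (by linarith)
        have h8 : Real.exp (-(ε * N)) = Real.exp (-(ε / 2 * N)) * Real.exp (-(ε / 2 * N)) := by
          rw [← Real.exp_add]
          ring_nf
        rw [h8]
        exact mul_le_mul_of_nonneg_left h7 (Real.exp_pos _).le
    _ ≤ ENNReal.ofReal (Real.exp (-(ε / 2 * N))) *
        (ENNReal.ofReal (Real.exp (ε / 2 * N)) * u 1) := by
        rw [ENNReal.ofReal_mul (Real.exp_pos _).le, ← e2]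
        exact mul_le_mul_right htot _
    _ = u 1 := by
        rw [← mul_assoc, ← ENNReal.ofReal_mul (Real.exp_pos _).le, ← Real.exp_add]
        simp

end Standing

end

noncomputable section

variable {d : ℕ} {μ : (Fin d → ℤ) → ℝ}

/-- The sequence `xs` in the orthant goes to infinity in the direction of the drift. -/
structure AlongDrift (μ : (Fin d → ℤ) → ℝ) (xs : ℕ → Fin d → ℤ) : Prop where
  mem : ∀ n, xs n ∈ posDom Set.univ
  norm : Tendsto (fun n => znorm (xs n)) atTop atTop
  dir : Tendsto (fun n i => (xs n i : ℝ) / znorm (xs n)) atTop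
    (𝓝 fun i => Mvec μ i / rnorm (Mvec μ))

/-- The Green function with pole `y` of the walk killed outside `posDom Λ`. -/
def grn (μ : (Fin d → ℤ) → ℝ) (Λ : Set (Fin d)) (y : Fin d → ℤ) : (Fin d → ℤ) → ℝ≥0∞ :=
  pot (ks (wt μ) (posDom Λ)) (dl y)

theorem kop_grn_le (Λ : Set (Fin d)) (y : Fin d → ℤ) :
    kop (ks (wt μ) (posDom Λ)) (grn μ Λ y) ≤ grn μ Λ y := kop_pot_le _ _

theorem znorm_one_sub_le (x : Fin d → ℤ) : znorm (1 - x) ≤ d + znorm x := by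
  rw [sub_eq_add_neg]
  refine (znorm_add_le _ _).trans ?_
  rw [znorm_neg]
  simp [znorm]

namespace Standing

theorem eventually_exp_le_grn (h : Standing μ) {xs : ℕ → Fin d → ℤ} (hx : AlongDrift μ xs)
    (Λ : Set (Fin d)) {ε : ℝ} (hε : 0 < ε) :
    ∀ᶠ n in atTop, ENNReal.ofReal (Real.exp (-(ε * znorm (xs n)))) ≤ grn μ Λ (xs n) 1 := by
  filter_upwards [h.eventually_exp_le_green hx.mem hx.norm hx.dir hε] with n hn
  exact hn.trans (pot_le_pot (ks_mono (fun _ => le_rfl) (posDom_anti (Set.subset_univ _))) _ _)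

/-- Exponentially small errors are negligible compared with the Green function on balls of small
relative radius. -/
theorem eventually_exp_le_mul_grn (h : Standing μ) {xs : ℕ → Fin d → ℤ} (hx : AlongDrift μ xs)
    (Λ : Set (Fin d)) {κ η : ℝ} (hκ : 0 < κ) (D : ℝ) (hη : 0 < η) :
    ∀ᶠ δ in 𝓝[>] (0 : ℝ), ∀ᶠ n in atTop, ∀ x ∈ posDom Λ, znorm x ≤ δ * znorm (xs n) →
      ENNReal.ofReal (D * Real.exp (-(κ * znorm (x - xs n)))) ≤
        ENNReal.ofReal η * grn μ Λ (xs n) x := by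
  obtain ⟨θ, hθ, H⟩ := h.exists_harnack Λ
  have hδ₀ : 0 < min (1 / 2) (κ / (8 * (θ + 1))) := by positivity
  filter_upwards [Ioo_mem_nhdsGT hδ₀] with δ hδ
  have h1 : δ ≤ 1 / 2 := hδ.2.le.trans (min_le_left _ _)
  have h2 : δ ≤ κ / (8 * (θ + 1)) := hδ.2.le.trans (min_le_right _ _)
  rw [le_div_iff₀ (by positivity)] at h2
  have hlarge : ∀ᶠ n in atTop, |D| * Real.exp (θ * d) / η ≤ Real.exp (κ / 4 * znorm (xs n)) :=
    (Real.tendsto_exp_atTop.comp (hx.norm.const_mul_atTop (by positivity : 0 < κ / 4)))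
      |>.eventually_ge_atTop _
  filter_upwards [h.eventually_exp_le_grn hx Λ (by positivity : 0 < κ / 8), hlarge]
    with n hn1 hn2 x hxS hxn
  set N := znorm (xs n)
  have hN : 0 ≤ N := znorm_nonneg _
  have hlow : ENNReal.ofReal (Real.exp (-(κ / 8 * N) - θ * (d + δ * N))) ≤ grn μ Λ (xs n) x := by
    have h3 := hn1.trans (H _ (kop_grn_le Λ (xs n)) x hxS 1 (one_mem_posDom _))
    have h4 : grn μ Λ (xs n) x = ENNReal.ofReal (Real.exp (-(θ * (d + δ * N)))) *
        (ENNReal.ofReal (Real.exp (θ * (d + δ * N))) * grn μ Λ (xs n) x) := by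
      rw [← mul_assoc, ← ENNReal.ofReal_mul (Real.exp_pos _).le, ← Real.exp_add]
      simp
    rw [h4, sub_eq_add_neg, add_comm, Real.exp_add, ENNReal.ofReal_mul (Real.exp_pos _).le]
    gcongr
    refine h3.trans ?_
    gcongr
    have := znorm_one_sub_le x
    linarith
  refine le_trans ?_ (mul_le_mul_right hlow _)
  rw [← ENNReal.ofReal_mul hη.le]
  refine ENNReal.ofReal_le_ofReal ?_
  have h5 : N ≤ znorm (x - xs n) + znorm x := by
    rw [znorm_sub_comm]
    refine le_trans (le_of_eq ?_) (znorm_add_le (xs n - x) x)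
    simp [N]
  rw [div_le_iff₀ hη] at hn2
  calc D * Real.exp (-(κ * znorm (x - xs n)))
      ≤ |D| * Real.exp (-(κ / 2 * N)) := by
        refine mul_le_mul (le_abs_self _) (Real.exp_le_exp.2 ?_) (Real.exp_pos _).le (abs_nonneg _)
        have h6 : N / 2 ≤ znorm (x - xs n) := by nlinarith
        nlinarith [mul_le_mul_of_nonneg_left h6 hκ.le]
    _ = (|D| * Real.exp (θ * d)) * Real.exp (-(κ / 2 * N) - θ * d) := by
        rw [mul_assoc, ← Real.exp_add]
        congr 2
        ring
    _ ≤ (Real.exp (κ / 4 * N) * η) * Real.exp (-(κ / 2 * N) - θ * d) := by gcongr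
    _ = η * Real.exp (-(κ / 4 * N) - θ * d) := by
        rw [mul_comm (Real.exp _) η, mul_assoc, ← Real.exp_add]
        congr 2
        ring
    _ ≤ η * Real.exp (-(κ / 8 * N) - θ * (d + δ * N)) := by
        refine mul_le_mul_of_nonneg_left (Real.exp_le_exp.2 ?_) hη.le
        have h6 : θ * δ * N ≤ κ / 8 * N := mul_le_mul_of_nonneg_right (by linarith [hδ.1]) hN
        linarith

theorem eventually_grn_add_le (h : Standing μ) {xs : ℕ → Fin d → ℤ} (hx : AlongDrift μ xs)
    (Λ : Set (Fin d)) {w : Fin d → ℤ} (hw : ∀ i ∈ Λ, w i = 0) {η : ℝ} (hη : 0 < η) :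
    ∀ᶠ δ in 𝓝[>] (0 : ℝ), ∀ᶠ n in atTop, ∀ x ∈ posDom Λ, znorm x ≤ δ * znorm (xs n) →
      grn μ Λ (xs n) (x + w) ≤ ENNReal.ofReal (1 + η) * grn μ Λ (xs n) x := by
  obtain ⟨κ, hκ, D, hD, H⟩ := h.exists_green_shift_le Λ hw (half_pos hη)
  filter_upwards [h.eventually_exp_le_mul_grn hx Λ hκ D (half_pos hη)] with δ hδ
  filter_upwards [hδ] with n hn x hxS hxn
  refine (H x hxS (xs n)).trans ((add_le_add le_rfl (hn x hxS hxn)).trans (le_of_eq ?_))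
  rw [grn, ← add_mul, ← ENNReal.ofReal_add (by positivity) (by positivity)]
  ring_nf

theorem eventually_kop_restr_grn_le (h : Standing μ) {xs : ℕ → Fin d → ℤ} (hx : AlongDrift μ xs)
    {Λ : Set (Fin d)} (hΛ : Λ ⊆ LambdaM μ) {i : Fin d} (hi : i ∈ Λ) {P : (Fin d → ℤ) → Prop}
    (hP : P = (fun z => z i ≠ 0) ∨ P = fun z => ¬z i ≠ 0) {η : ℝ} (hη : 0 < η) :
    ∀ᶠ δ in 𝓝[>] (0 : ℝ), ∀ᶠ n in atTop, ∀ x ∈ posDom Λ, znorm x ≤ δ * znorm (xs n) →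
      kop (ks (restr (wt μ) P) (posDom Λ)) (grn μ Λ (xs n)) x ≤
        (∑' z, restr (wt μ) P z + ENNReal.ofReal η) * grn μ Λ (xs n) x := by
  have hfin : ∑' z, restr (wt μ) P z ≠ ⊤ := ne_top_of_le_ne_top ENNReal.one_ne_top
    ((ENNReal.tsum_le_tsum (restr_le _ _)).trans h.tsum_wt.le)
  have hα := (ENNReal.ofReal_toReal hfin).symm
  set α := (∑' z, restr (wt μ) P z).toReal
  have hα0 : 0 ≤ α := ENNReal.toReal_nonneg
  obtain ⟨κ, hκ, D, hD, H⟩ := h.exists_kop_restr_green_le hΛ hi hP hα0 (half_pos hη) hα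
  filter_upwards [h.eventually_exp_le_mul_grn hx Λ hκ D (half_pos hη)] with δ hδ
  filter_upwards [hδ] with n hn x hxS hxn
  refine (H x (xs n)).trans ((add_le_add le_rfl (hn x hxS hxn)).trans (le_of_eq ?_))
  rw [grn, ← add_mul, ← ENNReal.ofReal_add (by positivity) (by positivity), hα,
    ← ENNReal.ofReal_add hα0 hη.le]
  ring_nf

end Standing

end

noncomputable section

variable {d : ℕ} {μ : (Fin d → ℤ) → ℝ}

/-- Minimum principle: a bound `lam * g ≤ F` on the contact set `C` propagates to all of `I`. -/
theorem mul_le_of_min {ι : Type*} {I : Finset ι} {C : Set ι} {F g : ι → ℝ} {lam : ℝ}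
    (hF : ∀ s ∈ I, 0 < F s) (hg : ∀ s ∈ I, 0 < g s) (hC : ∀ s ∈ I, s ∈ C → lam * g s ≤ F s)
    (hstep : ∀ s ∈ I, s ∉ C → ∀ ρ > 0, (∀ t ∈ I, ρ * g t ≤ F t) → ρ * g s < F s) :
    ∀ s ∈ I, lam * g s ≤ F s := by
  intro s hs
  obtain ⟨m, hm, hmin⟩ := I.exists_min_image (fun t => F t / g t) ⟨s, hs⟩
  have hle : ∀ t ∈ I, F m / g m * g t ≤ F t := fun t ht => by
    rw [← le_div_iff₀ (hg t ht)]
    exact hmin t ht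
  have hmC : m ∈ C := by
    by_contra hcon
    have := hstep m hm hcon _ (div_pos (hF m hm) (hg m hm)) hle
    rw [div_mul_cancel₀ _ (hg m hm).ne'] at this
    exact lt_irrefl _ this
  refine le_trans ?_ (hle s hs)
  refine mul_le_mul_of_nonneg_right ?_ (hg s hs).le
  rw [le_div_iff₀ (hg m hm)]
  exact hC m hm hmC

theorem tsum_restr_add (P : (Fin d → ℤ) → Prop) (f : (Fin d → ℤ) → ℝ≥0∞) :
    ∑' z, restr (wt μ) P z * f z + ∑' z, restr (wt μ) (fun z => ¬P z) z * f z =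
      ∑' z, wt μ z * f z := by
  rw [← ENNReal.tsum_add]
  refine tsum_congr fun z => ?_
  by_cases hz : P z <;> simp [restr, hz]

namespace Standing

theorem exists_neg_jump (h : Standing μ) (i : Fin d) : ∃ z, 0 < μ z ∧ z i < 0 := by
  obtain ⟨k, c, h0, hk, -, hpos⟩ := h.irred ∅ 0 (by simp [posDom]) (Pi.single i (-1))
    (by simp [posDom])
  by_contra! hcon
  have hmono : ∀ j ≤ k, 0 ≤ c j i := by
    intro j
    induction j with
    | zero => simp [h0]
    | succ j ih =>
      intro hj
      have h1 := ih (by omega)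
      have h2 := hcon _ (hpos j (by omega))
      simp only [Pi.sub_apply] at h2
      omega
  have := hmono k le_rfl
  simp [hk] at this

theorem one_lt_tsum_exp (h : Standing μ) {i : Fin d} (hi : Mvec μ i = 0) {κ : ℝ} (hκ : κ ≠ 0) :
    1 < ∑' z, wt μ z * ENNReal.ofReal (Real.exp (κ * z i)) := by
  by_contra! hcon
  have hnn : ∀ z : Fin d → ℤ, 0 ≤ μ z * Real.exp (κ * z i) := fun z =>
    mul_nonneg (h.nonneg z) (Real.exp_pos _).le
  have e1 : ∀ z : Fin d → ℤ, wt μ z * ENNReal.ofReal (Real.exp (κ * z i)) =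
      ENNReal.ofReal (μ z * Real.exp (κ * z i)) := fun z =>
    (ENNReal.ofReal_mul (h.nonneg z)).symm
  simp only [e1] at hcon
  have hs : Summable fun z : Fin d → ℤ => μ z * Real.exp (κ * z i) := by
    have := ENNReal.summable_toReal (ne_top_of_le_ne_top ENNReal.one_ne_top hcon)
    simpa only [ENNReal.toReal_ofReal (hnn _)] using this
  rw [← ENNReal.ofReal_tsum_of_nonneg hnn hs, ENNReal.ofReal_le_one] at hcon
  have hmean : HasSum (fun z : Fin d → ℤ => μ z * (z i : ℝ)) 0 := by
    rw [← hi]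
    exact (h.summable_mean i).hasSum
  have hdiff := (hs.hasSum.sub h.sum).sub (hmean.mul_left κ)
  obtain ⟨z, hz, hzi⟩ := h.exists_neg_jump i
  have hterm : ∀ z : Fin d → ℤ, 0 ≤ μ z * Real.exp (κ * z i) - μ z - κ * (μ z * z i) := fun z => by
    have := Real.add_one_le_exp (κ * z i)
    nlinarith [h.nonneg z]
  have hpos : 0 < μ z * Real.exp (κ * z i) - μ z - κ * (μ z * z i) := by
    have : κ * z i + 1 < Real.exp (κ * z i) :=
      Real.add_one_lt_exp (mul_ne_zero hκ (by exact_mod_cast hzi.ne))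
    nlinarith
  have := (hpos.trans_le (le_hasSum hdiff z fun y _ => hterm y))
  linarith

theorem tsum_restr_lt_tsum_exp (h : Standing μ) {i : Fin d} (hi : Mvec μ i = 0) {κ : ℝ}
    (hκ : κ ≠ 0) : ∑' z, restr (wt μ) (fun z => z i ≠ 0) z <
      ∑' z, restr (wt μ) (fun z => z i ≠ 0) z * ENNReal.ofReal (Real.exp (κ * z i)) := by
  have h1 := h.one_lt_tsum_exp hi hκ
  rw [← h.tsum_wt, ← tsum_restr_add fun z => z i ≠ 0] at h1
  have h2 := tsum_restr_add (μ := μ) (fun z => z i ≠ 0) 1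
  simp only [Pi.one_apply, mul_one] at h2
  rw [← h2] at h1
  have h3 : ∀ z : Fin d → ℤ, restr (wt μ) (fun z => ¬z i ≠ 0) z *
      ENNReal.ofReal (Real.exp (κ * z i)) = restr (wt μ) (fun z => ¬z i ≠ 0) z := fun z => by
    by_cases hz : z i = 0 <;> simp [restr, hz]
  simp only [h3] at h1
  exact lt_of_add_lt_add_right h1

end Standing

/-- A sum exceeding a bound does so when restricted to a bounded set. -/
theorem exists_lt_tsum_znorm_le {f : (Fin d → ℤ) → ℝ≥0∞} {b : ℝ≥0∞} (hb : b < ∑' z, f z) :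
    ∃ R : ℕ, b < ∑' z, if znorm z ≤ R then f z else 0 := by
  rw [ENNReal.tsum_eq_iSup_sum, lt_iSup_iff] at hb
  obtain ⟨s, hs⟩ := hb
  obtain ⟨B, hB⟩ := (s.image znorm).exists_le
  obtain ⟨R, hR⟩ := exists_nat_ge B
  refine ⟨R, hs.trans_le (le_trans (le_of_eq (Finset.sum_congr rfl fun z hz => ?_))
    (ENNReal.sum_le_tsum s))⟩
  rw [if_pos ((hB _ (Finset.mem_image_of_mem _ hz)).trans hR)]

theorem finite_znorm_le (R : ℝ) : {z : Fin d → ℤ | znorm z ≤ R}.Finite := by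
  refine (Set.Finite.pi' fun _ : Fin d => Set.finite_Icc (-⌊R⌋) ⌊R⌋).subset fun z hz i => ?_
  have := abs_le.1 ((abs_le_znorm z i).trans hz)
  constructor
  · have : (-(z i) : ℤ) ≤ ⌊R⌋ := Int.le_floor.2 (by push_cast; linarith)
    omega
  · exact Int.le_floor.2 this.2

end

noncomputable section

variable {d : ℕ} {μ : (Fin d → ℤ) → ℝ}

theorem update_mem_posDom {Λ : Set (Fin d)} {x : Fin d → ℤ} (hx : x ∈ posDom Λ) (i : Fin d)
    {s : ℤ} (hs : i ∈ Λ → 0 < s) : Function.update x i s ∈ posDom Λ := fun j hj => by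
  rcases eq_or_ne j i with rfl | hne
  · simpa using hs hj
  · simpa [hne] using hx j hj

theorem znorm_update (x : Fin d → ℤ) (i : Fin d) (s : ℤ) :
    znorm (Function.update x i s) + |(x i : ℝ)| = znorm x + |(s : ℝ)| := by
  unfold znorm
  rw [← Finset.add_sum_erase _ _ (Finset.mem_univ i),
    ← Finset.add_sum_erase _ (fun j => |(x j : ℝ)|) (Finset.mem_univ i)]
  have : ∑ l ∈ Finset.univ.erase i, |((Function.update x i s l : ℤ) : ℝ)| =
      ∑ l ∈ Finset.univ.erase i, |(x l : ℝ)| :=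
    Finset.sum_congr rfl fun l hl => by simp [(Finset.mem_erase.1 hl).1]
  rw [this, Function.update_self]
  ring

theorem znorm_update_le (x : Fin d → ℤ) (i : Fin d) {s : ℤ} (hs : |s| ≤ |x i|) :
    znorm (Function.update x i s) ≤ znorm x := by
  have := znorm_update x i s
  have h' : |(s : ℝ)| ≤ |(x i : ℝ)| := by exact_mod_cast hs
  linarith

namespace Standing

theorem exists_grn_le_update_of_mem (h : Standing μ) {xs : ℕ → Fin d → ℤ} (hx : AlongDrift μ xs)
    {i : Fin d} (hi : i ∈ LambdaM μ) {κ : ℝ} (hκ : 0 < κ) :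
    ∃ C ≥ 0, ∀ᶠ δ in 𝓝[>] (0 : ℝ), ∀ᶠ n in atTop, ∀ x ∈ posDom (LambdaM μ),
      znorm x ≤ δ * znorm (xs n) → grn μ (LambdaM μ) (xs n) x ≤
        ENNReal.ofReal (C * Real.exp (κ * |(x i : ℝ)|)) *
          grn μ (LambdaM μ) (xs n) (Function.update x i 1) := by
  set Λ := LambdaM μ
  obtain ⟨θ, hθ, H⟩ := h.exists_harnack Λ
  set P : (Fin d → ℤ) → Prop := fun z => z i ≠ 0
  obtain ⟨R, hR⟩ := exists_lt_tsum_znorm_le (h.tsum_restr_lt_tsum_exp hi hκ.ne')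
  set m' : (Fin d → ℤ) → ℝ≥0∞ := fun z => if znorm z ≤ R then restr (wt μ) P z else 0
  have hm'le : ∀ z, m' z ≤ restr (wt μ) P z := fun z => by
    simp only [m']
    split_ifs
    exacts [le_rfl, zero_le]
  have hα1 : ∑' z, restr (wt μ) P z ≤ 1 :=
    (ENNReal.tsum_le_tsum (restr_le _ _)).trans h.tsum_wt.le
  have hαtop := ne_top_of_le_ne_top ENNReal.one_ne_top hα1
  have ea : ∀ z : Fin d → ℤ, (if znorm z ≤ R then
      restr (wt μ) P z * ENNReal.ofReal (Real.exp (κ * z i)) else 0) =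
      m' z * ENNReal.ofReal (Real.exp (κ * z i)) := fun z => by
    simp only [m']
    split_ifs <;> simp
  replace hR := hR.trans_eq (tsum_congr ea)
  set a := ∑' z, m' z * ENNReal.ofReal (Real.exp (κ * z i))
  have hatop : a ≠ ⊤ := by
    have : a ≤ ∑' z, restr (wt μ) P z * ENNReal.ofReal (Real.exp (κ * R)) := by
      refine ENNReal.tsum_le_tsum fun z => ?_
      by_cases hz : znorm z ≤ R
      · refine mul_le_mul' (hm'le z) ?_
        gcongr
        exact (le_abs_self _).trans ((abs_le_znorm z i).trans hz)
      · simp [m', hz]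
    refine ne_top_of_le_ne_top ?_ this
    rw [ENNReal.tsum_mul_right]
    exact ENNReal.mul_ne_top hαtop ENNReal.ofReal_ne_top
  set α := ∑' z, restr (wt μ) P z
  have hα0 : 0 ≤ α.toReal := ENNReal.toReal_nonneg
  have hα1' : α.toReal ≤ 1 := by
    have := ENNReal.toReal_mono ENNReal.one_ne_top hα1
    simpa using this
  have hαa : α.toReal < a.toReal := (ENNReal.toReal_lt_toReal hαtop hatop).2 hR
  set η := min 1 ((a.toReal - α.toReal) / 4)
  have hη : 0 < η := lt_min one_pos (by linarith)
  have hη1 : η ≤ 1 := min_le_left _ _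
  have hη2 : η ≤ (a.toReal - α.toReal) / 4 := min_le_right _ _
  set b := (1 + η) * (α.toReal + η)
  have hb0 : 0 < b := by positivity
  have hbα : α.toReal ≤ b := by simp only [b]; nlinarith
  have hba : b < a.toReal := by simp only [b]; nlinarith
  refine ⟨Real.exp (θ * R) / (Real.exp κ - 1),
    div_nonneg (Real.exp_pos _).le (by linarith [Real.add_one_le_exp κ]), ?_⟩
  have hw : ∀ᶠ δ in 𝓝[>] (0 : ℝ), ∀ᶠ n in atTop, ∀ w ∈ {w : Fin d → ℤ | znorm w ≤ R},
      (∀ j ∈ Λ, w j = 0) → ∀ x ∈ posDom Λ, znorm x ≤ δ * znorm (xs n) →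
      grn μ Λ (xs n) (x + w) ≤ ENNReal.ofReal (1 + η) * grn μ Λ (xs n) x := by
    refine ((eventually_all_finite (finite_znorm_le R)).2 fun w _ => ?_).mono fun δ hδ =>
      (eventually_all_finite (finite_znorm_le R)).2 hδ
    by_cases hw : ∀ j ∈ Λ, w j = 0
    · exact (h.eventually_grn_add_le hx Λ hw hη).mono fun δ hδ => hδ.mono fun n hn _ => hn
    · exact Eventually.of_forall fun δ => Eventually.of_forall fun n hw' => absurd hw' hw
  obtain ⟨δ', hδ'1, hδ'2, hδ'0⟩ := (hw.and ((h.eventually_kop_restr_grn_le hx (le_refl Λ) hi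
    (P := P) (Or.inl rfl) hη).and self_mem_nhdsWithin)).exists
  filter_upwards [Ioo_mem_nhdsGT (half_pos hδ'0)] with δ hδ
  filter_upwards [hδ'1, hδ'2, hx.norm.eventually_ge_atTop (2 * R / δ'),
    h.eventually_exp_le_grn hx Λ one_pos] with n h1 h2 h3 h4 x hxS hxn
  rw [div_le_iff₀ hδ'0] at h3
  set N := znorm (xs n)
  have hN : 0 ≤ N := znorm_nonneg _
  have hxR : znorm x + R ≤ δ' * N := by nlinarith [hδ.2]
  set u := grn μ Λ (xs n)
  have hutop : ∀ x, u x ≠ ⊤ := fun x => h.green_ne_top _ _ _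
  have hupos : ∀ x ∈ posDom Λ, u x ≠ 0 := fun x hx hux => by
    have h5 := h4.trans (H _ (kop_grn_le Λ (xs n)) x hx 1 (one_mem_posDom _))
    rw [show grn μ Λ (xs n) x = 0 from hux, mul_zero] at h5
    exact absurd h5 (by simp [Real.exp_pos])
  have hx0 : 0 < x i := hxS i hi
  set F : ℤ → ℝ := fun s => (u (Function.update x i s)).toReal
  set g : ℤ → ℝ := fun s => Real.exp (κ * s) - 1
  have hmem : ∀ s : ℤ, 0 < s → Function.update x i s ∈ posDom Λ := fun s hs =>
    update_mem_posDom hxS i fun _ => hs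
  have hF : ∀ s : ℤ, 0 < s → 0 < F s := fun s hs =>
    ENNReal.toReal_pos (hupos _ (hmem s hs)) (hutop _)
  have hFof : ∀ s : ℤ, ENNReal.ofReal (F s) = u (Function.update x i s) := fun s =>
    ENNReal.ofReal_toReal (hutop _)
  have hg : ∀ s : ℤ, 0 < s → 0 < g s := fun s hs => by
    have : (0 : ℝ) < s := by exact_mod_cast hs
    simp only [g]
    linarith [Real.add_one_le_exp (κ * s), mul_pos hκ this]
  have hxupd : Function.update x i (x i) = x := Function.update_eq_self i x
  have hcmp := mul_le_of_min (I := Finset.Icc 1 (x i)) (C := {s | x i < s + R}) (F := F) (g := g)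
    (lam := Real.exp (-(θ * R)) * F (x i) * Real.exp (-(κ * x i)))
    (fun s hs => hF s (by rw [Finset.mem_Icc] at hs; omega))
    (fun s hs => hg s (by rw [Finset.mem_Icc] at hs; omega)) ?_ ?_ 1 (by
      rw [Finset.mem_Icc]; omega)
  · have hg1 : g 1 = Real.exp κ - 1 := by simp [g]
    have hg1pos := hg 1 one_pos
    have : F (x i) ≤ Real.exp (θ * R) / (Real.exp κ - 1) * Real.exp (κ * x i) * F 1 := by
      rw [← hg1, div_mul_eq_mul_div, div_mul_eq_mul_div, le_div_iff₀ hg1pos]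
      have e1 : F (x i) * g 1 = Real.exp (θ * R) * Real.exp (κ * x i) *
          (Real.exp (-(θ * R)) * F (x i) * Real.exp (-(κ * x i)) * g 1) := by
        rw [Real.exp_neg, Real.exp_neg]
        field_simp
      rw [e1]
      exact mul_le_mul_of_nonneg_left hcmp (by positivity)
    have h5 := ENNReal.ofReal_le_ofReal this
    rw [ENNReal.ofReal_mul (by rw [← hg1]; positivity), hFof, hFof, hxupd] at h5
    have e2 : |((x i : ℤ) : ℝ)| = x i := abs_of_pos (by exact_mod_cast hx0)
    rwa [e2]
  · intro s hs hsC
    rw [Finset.mem_Icc] at hs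
    rw [Set.mem_ofPred_eq] at hsC
    have hs0 : (0 : ℝ) ≤ s := by exact_mod_cast (by omega : (0 : ℤ) ≤ s)
    have hsx : (s : ℝ) ≤ x i := by exact_mod_cast hs.2
    have hsC' : (x i : ℝ) < s + R := by exact_mod_cast hsC
    have h5 : F (x i) ≤ Real.exp (θ * R) * F s := by
      have h6 := H u (kop_grn_le Λ (xs n)) _ (hmem s (by omega)) _ (hmem (x i) (by omega))
      have h7 : znorm (Function.update x i (x i) - Function.update x i s) ≤ R := by
        rw [← Function.update_sub, sub_self]
        have := znorm_update (0 : Fin d → ℤ) i (x i - s)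
        simp only [Pi.zero_apply, Int.cast_zero, abs_zero, add_zero] at this
        rw [this]
        simp only [znorm, Pi.zero_apply, Int.cast_zero, abs_zero, Finset.sum_const_zero, zero_add]
        push_cast
        rw [abs_of_nonneg (by linarith)]
        linarith
      rw [← ENNReal.ofReal_le_ofReal_iff (by have := hF s (by omega); positivity),
        ENNReal.ofReal_mul (Real.exp_pos _).le, hFof, hFof]
      refine h6.trans ?_
      gcongr
    have h8 : g s ≤ Real.exp (κ * x i) := by
      have : Real.exp (κ * s) ≤ Real.exp (κ * x i) :=
        Real.exp_le_exp.2 (mul_le_mul_of_nonneg_left hsx hκ.le)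
      simp only [g]
      linarith
    have hFx := hF (x i) hx0
    calc Real.exp (-(θ * R)) * F (x i) * Real.exp (-(κ * x i)) * g s
        ≤ Real.exp (-(θ * R)) * (Real.exp (θ * R) * F s) * Real.exp (-(κ * x i)) *
          Real.exp (κ * x i) := by
          have := hg s (by omega)
          gcongr
      _ = F s := by
          rw [Real.exp_neg, Real.exp_neg]
          field_simp
  · intro s hs hsC ρ hρ hρF
    rw [Finset.mem_Icc] at hs
    rw [Set.mem_ofPred_eq, not_lt] at hsC
    set p := Function.update x i s
    have hp : p ∈ posDom Λ := hmem s (by omega)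
    have hpn : znorm p ≤ znorm x :=
      znorm_update_le x i (by rw [abs_of_pos hx0, abs_of_pos (by omega)]; exact hs.2)
    have hpi : p i = s := by simp [p]
    have hA := h2 p hp (by linarith [Nat.cast_nonneg (α := ℝ) R])
    have hterm : ∀ z, ENNReal.ofReal ρ * (m' z * ENNReal.ofReal (g (s + z i))) ≤
        ENNReal.ofReal (1 + η) *
          (restr (wt μ) P z * if p + z ∈ posDom Λ then u (p + z) else 0) := by
      intro z
      by_cases hz0 : m' z = 0
      · simp [hz0]
      have hzR : znorm z ≤ R := by
        by_contra hcon
        exact hz0 (by simp [m', hcon])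
      have hmu : μ z ≠ 0 := fun hmu => hz0 (by simp [m', restr, wt, hmu])
      have hzP : z i ≠ 0 := by
        by_contra hcon
        exact hz0 (by simp [m', restr, P, hcon])
      have hzΛ : ∀ j ∈ Λ, j ≠ i → z j = 0 := fun j hj hji => by
        by_contra hcon
        exact hmu (h.mixed z j i hji hj hi hcon hzP)
      rcases le_or_gt (s + z i) 0 with hneg | hpos
      · have : g (s + z i) ≤ 0 := by
          have : ((s + z i : ℤ) : ℝ) ≤ 0 := by exact_mod_cast hneg
          simp only [g]
          have := Real.exp_le_one_iff.2 (mul_nonpos_of_nonneg_of_nonpos hκ.le this)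
          linarith
        rw [ENNReal.ofReal_of_nonpos this]
        simp
      · have hzi : (z i : ℝ) ≤ R := (le_abs_self _).trans ((abs_le_znorm z i).trans hzR)
        have hzi' : z i ≤ R := by exact_mod_cast hzi
        have hpz : p + z ∈ posDom Λ := fun j hj => by
          rcases eq_or_ne j i with rfl | hne
          · simpa [hpi] using hpos
          · simpa [hzΛ j hj hne] using hp j hj
        rw [if_pos hpz]
        set w := Function.update (-z) i 0
        have hwR : znorm w ≤ R := (znorm_update_le (-z) i (by simp)).trans (by rwa [znorm_neg])
        have hwΛ : ∀ j ∈ Λ, w j = 0 := fun j hj => by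
          rcases eq_or_ne j i with rfl | hne
          · simp [w]
          · simp [w, hne, hzΛ j hj hne]
        have hpw : p + z + w = Function.update x i (s + z i) := by
          funext j
          rcases eq_or_ne j i with rfl | hne
          · simp [p, w]
          · simp [p, w, hne]
        have h5 := h1 w hwR hwΛ (p + z) hpz (by
          have := znorm_add_le p z
          linarith)
        rw [hpw] at h5
        have h6 := ENNReal.ofReal_le_ofReal (hρF (s + z i) (by rw [Finset.mem_Icc]; omega))
        rw [hFof, ENNReal.ofReal_mul hρ.le] at h6
        calc ENNReal.ofReal ρ * (m' z * ENNReal.ofReal (g (s + z i)))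
            = m' z * (ENNReal.ofReal ρ * ENNReal.ofReal (g (s + z i))) := by ring
          _ ≤ restr (wt μ) P z * (ENNReal.ofReal (1 + η) * u (p + z)) :=
              mul_le_mul' (hm'le z) (h6.trans h5)
          _ = _ := by ring
    have hsum := ENNReal.tsum_le_tsum hterm
    rw [ENNReal.tsum_mul_left, ENNReal.tsum_mul_left] at hsum
    rw [kop_ks_apply, if_pos hp] at hA
    have hsum2 := hsum.trans (mul_le_mul_right hA _)
    set T := ∑' z, m' z * ENNReal.ofReal (g (s + z i))
    have hTα : ENNReal.ofReal (Real.exp (κ * s)) * a ≤ T + α := by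
      rw [← ENNReal.tsum_mul_left]
      refine le_trans ?_ (add_le_add le_rfl (ENNReal.tsum_le_tsum hm'le))
      rw [← ENNReal.tsum_add]
      refine ENNReal.tsum_le_tsum fun z => ?_
      have : ENNReal.ofReal (Real.exp (κ * s + κ * z i)) ≤ ENNReal.ofReal (g (s + z i)) + 1 := by
        rw [← ENNReal.ofReal_one]
        refine le_trans (ENNReal.ofReal_le_ofReal ?_) ENNReal.ofReal_add_le
        simp only [g]
        push_cast
        rw [mul_add]
        linarith
      rw [mul_left_comm, ← ENNReal.ofReal_mul (Real.exp_pos _).le, ← Real.exp_add]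
      exact (mul_le_mul_right this _).trans (by rw [mul_add, mul_one])
    have hu := hutop p
    have hTtop : T ≠ ⊤ := by
      intro hT
      rw [hT, ENNReal.mul_top (by simpa using hρ)] at hsum2
      exact absurd hsum2 (not_le.2 (ENNReal.mul_lt_top ENNReal.ofReal_lt_top
        (ENNReal.mul_lt_top (ENNReal.add_lt_top.2 ⟨hαtop.lt_top, ENNReal.ofReal_lt_top⟩)
          hu.lt_top)))
    have r1 := ENNReal.toReal_mono (ENNReal.add_ne_top.2 ⟨hTtop, hαtop⟩) hTα
    rw [ENNReal.toReal_mul, ENNReal.toReal_ofReal (Real.exp_pos _).le,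
      ENNReal.toReal_add hTtop hαtop] at r1
    have r2 := ENNReal.toReal_mono (ENNReal.mul_ne_top ENNReal.ofReal_ne_top
      (ENNReal.mul_ne_top (ENNReal.add_ne_top.2 ⟨hαtop, ENNReal.ofReal_ne_top⟩) hu)) hsum2
    rw [ENNReal.toReal_mul, ENNReal.toReal_ofReal hρ.le, ENNReal.toReal_mul,
      ENNReal.toReal_ofReal (by positivity), ENNReal.toReal_mul,
      ENNReal.toReal_add hαtop ENNReal.ofReal_ne_top, ENNReal.toReal_ofReal hη.le, ← mul_assoc] at r2
    have r3 : ρ * T.toReal ≤ b * F s := r2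
    have hE := Real.exp_pos (κ * s)
    have r4 : ρ * (b * g s) < ρ * T.toReal := by
      refine mul_lt_mul_of_pos_left ?_ hρ
      have : Real.exp (κ * s) * b < Real.exp (κ * s) * a.toReal := by gcongr
      simp only [g]
      nlinarith
    have : b * (ρ * g s) < b * F s := by linarith
    exact lt_of_mul_lt_mul_left this hb0.le

end Standing

end

noncomputable section

variable {d : ℕ} {μ : (Fin d → ℤ) → ℝ}

theorem znorm_single (i : Fin d) (s : ℤ) : znorm (Pi.single i s) = |(s : ℝ)| := by
  have := znorm_update (0 : Fin d → ℤ) i s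
  have h0 : znorm (0 : Fin d → ℤ) = 0 := by simp [znorm]
  rw [Pi.single]
  simpa [h0] using this

theorem znorm_piecewise_one_le (T : Finset (Fin d)) (x : Fin d → ℤ) :
    znorm (T.piecewise 1 x) ≤ znorm x + d := by
  have : znorm (T.piecewise 1 x) ≤ ∑ i, (|(x i : ℝ)| + 1) := by
    refine Finset.sum_le_sum fun i _ => ?_
    by_cases hi : i ∈ T <;> simp [hi]
  simpa [znorm, Finset.sum_add_distrib] using this

namespace Standing

theorem exists_grn_le_update_of_notMem (h : Standing μ) {xs : ℕ → Fin d → ℤ}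
    (hx : AlongDrift μ xs) (Λ : Set (Fin d)) {i : Fin d} (hi : i ∉ Λ) {κ : ℝ} (hκ : 0 < κ) :
    ∃ C ≥ 0, ∀ᶠ δ in 𝓝[>] (0 : ℝ), ∀ᶠ n in atTop, ∀ x ∈ posDom Λ,
      znorm x ≤ δ * znorm (xs n) → grn μ Λ (xs n) x ≤
        ENNReal.ofReal (C * Real.exp (κ * |(x i : ℝ)|)) *
          grn μ Λ (xs n) (Function.update x i 1) := by
  have hη : 0 < Real.exp κ - 1 := by linarith [Real.add_one_le_exp κ]
  have hw : ∀ s : ℤ, ∀ j ∈ Λ, (Pi.single i s : Fin d → ℤ) j = 0 := fun s j hj => by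
    rw [Pi.single_eq_of_ne]
    rintro rfl
    exact hi hj
  obtain ⟨δ', h1, h2, h0⟩ := ((h.eventually_grn_add_le hx Λ (hw 1) hη).and
    ((h.eventually_grn_add_le hx Λ (hw (-1)) hη).and self_mem_nhdsWithin)).exists
  replace h0 : 0 < δ' := h0
  refine ⟨Real.exp κ, (Real.exp_pos _).le, ?_⟩
  filter_upwards [Ioo_mem_nhdsGT (show 0 < δ' / 3 by positivity)] with δ hδ
  filter_upwards [h1, h2, hx.norm.eventually_ge_atTop (3 / δ')] with n h1 h2 h3 x hxS hxn
  rw [div_le_iff₀ h0] at h3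
  rw [add_sub_cancel] at h1 h2
  set u := grn μ Λ (xs n)
  have key : ∀ (k : ℕ) (x : Fin d → ℤ), x ∈ posDom Λ → |x i - 1| = k →
      znorm x + k ≤ δ' * znorm (xs n) →
      u x ≤ ENNReal.ofReal (Real.exp (κ * k)) * u (Function.update x i 1) := by
    intro k
    induction k with
    | zero =>
      intro x _ hk _
      have : x i = 1 := by
        rw [Nat.cast_zero, abs_eq_zero] at hk
        omega
      simp [← this]
    | succ k ih =>
      intro x hxS hk hxn
      obtain ⟨s, hs, hs', hw⟩ : ∃ s : ℤ, |s| = 1 ∧ |x i - s - 1| = k ∧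
          ∀ y ∈ posDom Λ, znorm y ≤ δ' * znorm (xs n) →
          u (y + Pi.single i s) ≤ ENNReal.ofReal (Real.exp κ) * u y := by
        rcases le_or_gt (x i) 1 with h5 | h5
        · refine ⟨-1, by simp, ?_, h2⟩
          rw [abs_of_nonpos (by omega)] at hk
          rw [abs_of_nonpos] <;> omega
        · refine ⟨1, by simp, ?_, h1⟩
          rw [abs_of_nonneg (by omega)] at hk
          rw [abs_of_nonneg] <;> omega
      have hy : x - Pi.single i s ∈ posDom Λ := fun j hj => by
        have : j ≠ i := fun hji => hi (hji ▸ hj)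
        simpa [this] using hxS j hj
      have hyn : znorm (x - Pi.single i s) ≤ znorm x + 1 := by
        have := znorm_add_le x (-Pi.single i s)
        rw [znorm_neg, znorm_single, ← sub_eq_add_neg] at this
        have hs1 : |(s : ℝ)| = 1 := by exact_mod_cast hs
        rwa [hs1] at this
      push_cast at hxn
      have hk0 : (0 : ℝ) ≤ k := k.cast_nonneg
      have e1 := hw _ hy (by linarith)
      have e2 := ih _ hy (by simpa using hs') (by linarith)
      have e3 : Function.update (x - Pi.single i s) i 1 = Function.update x i 1 := by
        funext j
        rcases eq_or_ne j i with rfl | hne <;> simp [*]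
      rw [sub_add_cancel] at e1
      rw [e3] at e2
      refine e1.trans ((mul_le_mul_right e2 _).trans_eq ?_)
      rw [← mul_assoc, ← ENNReal.ofReal_mul (Real.exp_pos _).le, ← Real.exp_add]
      congr 3
      push_cast
      ring
  have hk : ((x i - 1).natAbs : ℝ) ≤ |(x i : ℝ)| + 1 := by
    rw [Nat.cast_natAbs]
    push_cast
    simpa using abs_sub (x i : ℝ) 1
  have hxi := abs_le_znorm x i
  refine (key (x i - 1).natAbs x hxS (by simp) ?_).trans ?_
  · have := hδ.2
    have hN := znorm_nonneg (xs n)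
    nlinarith
  · rw [← Real.exp_add]
    gcongr
    nlinarith

theorem exists_grn_le_update (h : Standing μ) {xs : ℕ → Fin d → ℤ} (hx : AlongDrift μ xs)
    (i : Fin d) {κ : ℝ} (hκ : 0 < κ) :
    ∃ C ≥ 0, ∀ᶠ δ in 𝓝[>] (0 : ℝ), ∀ᶠ n in atTop, ∀ x ∈ posDom (LambdaM μ),
      znorm x ≤ δ * znorm (xs n) → grn μ (LambdaM μ) (xs n) x ≤
        ENNReal.ofReal (C * Real.exp (κ * |(x i : ℝ)|)) *
          grn μ (LambdaM μ) (xs n) (Function.update x i 1) := by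
  by_cases hi : i ∈ LambdaM μ
  · exact h.exists_grn_le_update_of_mem hx hi hκ
  · exact h.exists_grn_le_update_of_notMem hx _ hi hκ

theorem exists_grn_le_piecewise (h : Standing μ) {xs : ℕ → Fin d → ℤ} (hx : AlongDrift μ xs)
    {κ : ℝ} (hκ : 0 < κ) (T : Finset (Fin d)) :
    ∃ C ≥ 0, ∀ᶠ δ in 𝓝[>] (0 : ℝ), ∀ᶠ n in atTop, ∀ x ∈ posDom (LambdaM μ),
      znorm x ≤ δ * znorm (xs n) → grn μ (LambdaM μ) (xs n) x ≤
        ENNReal.ofReal (C * Real.exp (κ * ∑ i ∈ T, |(x i : ℝ)|)) *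
          grn μ (LambdaM μ) (xs n) (T.piecewise 1 x) := by
  induction T using Finset.induction_on with
  | empty => exact ⟨1, zero_le_one, Eventually.of_forall fun δ => Eventually.of_forall fun n => by
      simp⟩
  | insert i T hi ih =>
    obtain ⟨C, hC, h1⟩ := ih
    obtain ⟨C', hC', h2⟩ := h.exists_grn_le_update hx i hκ
    refine ⟨C * C', mul_nonneg hC hC', ?_⟩
    obtain ⟨δ', h2, h0⟩ := (h2.and self_mem_nhdsWithin).exists
    replace h0 : 0 < δ' := h0
    filter_upwards [h1, Ioo_mem_nhdsGT (show 0 < δ' / 2 by positivity)] with δ h1 hδ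
    filter_upwards [h1, h2, hx.norm.eventually_ge_atTop (2 * d / δ')] with n h1 h2 h3 x hxS hxn
    rw [div_le_iff₀ h0] at h3
    have hy : T.piecewise 1 x ∈ posDom (LambdaM μ) := fun j hj => by
      by_cases hjT : j ∈ T
      · simp [hjT]
      · simpa [hjT] using hxS j hj
    have e2 := h2 _ hy ((znorm_piecewise_one_le T x).trans (by
      have := hδ.2
      have hN := znorm_nonneg (xs n)
      nlinarith))
    rw [Finset.piecewise_eq_of_notMem _ _ _ hi] at e2
    refine (h1 x hxS hxn).trans ((mul_le_mul_right e2 _).trans_eq ?_)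
    rw [Finset.piecewise_insert, Pi.one_apply, ← mul_assoc, ← ENNReal.ofReal_mul (by positivity),
      Finset.sum_insert hi, mul_add, Real.exp_add]
    congr 2
    ring

/-- Subexponential growth of the normalized Green functions, uniformly along the sequence. -/
theorem exists_grn_le (h : Standing μ) {xs : ℕ → Fin d → ℤ} (hx : AlongDrift μ xs)
    {κ : ℝ} (hκ : 0 < κ) :
    ∃ C ≥ 0, ∀ᶠ n in atTop, ∀ x ∈ posDom (LambdaM μ), grn μ (LambdaM μ) (xs n) x ≤
        ENNReal.ofReal (C * Real.exp (κ * znorm x)) * grn μ (LambdaM μ) (xs n) 1 := by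
  obtain ⟨C, hC, h1⟩ := h.exists_grn_le_piecewise hx hκ Finset.univ
  obtain ⟨δ, h1, h0⟩ := (h1.and self_mem_nhdsWithin).exists
  replace h0 : 0 < δ := h0
  set ε := κ * δ / (2 + δ)
  have hε : 0 < ε := by positivity
  have hεκ : ε * (2 + δ) = κ * δ := by simp only [ε]; field_simp
  obtain ⟨D, hD, H⟩ := h.exists_green_le hε
  refine ⟨max C D, hC.trans (le_max_left _ _), ?_⟩
  filter_upwards [h1, h.eventually_exp_le_grn hx (LambdaM μ) hε] with n h1 h2 x hxS
  rcases le_or_gt (znorm x) (δ * znorm (xs n)) with hxn | hxn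
  · refine (h1 x hxS hxn).trans ?_
    rw [Finset.piecewise_univ]
    gcongr
    exacts [le_max_left _ _, le_rfl]
  · refine (H (posDom (LambdaM μ)) x (xs n)).trans (le_trans ?_ (mul_le_mul_right h2 _))
    rw [← ENNReal.ofReal_mul (by positivity), mul_assoc, ← Real.exp_add]
    gcongr
    · exact le_max_right _ _
    · have e1 := znorm_add_le (xs n) (-x)
      rw [znorm_neg, ← sub_eq_add_neg] at e1
      have e2 : ε * znorm (xs n - x) ≤ ε * (znorm (xs n) + znorm x) :=
        mul_le_mul_of_nonneg_left e1 hε.le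
      have e3 : δ * (ε * (2 * znorm (xs n) + znorm x)) ≤ δ * (κ * znorm x) := by
        have : δ * (κ * znorm x) = ε * (2 + δ) * znorm x := by rw [hεκ]; ring
        rw [this]
        nlinarith
      have := le_of_mul_le_mul_left e3 h0
      linarith

end Standing

end

noncomputable section

variable {d : ℕ} {μ : (Fin d → ℤ) → ℝ}

/-- The law of the `i`-th coordinate under the weights `m`. -/
def proj1 (m : (Fin d → ℤ) → ℝ≥0∞) (i : Fin d) (t : ℤ) : ℝ≥0∞ :=
  ∑' z, if z i = t then m z else 0

theorem tsum_proj1 (m : (Fin d → ℤ) → ℝ≥0∞) (i : Fin d) (g : ℤ → ℝ≥0∞) :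
    ∑' t, proj1 m i t * g t = ∑' z, m z * g (z i) := by
  simp only [proj1, ← ENNReal.tsum_mul_right]
  rw [ENNReal.tsum_comm]
  refine tsum_congr fun z => ?_
  rw [tsum_eq_single (z i)]
  · simp
  · intro t ht
    simp [ht.symm]

/-- Transition operator of the `i`-th coordinate of the walk, killed when it leaves the positive
integers. -/
def nop (μ : (Fin d → ℤ) → ℝ) (i : Fin d) : Module.End ℝ≥0∞ (ℤ → ℝ≥0∞) :=
  kop (ks (proj1 (wt μ) i) (Set.Ioi 0))

theorem nop_of_pos (i : Fin d) (f : ℤ → ℝ≥0∞) {s : ℤ} (hs : 0 < s) :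
    nop μ i f s = ∑' z, wt μ z * (if 0 < s + z i then f (s + z i) else 0) := by
  rw [nop, kop_ks_apply, if_pos (Set.mem_Ioi.2 hs)]
  simp only [Set.mem_Ioi]
  exact tsum_proj1 (wt μ) i fun t => if 0 < s + t then f (s + t) else 0

theorem nop_of_le (i : Fin d) (f : ℤ → ℝ≥0∞) {s : ℤ} (hs : s ≤ 0) : nop μ i f s = 0 := by
  rw [nop, kop_ks_apply, if_neg (by simpa using hs)]

theorem nop_of_pos' (i : Fin d) {f : ℤ → ℝ≥0∞} (hf : ∀ s ≤ 0, f s = 0) {s : ℤ} (hs : 0 < s) :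
    nop μ i f s = ∑' z, wt μ z * f (s + z i) := by
  rw [nop_of_pos i f hs]
  refine tsum_congr fun z => ?_
  split_ifs with hz
  · rfl
  · rw [hf _ (not_lt.1 hz)]

theorem kop_posDom_singleton (i : Fin d) (f : ℤ → ℝ≥0∞) (x : Fin d → ℤ) :
    kop (ks (wt μ) (posDom {i})) (fun y => f (y i)) x = nop μ i f (x i) := by
  rw [kop_ks_apply]
  have hmem : ∀ y : Fin d → ℤ, y ∈ posDom {i} ↔ 0 < y i := fun y => by simp [posDom]
  simp only [hmem, Pi.add_apply]
  split_ifs with h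
  · rw [nop_of_pos i f h]
  · rw [nop_of_le i f (not_lt.1 h)]

theorem ofReal_le_tsum_wt (hnn : ∀ z, 0 ≤ μ z) {f g : (Fin d → ℤ) → ℝ} {G : ℝ}
    (hg : HasSum (fun z => μ z * g z) G) (hgf : ∀ z, g z ≤ f z) :
    ENNReal.ofReal G ≤ ∑' z, wt μ z * ENNReal.ofReal (f z) := by
  have h0 : ∀ z, 0 ≤ μ z * max (g z) 0 := fun z => mul_nonneg (hnn z) (le_max_right _ _)
  have hs : Summable fun z => μ z * max (g z) 0 := by
    refine Summable.of_nonneg_of_le h0 (fun z => ?_) hg.summable.abs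
    rw [abs_mul, abs_of_nonneg (hnn z)]
    exact mul_le_mul_of_nonneg_left (max_le (le_abs_self _) (abs_nonneg _)) (hnn z)
  have h1 : G ≤ ∑' z, μ z * max (g z) 0 :=
    hg.tsum_eq ▸ hg.summable.tsum_le_tsum
      (fun z => mul_le_mul_of_nonneg_left (le_max_left _ _) (hnn z)) hs
  refine (ENNReal.ofReal_le_ofReal h1).trans ?_
  rw [ENNReal.ofReal_tsum_of_nonneg h0 hs]
  refine ENNReal.tsum_le_tsum fun z => ?_
  rw [ENNReal.ofReal_mul (hnn z), ENNReal.ofReal_max, ENNReal.ofReal_zero, max_zero, wt]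
  gcongr
  exact hgf z

theorem tsum_wt_le_ofReal (hnn : ∀ z, 0 ≤ μ z) {f g : (Fin d → ℤ) → ℝ} {G : ℝ}
    (hg : HasSum (fun z => μ z * g z) G) (h0 : ∀ z, 0 ≤ g z) (hfg : ∀ z, f z ≤ g z) :
    ∑' z, wt μ z * ENNReal.ofReal (f z) ≤ ENNReal.ofReal G := by
  rw [← hg.tsum_eq, ENNReal.ofReal_tsum_of_nonneg (fun z => mul_nonneg (hnn z) (h0 z)) hg.summable]
  refine ENNReal.tsum_le_tsum fun z => ?_
  rw [ENNReal.ofReal_mul (hnn z), wt]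
  gcongr
  exact hfg z

/-- Overshoot below the origin. -/
def overshoot (μ : (Fin d → ℤ) → ℝ) (i : Fin d) (s : ℤ) : ℝ≥0∞ :=
  if 0 < s then ∑' z, wt μ z * ENNReal.ofReal (-((s + z i : ℤ) : ℝ)) else 0

/-- Expected overshoot at the exit from the positive integers. -/
def exitMean (μ : (Fin d → ℤ) → ℝ) (i : Fin d) : ℤ → ℝ≥0∞ :=
  pot (ks (proj1 (wt μ) i) (Set.Ioi 0)) (overshoot μ i)

/-- The harmonic function of the `i`-th coordinate killed outside the positive integers. -/
def hfun (μ : (Fin d → ℤ) → ℝ) (i : Fin d) (s : ℤ) : ℝ≥0∞ := ENNReal.ofReal s + exitMean μ i s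

theorem overshoot_of_le (i : Fin d) {s : ℤ} (hs : s ≤ 0) : overshoot μ i s = 0 :=
  if_neg (not_lt.2 hs)

theorem exitMean_of_le (i : Fin d) {s : ℤ} (hs : s ≤ 0) : exitMean μ i s = 0 :=
  pot_ks_of_notMem (fun y hy => overshoot_of_le i (by simpa using hy)) (by simpa using hs)

theorem hfun_of_le (i : Fin d) {s : ℤ} (hs : s ≤ 0) : hfun μ i s = 0 := by
  rw [hfun, exitMean_of_le i hs, ENNReal.ofReal_of_nonpos (by exact_mod_cast hs), add_zero]

theorem ofReal_le_hfun (i : Fin d) (s : ℤ) : ENNReal.ofReal s ≤ hfun μ i s := le_self_add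

theorem exitMean_eq (i : Fin d) : exitMean μ i = overshoot μ i + nop μ i (exitMean μ i) :=
  pot_eq _ _

namespace Standing

theorem summable_exp_coord (h : Standing μ) (i : Fin d) :
    ∃ c > 0, ∀ κ : ℝ, |κ| ≤ c → Summable fun z => μ z * Real.exp (κ * |(z i : ℝ)|) := by
  obtain ⟨c, hc, hs⟩ := h.exists_summable_exp
  refine ⟨c, hc, fun κ hκ => Summable.of_nonneg_of_le
    (fun z => mul_nonneg (h.nonneg z) (Real.exp_pos _).le) (fun z => ?_) hs⟩
  refine mul_le_mul_of_nonneg_left (Real.exp_le_exp.2 ?_) (h.nonneg z)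
  calc κ * |(z i : ℝ)| ≤ |κ| * |(z i : ℝ)| := by
        gcongr
        exact le_abs_self κ
    _ ≤ c * znorm z := by
        gcongr
        exact abs_le_znorm z i

theorem exists_hasSum_exp (h : Standing μ) {i : Fin d} (hi : Mvec μ i = 0) :
    ∃ c > 0, ∀ κ : ℝ, κ ≠ 0 → |κ| ≤ c → ∃ φ > 1, HasSum (fun z => μ z * Real.exp (κ * z i)) φ := by
  obtain ⟨c, hc, H⟩ := h.summable_exp_coord i
  refine ⟨c, hc, fun κ hκ hκc => ?_⟩
  have hnn : ∀ z : Fin d → ℤ, 0 ≤ μ z * Real.exp (κ * z i) := fun z =>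
    mul_nonneg (h.nonneg z) (Real.exp_pos _).le
  have hs : Summable fun z => μ z * Real.exp (κ * z i) := by
    refine Summable.of_nonneg_of_le hnn (fun z => ?_) (H |κ| (by rwa [abs_abs]))
    refine mul_le_mul_of_nonneg_left (Real.exp_le_exp.2 ?_) (h.nonneg z)
    exact (le_abs_self _).trans (abs_mul _ _).le
  refine ⟨_, ?_, hs.hasSum⟩
  have := h.one_lt_tsum_exp hi hκ
  simp only [wt, ← ENNReal.ofReal_mul (h.nonneg _)] at this
  rw [← ENNReal.ofReal_tsum_of_nonneg hnn hs, ENNReal.one_lt_ofReal] at this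
  exact this

theorem hasSum_coord (h : Standing μ) {i : Fin d} (hi : Mvec μ i = 0) (s : ℝ) :
    HasSum (fun z => μ z * (s + z i)) s := by
  have h1 := (h.summable_mean i).hasSum
  rw [show ∑' z, μ z * (z i : ℝ) = 0 from hi] at h1
  simpa [mul_add, mul_comm s] using (h.sum.mul_right s).add h1

theorem exists_exitMean_le (h : Standing μ) {i : Fin d} (hi : Mvec μ i = 0) :
    ∃ C ≥ 0, ∀ s, exitMean μ i s ≤ ENNReal.ofReal C := by
  obtain ⟨c, hc, H⟩ := h.exists_hasSum_exp hi
  set κ := c / 2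
  have hκ : 0 < κ := half_pos hc
  obtain ⟨φ, hφ, h1⟩ := H (-κ) (by simpa using hκ.ne') (by
    rw [abs_neg, abs_of_pos hκ]; exact half_le_self hc.le)
  obtain ⟨ψ, hψ, h2⟩ := H (-(2 * κ)) (by simpa using hκ.ne') (by
    rw [abs_neg, abs_of_pos (by positivity)]; simp only [κ]; linarith)
  obtain ⟨L, hL⟩ := exists_nat_gt (2 * ψ / (φ - 1) / κ)
  have hL' : 2 * ψ * Real.exp (-(κ * L)) ≤ φ - 1 := by
    rw [div_lt_iff₀ hκ, div_lt_iff₀ (by linarith)] at hL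
    rw [Real.exp_neg, ← div_eq_mul_inv, div_le_iff₀ (Real.exp_pos _)]
    have := Real.add_one_le_exp (κ * L)
    nlinarith
  set D := Real.exp (2 * κ * L) / (2 * κ)
  have hD : 0 < D := by positivity
  set w : ℤ → ℝ := fun t => 1 - Real.exp (-(κ * (t + L)))
  have key : overshoot μ i + nop μ i (fun s => ENNReal.ofReal (D * w s)) ≤
      fun s => if 0 < s then ENNReal.ofReal (D * w s) else 0 := by
    intro s
    rcases le_or_gt s 0 with hs | hs
    · rw [Pi.add_apply, overshoot_of_le i hs, nop_of_le i _ hs]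
      simp
    rw [Pi.add_apply, overshoot, if_pos hs, nop_of_pos i _ hs, ← ENNReal.tsum_add]
    dsimp only
    rw [if_pos hs]
    have e1 : ∀ z : Fin d → ℤ, wt μ z * ENNReal.ofReal (-((s + z i : ℤ) : ℝ)) +
        wt μ z * (if 0 < s + z i then ENNReal.ofReal (D * w (s + z i)) else 0) =
        wt μ z * ENNReal.ofReal (if 0 < s + z i then D * w (s + z i) else -((s + z i : ℤ) : ℝ)) := by
      intro z
      rw [← mul_add]
      split_ifs with hz
      · rw [ENNReal.ofReal_of_nonpos (p := -((s + z i : ℤ) : ℝ)), zero_add]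
        have : (0 : ℝ) < (s + z i : ℤ) := by exact_mod_cast hz
        linarith
      · rw [add_zero]
    rw [tsum_congr e1]
    set y : (Fin d → ℤ) → ℝ := fun z => Real.exp (-(κ * ((s + z i : ℤ) + L)))
    have hy : ∀ z, Real.exp (-(2 * κ) * z i) * Real.exp (-(2 * κ * (s + L))) = y z ^ 2 := fun z => by
      simp only [y]
      rw [← Real.exp_add, ← Real.exp_nat_mul]
      congr 1
      push_cast
      ring
    have hy' : ∀ z, Real.exp (-κ * z i) * Real.exp (-(κ * (s + L))) = y z := fun z => by
      simp only [y]
      rw [← Real.exp_add]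
      congr 1
      push_cast
      ring
    have hsum : HasSum (fun z => μ z * (D * (1 - y z + 2 * y z ^ 2)))
        (D * (1 - φ * Real.exp (-(κ * (s + L))) + 2 * (ψ * Real.exp (-(2 * κ * (s + L)))))) := by
      have := ((h.sum.sub (h1.mul_right (Real.exp (-(κ * (s + L)))))).add
        ((h2.mul_right (Real.exp (-(2 * κ * (s + L))))).mul_left 2)).mul_left D
      refine this.congr_fun fun z => ?_
      rw [mul_assoc, mul_assoc, hy, hy']
      ring
    refine (tsum_wt_le_ofReal h.nonneg hsum (fun z => ?_) (fun z => ?_)).trans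
      (ENNReal.ofReal_le_ofReal ?_)
    · have : 0 ≤ 1 - y z + 2 * y z ^ 2 := by nlinarith [sq_nonneg (y z - 1 / 2)]
      positivity
    · split_ifs with hz
      · simp only [w, y]
        gcongr
        nlinarith [sq_nonneg (y z)]
      · have e2 : (((s + z i : ℤ)) : ℝ) ≤ 0 := by exact_mod_cast not_lt.1 hz
        have e3 : D * y z ^ 2 ≤ D * (1 - y z + 2 * y z ^ 2) := by
          gcongr
          nlinarith [sq_nonneg (y z - 1 / 2)]
        refine le_trans ?_ e3
        have e4 : D * y z ^ 2 = Real.exp (2 * κ * -((s + z i : ℤ) : ℝ)) / (2 * κ) := by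
          simp only [D, y]
          rw [← Real.exp_nat_mul, div_mul_eq_mul_div, ← Real.exp_add]
          congr 2
          push_cast
          ring
        rw [e4, le_div_iff₀ (by positivity)]
        have := Real.add_one_le_exp (2 * κ * -((s + z i : ℤ) : ℝ))
        linarith
    · gcongr
      simp only [w]
      have e5 : Real.exp (-(2 * κ * (s + L))) =
          Real.exp (-(κ * (s + L))) * Real.exp (-(κ * (s + L))) := by
        rw [← Real.exp_add]
        ring_nf
      rw [e5]
      have e6 : Real.exp (-(κ * (s + L))) ≤ Real.exp (-(κ * L)) := by
        have : (0 : ℝ) < s := by exact_mod_cast hs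
        refine Real.exp_le_exp.2 ?_
        nlinarith
      have e7 := Real.exp_pos (-(κ * (s + L)))
      nlinarith [mul_le_mul_of_nonneg_left e6 (show 0 ≤ 2 * ψ by linarith)]
  refine ⟨D, hD.le, fun s => ?_⟩
  have hle := pot_le (k := ks (proj1 (wt μ) i) (Set.Ioi 0)) (r := overshoot μ i)
    (u := fun s => if 0 < s then ENNReal.ofReal (D * w s) else 0) (le_trans ?_ key)
  · refine (hle s).trans ?_
    dsimp only
    split_ifs
    · refine ENNReal.ofReal_le_ofReal ?_
      have : w s ≤ 1 := by simp only [w]; linarith [Real.exp_pos (-(κ * (s + L)))]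
      nlinarith
    · exact zero_le
  · refine add_le_add le_rfl (kop_mono _ fun s => ?_)
    dsimp only
    split_ifs
    exacts [le_rfl, zero_le]

end Standing

end

noncomputable section

variable {d : ℕ} {μ : (Fin d → ℤ) → ℝ}

theorem tsum_wt_ofReal_eq (hnn : ∀ z, 0 ≤ μ z) {g : (Fin d → ℤ) → ℝ} {G : ℝ} (hG : 0 ≤ G)
    (hg : HasSum (fun z => μ z * g z) G) :
    ∑' z, wt μ z * ENNReal.ofReal (g z) =
      ENNReal.ofReal G + ∑' z, wt μ z * ENNReal.ofReal (-g z) := by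
  have key : ∀ f : (Fin d → ℤ) → ℝ, Summable (fun z => μ z * f z) →
      Summable (fun z => μ z * max (f z) 0) ∧
      ∑' z, wt μ z * ENNReal.ofReal (f z) = ENNReal.ofReal (∑' z, μ z * max (f z) 0) := by
    intro f hf
    have h0 : ∀ z, 0 ≤ μ z * max (f z) 0 := fun z => mul_nonneg (hnn z) (le_max_right _ _)
    have hs : Summable fun z => μ z * max (f z) 0 := by
      refine Summable.of_nonneg_of_le h0 (fun z => ?_) hf.abs
      rw [abs_mul, abs_of_nonneg (hnn z)]
      exact mul_le_mul_of_nonneg_left (max_le (le_abs_self _) (abs_nonneg _)) (hnn z)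
    refine ⟨hs, ?_⟩
    rw [ENNReal.ofReal_tsum_of_nonneg h0 hs]
    refine tsum_congr fun z => ?_
    rw [ENNReal.ofReal_mul (hnn z), ENNReal.ofReal_max, ENNReal.ofReal_zero, max_zero, wt]
  obtain ⟨s1, e1⟩ := key g hg.summable
  obtain ⟨s2, e2⟩ := key (fun z => -g z) (by simpa using hg.summable.neg)
  have h2 : 0 ≤ ∑' z, μ z * max (-g z) 0 := tsum_nonneg fun z =>
    mul_nonneg (hnn z) (le_max_right _ _)
  rw [e1, e2, ← ENNReal.ofReal_add hG h2, ← hg.tsum_eq, ← hg.summable.tsum_add s2]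
  congr 2
  funext z
  rw [← mul_add]
  congr 1
  rcases le_total 0 (g z) with h | h
  · rw [max_eq_left h, max_eq_right (by linarith), add_zero]
  · rw [max_eq_right h, max_eq_left (by linarith), add_neg_cancel]

namespace Standing

theorem nop_hfun (h : Standing μ) {i : Fin d} (hi : Mvec μ i = 0) :
    nop μ i (hfun μ i) = hfun μ i := by
  funext s
  rcases le_or_gt s 0 with hs | hs
  · rw [nop_of_le i _ hs, hfun_of_le i hs]
  have hs' : (0 : ℝ) < s := by exact_mod_cast hs
  have e := tsum_wt_ofReal_eq h.nonneg hs'.le (h.hasSum_coord hi s)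
  have e2 := congrFun (exitMean_eq (μ := μ) i) s
  rw [Pi.add_apply, overshoot, if_pos hs] at e2
  rw [nop_of_pos' i (fun _ => hfun_of_le i) hs]
  simp only [hfun, mul_add, ENNReal.tsum_add]
  push_cast at e2 ⊢
  rw [e, e2, nop_of_pos' i (fun _ => exitMean_of_le i) hs, add_assoc]

theorem exists_nop_harnack (h : Standing μ) (i : Fin d) :
    ∃ θ ≥ 0, ∀ k : ℤ → ℝ≥0∞, nop μ i k ≤ k → ∀ s t : ℤ, 0 < s → 0 < t →
      k t ≤ ENNReal.ofReal (Real.exp (θ * |(t : ℝ) - s|)) * k s := by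
  obtain ⟨θ, hθ, H⟩ := h.exists_harnack {i}
  refine ⟨θ, hθ, fun k hk s t hs ht => ?_⟩
  have := H (fun y => k (y i)) (fun x => by rw [kop_posDom_singleton]; exact hk _)
    (Pi.single i s) (by simpa [posDom] using hs) (Pi.single i t) (by simpa [posDom] using ht)
  rw [← Pi.single_sub, znorm_single] at this
  simpa using this

theorem nop_ne_top (h : Standing μ) {i : Fin d} {k : ℤ → ℝ≥0∞} (hk : nop μ i k ≤ k)
    (h1 : k 1 ≠ ⊤) {s : ℤ} (hs : 0 < s) : k s ≠ ⊤ := by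
  obtain ⟨θ, -, H⟩ := h.exists_nop_harnack i
  exact ne_top_of_le_ne_top (ENNReal.mul_ne_top ENNReal.ofReal_ne_top h1) (H k hk 1 s one_pos hs)

theorem nop_pos (h : Standing μ) {i : Fin d} {k : ℤ → ℝ≥0∞} (hk : nop μ i k ≤ k)
    {s t : ℤ} (hs : 0 < s) (ht : 0 < t) (h0 : k s ≠ 0) : k t ≠ 0 := by
  obtain ⟨θ, -, H⟩ := h.exists_nop_harnack i
  intro hkt
  have := H k hk t s ht hs
  rw [hkt, mul_zero] at this
  exact h0 (le_zero_iff.1 this)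

/-- Nonnegative superharmonic functions of a killed centred walk on the integers grow at most
linearly. -/
theorem exists_nop_le_linear (h : Standing μ) {i : Fin d} (hi : Mvec μ i = 0) :
    ∃ C ≥ 0, ∀ k : ℤ → ℝ≥0∞, nop μ i k ≤ k → k 1 ≠ ⊤ → ∀ u v : ℤ, 0 < u → u ≤ v →
      k v ≤ ENNReal.ofReal (C * (v / u)) * k u := by
  obtain ⟨θ, hθ, H⟩ := h.exists_nop_harnack i
  obtain ⟨c, hc, hφ⟩ := h.exists_hasSum_exp hi
  obtain ⟨c', hc', hψ⟩ := h.summable_exp_coord i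
  set κ := min c (c' / 3)
  have hκ : 0 < κ := lt_min hc (by positivity)
  have hκ' : 3 * κ ≤ c' := by linarith [min_le_right c (c' / 3)]
  obtain ⟨φ, hφ1, h1⟩ := hφ κ hκ.ne' (by rw [abs_of_pos hκ]; exact min_le_left _ _)
  have h2 := (hψ (3 * κ) (by rw [abs_of_pos (by positivity)]; exact hκ')).hasSum
  set ψ := ∑' z, μ z * Real.exp (3 * κ * |(z i : ℝ)|)
  have hψ0 : 0 ≤ ψ := tsum_nonneg fun z => mul_nonneg (h.nonneg z) (Real.exp_pos _).le
  set B := 2 + 1 / κ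
  have hB : 0 < B := by positivity
  obtain ⟨R, hR⟩ := exists_nat_gt (B * ψ / (φ - 1) / κ)
  have hR' : B * Real.exp (-(κ * R)) * ψ < φ - 1 := by
    rw [div_lt_iff₀ hκ, div_lt_iff₀ (by linarith)] at hR
    rw [Real.exp_neg, mul_right_comm, ← div_eq_mul_inv, div_lt_iff₀ (Real.exp_pos _)]
    have := Real.add_one_le_exp (κ * R)
    nlinarith
  refine ⟨2 * Real.exp (θ * R), by positivity, fun k hk hk1 u v hu huv => ?_⟩
  have htop : ∀ s, 0 < s → k s ≠ ⊤ := fun s hs => h.nop_ne_top hk hk1 hs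
  by_cases hkv : k v = 0
  · rw [hkv]
    exact zero_le
  have hv : 0 < v := hu.trans_le huv
  have hpos : ∀ s, 0 < s → k s ≠ 0 := fun s hs => h.nop_pos hk hv hs hkv
  set F : ℤ → ℝ := fun s => (k s).toReal
  have hF : ∀ s : ℤ, 0 < s → 0 < F s := fun s hs => ENNReal.toReal_pos (hpos s hs) (htop s hs)
  have hFof : ∀ s : ℤ, 0 < s → ENNReal.ofReal (F s) = k s := fun s hs =>
    ENNReal.ofReal_toReal (htop s hs)
  have hv' : (1 : ℝ) ≤ v := by exact_mod_cast hv
  set g : ℤ → ℝ := fun s => s + v * (Real.exp (κ * (s - v)) - Real.exp (-(κ * v)))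
  have hgs : ∀ s : ℤ, 0 ≤ s → (s : ℝ) ≤ g s := fun s hs => by
    have hs : (0 : ℝ) ≤ s := by exact_mod_cast hs
    have : Real.exp (-(κ * v)) ≤ Real.exp (κ * (s - v)) := Real.exp_le_exp.2 (by nlinarith)
    simp only [g]
    nlinarith
  have hg0 : ∀ s : ℤ, s ≤ 0 → g s ≤ 0 := fun s hs => by
    have hs : (s : ℝ) ≤ 0 := by exact_mod_cast hs
    have : Real.exp (κ * (s - v)) ≤ Real.exp (-(κ * v)) := Real.exp_le_exp.2 (by nlinarith)
    simp only [g]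
    nlinarith
  have hg2 : ∀ s : ℤ, s ≤ v → g s ≤ 2 * v := fun s hs => by
    have hs : (s : ℝ) ≤ v := by exact_mod_cast hs
    have : Real.exp (κ * (s - v)) ≤ 1 := Real.exp_le_one_iff.2 (by nlinarith)
    have := Real.exp_pos (-(κ * v))
    simp only [g]
    nlinarith
  have hgpos : ∀ s : ℤ, 0 < s → 0 < g s := fun s hs =>
    lt_of_lt_of_le (by exact_mod_cast hs) (hgs s hs.le)
  have hcmp := mul_le_of_min (I := Finset.Icc 1 v) (C := {s | v < s + R}) (F := F) (g := g)
    (lam := Real.exp (-(θ * R)) * F v / (2 * v))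
    (fun s hs => hF s (by rw [Finset.mem_Icc] at hs; omega))
    (fun s hs => hgpos s (by rw [Finset.mem_Icc] at hs; omega)) ?_ ?_ u (by
      rw [Finset.mem_Icc]; omega)
  · have hu' : (0 : ℝ) < u := by exact_mod_cast hu
    have e1 : Real.exp (-(θ * R)) * F v / (2 * v) * u ≤ F u :=
      (mul_le_mul_of_nonneg_left (hgs u hu.le) (by have := hF v hv; positivity)).trans hcmp
    rw [← hFof v hv, ← hFof u hu, ← ENNReal.ofReal_mul (by positivity)]
    refine ENNReal.ofReal_le_ofReal ?_
    calc F v = 2 * Real.exp (θ * R) * (v / u) * (Real.exp (-(θ * R)) * F v / (2 * v) * u) := by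
          rw [Real.exp_neg]
          field_simp
      _ ≤ _ := by gcongr
  · intro s hs hsC
    rw [Finset.mem_Icc] at hs
    rw [Set.mem_ofPred_eq] at hsC
    have hsv : (s : ℝ) ≤ v := by exact_mod_cast hs.2
    have hsC' : (v : ℝ) < s + R := by exact_mod_cast hsC
    have h5 : F v ≤ Real.exp (θ * R) * F s := by
      have hFs := hF s (by omega)
      rw [← ENNReal.ofReal_le_ofReal_iff (by positivity),
        ENNReal.ofReal_mul (Real.exp_pos _).le, hFof v hv, hFof s (by omega)]
      refine (H k hk s v (by omega) hv).trans ?_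
      gcongr
      rw [abs_of_nonneg (by linarith)]
      linarith
    have hFv := hF v hv
    calc Real.exp (-(θ * R)) * F v / (2 * v) * g s
        ≤ Real.exp (-(θ * R)) * (Real.exp (θ * R) * F s) / (2 * v) * (2 * v) := by
          have := hgpos s (by omega)
          have := hg2 s hs.2
          gcongr
      _ = F s := by
          rw [Real.exp_neg]
          field_simp
  · intro s hs hsC ρ hρ hρF
    rw [Finset.mem_Icc] at hs
    rw [Set.mem_ofPred_eq, not_lt] at hsC
    have hs0 : 0 < s := by omega
    set a : ℝ := v - s
    have haR : (R : ℝ) ≤ a := by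
      have : (s : ℝ) + R ≤ v := by exact_mod_cast hsC
      simp only [a]; linarith
    have hsr : (0 : ℝ) < s := by exact_mod_cast hs0
    have hsum : HasSum (fun z => μ z * (s + z i + v * Real.exp (-(κ * a)) * Real.exp (κ * z i) -
        v * Real.exp (-(κ * v)) - v * B * Real.exp (-(κ * R)) * Real.exp (-(κ * a)) *
          Real.exp (3 * κ * |(z i : ℝ)|)))
        (s + v * Real.exp (-(κ * a)) * φ - v * Real.exp (-(κ * v)) -
          v * B * Real.exp (-(κ * R)) * Real.exp (-(κ * a)) * ψ) := by
      have := (((h.hasSum_coord hi s).add (h1.mul_left (v * Real.exp (-(κ * a))))).sub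
        (h.sum.mul_left (v * Real.exp (-(κ * v))))).sub
        (h2.mul_left (v * B * Real.exp (-(κ * R)) * Real.exp (-(κ * a))))
      rw [mul_one] at this
      refine this.congr_fun fun z => ?_
      ring
    have hpt := ofReal_le_tsum_wt h.nonneg (hsum.mul_left ρ |>.congr_fun fun z => by ring)
      (g := fun z => ρ * (s + z i + v * Real.exp (-(κ * a)) * Real.exp (κ * z i) -
        v * Real.exp (-(κ * v)) - v * B * Real.exp (-(κ * R)) * Real.exp (-(κ * a)) *
          Real.exp (3 * κ * |(z i : ℝ)|)))
      (f := fun z => if 0 < s + z i then F (s + z i) else 0) (fun z => ?_)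
    · have hkk : ∑' z, wt μ z * ENNReal.ofReal (if 0 < s + z i then F (s + z i) else 0) ≤ k s := by
        refine le_trans (le_of_eq ?_) (hk s)
        rw [nop_of_pos i k hs0]
        refine tsum_congr fun z => ?_
        split_ifs with hz
        · rw [hFof _ hz]
        · rw [ENNReal.ofReal_zero]
      have h3 := hpt.trans hkk
      rw [← hFof s hs0, ENNReal.ofReal_le_ofReal_iff (hF s hs0).le] at h3
      refine lt_of_lt_of_le ?_ h3
      refine mul_lt_mul_of_pos_left ?_ hρ
      have e1 : κ * (s - v) = -(κ * a) := by simp only [a]; ring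
      simp only [g]
      rw [e1]
      have hva : 0 < v * Real.exp (-(κ * a)) := by positivity
      nlinarith [mul_lt_mul_of_pos_left hR' hva]
    · have hE3 : 0 ≤ v * B * Real.exp (-(κ * R)) * Real.exp (-(κ * a)) *
          Real.exp (3 * κ * |(z i : ℝ)|) := by positivity
      have hgz : s + z i + v * Real.exp (-(κ * a)) * Real.exp (κ * z i) -
          v * Real.exp (-(κ * v)) = g (s + z i) := by
        simp only [g]
        rw [mul_assoc, ← Real.exp_add]
        have : -(κ * a) + κ * z i = κ * ((s + z i : ℤ) - v) := by
          simp only [a]; push_cast; ring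
        rw [this]
        push_cast
        ring
      rw [hgz]
      split_ifs with hz
      · rcases le_or_gt (s + z i) v with hzv | hzv
        · have := hρF (s + z i) (by rw [Finset.mem_Icc]; omega)
          nlinarith
        · refine le_trans ?_ (hF _ hz).le
          refine mul_nonpos_of_nonneg_of_nonpos hρ.le ?_
          have hza : a < z i := by
            have : (v : ℝ) < s + z i := by exact_mod_cast hzv
            simp only [a]; linarith
          have hR0 : (0 : ℝ) ≤ R := R.cast_nonneg
          have hz0 : (0 : ℝ) ≤ z i := by linarith
          rw [abs_of_nonneg hz0]
          set t := (z i : ℝ)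
          have b1 : (s : ℝ) ≤ v := by exact_mod_cast hs.2
          have b2 : 1 + t ≤ (1 + 1 / κ) * Real.exp (κ * t) := by
            have c1 := Real.add_one_le_exp (κ * t)
            have c2 : (1 + 1 / κ) * (κ * t + 1) ≤ (1 + 1 / κ) * Real.exp (κ * t) := by gcongr
            have c3 : (1 + 1 / κ) * (κ * t + 1) = 1 + t + κ * t + 1 / κ := by field_simp; ring
            have : 0 ≤ κ * t := by positivity
            have : 0 ≤ 1 / κ := by positivity
            linarith
          have b3 : g (s + z i) ≤ v * (B * Real.exp (κ * t)) := by
            have c1 : Real.exp (κ * ((s + z i : ℤ) - v)) ≤ Real.exp (κ * t) := by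
              refine Real.exp_le_exp.2 ?_
              push_cast
              nlinarith
            have c2 := Real.exp_pos (-(κ * v))
            have c3 : (((s + z i : ℤ)) : ℝ) ≤ v * (1 + t) := by
              push_cast
              nlinarith
            have c4 : g (s + z i) ≤ v * (1 + t) + v * Real.exp (κ * t) := by
              simp only [g]
              nlinarith
            refine c4.trans ?_
            simp only [B]
            nlinarith
          have b4 : Real.exp (κ * t) ≤ Real.exp (-(κ * R)) * Real.exp (-(κ * a)) *
              Real.exp (3 * κ * t) := by
            rw [← Real.exp_add, ← Real.exp_add]
            refine Real.exp_le_exp.2 ?_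
            nlinarith
          have b5 : v * (B * Real.exp (κ * t)) ≤ v * (B * (Real.exp (-(κ * R)) *
              Real.exp (-(κ * a)) * Real.exp (3 * κ * t))) := by gcongr
          linarith
      · have := hg0 _ (not_lt.1 hz)
        nlinarith

end Standing

end

noncomputable section

variable {d : ℕ} {μ : (Fin d → ℤ) → ℝ}

theorem le_zero_of_nop_eq {i : Fin d} {k : ℤ → ℝ≥0∞} (hk : nop μ i k = k) {s : ℤ} (hs : s ≤ 0) :
    k s = 0 := by
  rw [← hk, nop_of_le i _ hs]

theorem hfun_ne_zero (i : Fin d) {s : ℤ} (hs : 0 < s) : hfun μ i s ≠ 0 := by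
  have h0 : (0 : ℝ) < s := by exact_mod_cast hs
  exact (lt_of_lt_of_le (ENNReal.ofReal_pos.2 h0) (ofReal_le_hfun i s)).ne'

namespace Standing

theorem nop_le_of_le (h : Standing μ) {i : Fin d} {k H : ℤ → ℝ≥0∞} (hk : nop μ i k = k)
    (hH : nop μ i H = H) (hk1 : k 1 ≠ ⊤) (hH1 : H 1 ≠ ⊤) {a : ℝ≥0∞} (ha : a ≠ ⊤) {v : ℤ}
    (hv : ∀ t, v ≤ t → k t ≤ a * H t) (t : ℤ) : k t ≤ a * H t := by
  by_contra! hcon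
  have ht0 : 0 < t := by
    by_contra! ht
    simp [le_zero_of_nop_eq hk ht] at hcon
  have htv : t < v := by
    by_contra! ht
    exact absurd (hv t ht) (not_le.2 hcon)
  have hHtop : ∀ s, a * H s ≠ ⊤ := fun s => by
    rcases le_or_gt s 0 with hs | hs
    · simp [le_zero_of_nop_eq hH hs]
    · exact ENNReal.mul_ne_top ha (h.nop_ne_top hH.le hH1 hs)
  set e : ℤ → ℝ≥0∞ := fun s => k s - a * H s
  obtain ⟨s₁, hs₁, hmax⟩ := (Finset.Icc 1 v).exists_max_image e ⟨t, by rw [Finset.mem_Icc]; omega⟩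
  set T := (Finset.Icc 1 v).filter fun s => e s = e s₁
  have hT : T.Nonempty := ⟨s₁, Finset.mem_filter.2 ⟨hs₁, rfl⟩⟩
  set s := T.min' hT
  obtain ⟨hsI, hse⟩ := Finset.mem_filter.1 (T.min'_mem hT)
  rw [Finset.mem_Icc] at hsI
  set p := e s₁
  have hp : 0 < p := lt_of_lt_of_le (tsub_pos_of_lt hcon)
    (hmax t (by rw [Finset.mem_Icc]; omega))
  have hle : ∀ r, k r ≤ a * H r + p := fun r => by
    rcases le_or_gt r 0 with hr | hr
    · simp [le_zero_of_nop_eq hk hr]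
    rcases le_or_gt v r with hr' | hr'
    · exact (hv r hr').trans le_self_add
    · exact le_add_tsub.trans (add_le_add le_rfl (hmax r (by rw [Finset.mem_Icc]; omega)))
  have hlt : ∀ r, r < s → k r < a * H r + p := fun r hr => by
    rcases le_or_gt r 0 with hr0 | hr0
    · rw [le_zero_of_nop_eq hk hr0]
      exact lt_of_lt_of_le hp le_add_self
    have hrI : r ∈ Finset.Icc 1 v := by rw [Finset.mem_Icc]; omega
    refine lt_of_le_of_lt le_add_tsub (ENNReal.add_lt_add_left (hHtop r)
      (lt_of_le_of_ne (hmax r hrI) fun her => ?_))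
    exact absurd (T.min'_le r (Finset.mem_filter.2 ⟨hrI, her⟩)) (not_le.2 hr)
  have hks : k s = a * H s + p := by
    rw [← hse]
    refine (add_tsub_cancel_of_le ?_).symm
    by_contra! hc
    rw [show e s = 0 from tsub_eq_zero_of_le hc.le] at hse
    exact hp.ne hse
  have hs0 : 0 < s := by omega
  obtain ⟨z, hz, hzi⟩ := h.exists_neg_jump i
  have e1 : ∑' z, wt μ z * k (s + z i) = k s := by
    rw [← nop_of_pos' i (fun _ => le_zero_of_nop_eq hk) hs0, hk]
  have e2 : ∑' z, wt μ z * (a * H (s + z i) + p) = a * H s + p := by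
    simp only [mul_add, ENNReal.tsum_add, ENNReal.tsum_mul_right, h.tsum_wt, one_mul]
    simp only [mul_left_comm _ a, ENNReal.tsum_mul_left]
    rw [← nop_of_pos' i (fun _ => le_zero_of_nop_eq hH) hs0, hH]
  have hfin : ∑' z, wt μ z * k (s + z i) ≠ ⊤ := by
    rw [e1]
    exact h.nop_ne_top hk.le hk1 hs0
  have := ENNReal.tsum_lt_tsum (i := z) hfin (fun z => mul_le_mul_right (hle (s + z i)) (wt μ z))
    (ENNReal.mul_lt_mul_right (by simpa [wt] using hz) (by simp [wt]) (hlt _ (by omega)))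
  rw [e1, e2, hks] at this
  exact lt_irrefl _ this

theorem hfun_ne_top (h : Standing μ) {i : Fin d} (hi : Mvec μ i = 0) (s : ℤ) :
    hfun μ i s ≠ ⊤ := by
  obtain ⟨C, -, H⟩ := h.exists_exitMean_le hi
  exact ENNReal.add_ne_top.2 ⟨ENNReal.ofReal_ne_top, ne_top_of_le_ne_top ENNReal.ofReal_ne_top (H s)⟩

theorem exists_hfun_le (h : Standing μ) {i : Fin d} (hi : Mvec μ i = 0) :
    ∃ C ≥ 0, ∀ s : ℤ, 0 < s → hfun μ i s ≤ ENNReal.ofReal (C * s) := by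
  obtain ⟨C, hC, H⟩ := h.exists_exitMean_le hi
  refine ⟨1 + C, by positivity, fun s hs => ?_⟩
  have hs' : (1 : ℝ) ≤ s := by exact_mod_cast hs
  refine (add_le_add le_rfl (H s)).trans ?_
  rw [← ENNReal.ofReal_add (by linarith) hC]
  refine ENNReal.ofReal_le_ofReal ?_
  nlinarith

theorem exists_nop_mul_le (h : Standing μ) {i : Fin d} (hi : Mvec μ i = 0) :
    ∃ C : ℝ≥0∞, C ≠ ⊤ ∧ ∀ k : ℤ → ℝ≥0∞, nop μ i k = k → k 1 ≠ ⊤ → ∀ u v : ℤ, 0 < v →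
      k u * hfun μ i v ≤ C * k v * hfun μ i u := by
  obtain ⟨C, hC, H⟩ := h.exists_nop_le_linear hi
  obtain ⟨D, hD, HD⟩ := h.exists_hfun_le hi
  refine ⟨ENNReal.ofReal (C * D), ENNReal.ofReal_ne_top, fun k hk hk1 u v hv => ?_⟩
  have hv' : (0 : ℝ) < v := by exact_mod_cast hv
  have := h.nop_le_of_le hk (h.nop_hfun hi) hk1 (h.hfun_ne_top hi 1)
    (a := ENNReal.ofReal (C / v) * k v) (v := v)
    (ENNReal.mul_ne_top ENNReal.ofReal_ne_top (h.nop_ne_top hk.le hk1 hv)) (fun t ht => ?_) u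
  · refine (mul_le_mul' this (HD v hv)).trans_eq ?_
    rw [show C * D = C / v * (D * v) by field_simp,
      ENNReal.ofReal_mul (show 0 ≤ C / v by positivity)]
    ring
  · refine (H k hk.le hk1 v t hv ht).trans ?_
    rw [show C * ((t : ℝ) / v) = C / v * t by ring, ENNReal.ofReal_mul (by positivity),
      mul_right_comm]
    exact mul_le_mul_right (ofReal_le_hfun i t) _

/-- Uniqueness, up to a factor, of the harmonic function of a killed centred walk on the
integers. -/
theorem exists_eq_mul_hfun (h : Standing μ) {i : Fin d} (hi : Mvec μ i = 0) {k : ℤ → ℝ≥0∞}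
    (hk : nop μ i k = k) (hk1 : k 1 ≠ ⊤) : ∃ c, ∀ s, k s = c * hfun μ i s := by
  obtain ⟨C, hC, HC⟩ := h.exists_nop_mul_le hi
  have hHtop := h.hfun_ne_top hi
  have hH := h.nop_hfun hi
  set H := hfun μ i
  have hH0 : ∀ s : ℤ, 0 < s → H s ≠ 0 := fun s hs => hfun_ne_zero i hs
  set c := ⨅ s : {s : ℤ // 0 < s}, k s / H s
  have hc : ∀ s : ℤ, 0 < s → c ≤ k s / H s := fun s hs =>
    iInf_le (fun s : {s : ℤ // 0 < s} => k s / H s) ⟨s, hs⟩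
  have hctop : c ≠ ⊤ := ne_top_of_le_ne_top
    (ENNReal.div_ne_top hk1 (hH0 1 one_pos)) (hc 1 one_pos)
  have hle : ∀ s, c * H s ≤ k s := fun s => by
    rcases le_or_gt s 0 with hs | hs
    · simp [H, hfun_of_le i hs]
    · exact (ENNReal.le_div_iff_mul_le (Or.inl (hH0 s hs)) (Or.inl (hHtop s))).1 (hc s hs)
  set k' : ℤ → ℝ≥0∞ := fun s => k s - c * H s
  have hk' : k' + c • H = k := funext fun s => tsub_add_cancel_of_le (hle s)
  have hk'h : nop μ i k' = k' := by
    have e : nop μ i k' + c • H = k' + c • H := by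
      conv_lhs => rw [← hH, ← map_smul, ← map_add]
      rw [hk', hk]
    funext s
    exact (ENNReal.add_left_inj (ENNReal.mul_ne_top hctop (hHtop s))).1 (congrFun e s)
  have hk'1 : k' 1 ≠ ⊤ := ne_top_of_le_ne_top hk1 tsub_le_self
  refine ⟨c, fun u => ?_⟩
  have hzero : k' u = 0 := by
    have h1 : ∀ v : {s : ℤ // 0 < s}, k' u ≤ C * H u * (k v / H v - c) := fun v => by
      have h2 := HC k' hk'h hk'1 u v v.2
      have h3 : k' v = (k v / H v - c) * H v := by
        rw [ENNReal.sub_mul fun _ _ => hHtop v, ENNReal.div_mul_cancel (hH0 v v.2) (hHtop v)]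
      rw [h3] at h2
      refine (ENNReal.mul_le_mul_iff_left (hH0 v v.2) (hHtop v)).1 (h2.trans_eq ?_)
      ring
    have h4 : k' u ≤ ⨅ v : {s : ℤ // 0 < s}, C * H u * (k v / H v - c) := le_iInf h1
    rw [← ENNReal.mul_iInf' (fun hcon => absurd hcon (ENNReal.mul_ne_top hC (hHtop u)))
      (fun _ => ⟨⟨1, one_pos⟩⟩)] at h4
    have h5 : (⨅ v : {s : ℤ // 0 < s}, (k v / H v - c)) + c ≤ 0 + c := by
      rw [zero_add]
      exact le_iInf fun v => (add_le_add (iInf_le _ v) le_rfl).trans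
        (tsub_add_cancel_of_le (hc v v.2)).le
    rw [le_zero_iff.1 ((ENNReal.add_le_add_iff_right hctop).1 h5), mul_zero] at h4
    exact le_zero_iff.1 h4
  have := congrFun hk' u
  rw [Pi.add_apply, hzero, zero_add] at this
  exact this.symm

end Standing

end

noncomputable section

variable {d : ℕ} {μ : (Fin d → ℤ) → ℝ}

/-- Dominated convergence for sums in `ℝ≥0∞`, along an arbitrary filter. -/
theorem tendsto_tsum_of_dominated {ι α : Type*} {F : Filter ι} {f : ι → α → ℝ≥0∞}
    {g b : α → ℝ≥0∞} (hb : ∑' a, b a ≠ ⊤) (hlim : ∀ a, Tendsto (fun n => f n a) F (𝓝 (g a)))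
    (hle : ∀ᶠ n in F, ∀ a, f n a ≤ b a) :
    Tendsto (fun n => ∑' a, f n a) F (𝓝 (∑' a, g a)) := by
  rcases F.eq_or_neBot with rfl | hF
  · exact tendsto_bot
  have hba : ∀ a, b a ≠ ⊤ := ENNReal.ne_top_of_tsum_ne_top hb
  have hga : ∀ a, g a ≤ b a := fun a =>
    le_of_tendsto (hlim a) (hle.mono fun n hn => hn a)
  have hgt : ∑' a, g a ≠ ⊤ := ne_top_of_le_ne_top hb (ENNReal.tsum_le_tsum hga)
  have key : Tendsto (fun n => ∑' a, (f n a).toReal) F (𝓝 (∑' a, (g a).toReal)) := by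
    refine tendsto_tsum_of_dominated_convergence (ENNReal.summable_toReal hb) (fun a =>
      (ENNReal.tendsto_toReal (ne_top_of_le_ne_top (hba a) (hga a))).comp (hlim a)) ?_
    filter_upwards [hle] with n hn a
    rw [Real.norm_of_nonneg ENNReal.toReal_nonneg]
    exact ENNReal.toReal_mono (hba a) (hn a)
  rw [← ENNReal.tsum_toReal_eq fun a => ne_top_of_le_ne_top (hba a) (hga a)] at key
  have h2 := ENNReal.tendsto_ofReal key
  rw [ENNReal.ofReal_toReal hgt] at h2
  refine h2.congr' ?_
  filter_upwards [hle] with n hn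
  have : ∑' a, f n a ≠ ⊤ := ne_top_of_le_ne_top hb (ENNReal.tsum_le_tsum hn)
  rw [← ENNReal.tsum_toReal_eq fun a => ne_top_of_le_ne_top (hba a) (hn a),
    ENNReal.ofReal_toReal this]

/-- The product of the harmonic functions of the centred coordinates. -/
def hprod (μ : (Fin d → ℤ) → ℝ) (x : Fin d → ℤ) : ℝ≥0∞ :=
  ∏ i, if Mvec μ i = 0 then hfun μ i (x i) else 1

theorem hprod_of_notMem {x : Fin d → ℤ} (hx : x ∉ posDom (LambdaM μ)) : hprod μ x = 0 := by
  obtain ⟨i, hi, hxi⟩ : ∃ i, ∃ _ : i ∈ LambdaM μ, ¬0 < x i := by simpa [posDom] using hx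
  refine Finset.prod_eq_zero (Finset.mem_univ i) ?_
  rw [if_pos (show Mvec μ i = 0 from hi), hfun_of_le i (not_lt.1 hxi)]

theorem hprod_ne_zero {x : Fin d → ℤ} (hx : x ∈ posDom (LambdaM μ)) : hprod μ x ≠ 0 := by
  refine Finset.prod_ne_zero_iff.2 fun i _ => ?_
  split_ifs with hi
  · exact hfun_ne_zero i (hx i hi)
  · exact one_ne_zero

theorem Standing.hprod_ne_top (h : Standing μ) (x : Fin d → ℤ) : hprod μ x ≠ ⊤ := by
  refine ENNReal.prod_ne_top fun i _ => ?_
  split_ifs with hi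
  · exact h.hfun_ne_top hi _
  · exact ENNReal.one_ne_top

/-- A pointwise limit of the normalised Green functions along an ultrafilter. -/
structure IsGrnLimit (μ : (Fin d → ℤ) → ℝ) (xs : ℕ → Fin d → ℤ) (U : Filter ℕ)
    (K : (Fin d → ℤ) → ℝ≥0∞) : Prop where
  le : U ≤ atTop
  neBot : U.NeBot
  drift : AlongDrift μ xs
  lim : ∀ x, Tendsto (fun n => grn μ (LambdaM μ) (xs n) x / grn μ (LambdaM μ) (xs n) 1) U
    (𝓝 (K x))

namespace Standing

theorem summable_growth (h : Standing μ) : ∃ κ > 0, ∀ C ≥ 0, ∀ x : Fin d → ℤ,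
    ∑' z, wt μ z * ENNReal.ofReal (C * Real.exp (κ * znorm (x + z))) ≠ ⊤ := by
  obtain ⟨c, hc, hs⟩ := h.exists_summable_exp
  refine ⟨c, hc, fun C hC x => ?_⟩
  have hs' := hs.mul_left (C * Real.exp (c * znorm x))
  refine ne_top_of_le_ne_top hs'.tsum_ofReal_ne_top (ENNReal.tsum_le_tsum fun z => ?_)
  rw [wt, ← ENNReal.ofReal_mul (h.nonneg z)]
  refine ENNReal.ofReal_le_ofReal ?_
  calc μ z * (C * Real.exp (c * znorm (x + z)))
      ≤ μ z * (C * Real.exp (c * znorm x + c * znorm z)) := by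
        have := znorm_add_le x z
        have h2 := h.nonneg z
        gcongr
        nlinarith
    _ = _ := by rw [Real.exp_add]; ring

theorem eventually_grn_one_ne_zero (h : Standing μ) {xs : ℕ → Fin d → ℤ}
    (hx : AlongDrift μ xs) (Λ : Set (Fin d)) : ∀ᶠ n in atTop, grn μ Λ (xs n) 1 ≠ 0 := by
  filter_upwards [h.eventually_exp_le_grn hx Λ one_pos] with n hn h0
  rw [h0, le_zero_iff, ENNReal.ofReal_eq_zero] at hn
  exact absurd hn (not_le.2 (Real.exp_pos _))

theorem grn_ne_top (h : Standing μ) (Λ : Set (Fin d)) (y x : Fin d → ℤ) : grn μ Λ y x ≠ ⊤ :=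
  h.green_ne_top _ _ _

theorem grn_of_notMem {xs : ℕ → Fin d → ℤ} (hx : AlongDrift μ xs) (Λ : Set (Fin d)) (n : ℕ)
    {x : Fin d → ℤ} (hxS : x ∉ posDom Λ) : grn μ Λ (xs n) x = 0 :=
  pot_ks_of_notMem (dl_of_notMem (posDom_anti (Set.subset_univ _) (hx.mem n))) hxS

variable {xs : ℕ → Fin d → ℤ} {U : Filter ℕ} {K : (Fin d → ℤ) → ℝ≥0∞}

theorem limit_one (h : Standing μ) (hK : IsGrnLimit μ xs U K) : K 1 = 1 := by
  have := hK.neBot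
  refine tendsto_nhds_unique (hK.lim 1) (tendsto_const_nhds.congr' ?_)
  filter_upwards [hK.le (h.eventually_grn_one_ne_zero hK.drift (LambdaM μ))] with n hn
  exact (ENNReal.div_self hn (h.grn_ne_top _ _ _)).symm

theorem limit_of_notMem (hK : IsGrnLimit μ xs U K) {x : Fin d → ℤ}
    (hx : x ∉ posDom (LambdaM μ)) : K x = 0 := by
  have := hK.neBot
  refine tendsto_nhds_unique (hK.lim x) (tendsto_const_nhds.congr fun n => ?_)
  rw [grn_of_notMem hK.drift _ n hx, ENNReal.zero_div]

theorem exists_ratio_le (h : Standing μ) (hx : AlongDrift μ xs) {κ : ℝ} (hκ : 0 < κ) :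
    ∃ C ≥ 0, ∀ᶠ n in atTop, ∀ x,
      grn μ (LambdaM μ) (xs n) x / grn μ (LambdaM μ) (xs n) 1 ≤
        ENNReal.ofReal (C * Real.exp (κ * znorm x)) := by
  obtain ⟨C, hC, H⟩ := h.exists_grn_le hx hκ
  refine ⟨C, hC, H.mono fun n hn x => ?_⟩
  by_cases hxS : x ∈ posDom (LambdaM μ)
  · exact ENNReal.div_le_of_le_mul (hn x hxS)
  · rw [grn_of_notMem hx _ n hxS, ENNReal.zero_div]
    exact zero_le

theorem limit_ne_top (h : Standing μ) (hK : IsGrnLimit μ xs U K) (x : Fin d → ℤ) :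
    K x ≠ ⊤ := by
  have := hK.neBot
  obtain ⟨C, hC, H⟩ := h.exists_ratio_le hK.drift one_pos
  exact ne_top_of_le_ne_top ENNReal.ofReal_ne_top
    (le_of_tendsto (hK.lim x) ((H.filter_mono hK.le).mono fun n hn => hn x))

theorem tendsto_kop_ratio (h : Standing μ) (hK : IsGrnLimit μ xs U K)
    {m : (Fin d → ℤ) → ℝ≥0∞} (hm : ∀ z, m z ≤ wt μ z) (x : Fin d → ℤ) :
    Tendsto (fun n => kop (ks m (posDom (LambdaM μ))) (grn μ (LambdaM μ) (xs n)) x /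
      grn μ (LambdaM μ) (xs n) 1) U (𝓝 (kop (ks m (posDom (LambdaM μ))) K x)) := by
  obtain ⟨κ, hκ, hs⟩ := h.summable_growth
  obtain ⟨C, hC, H⟩ := h.exists_ratio_le hK.drift hκ
  by_cases hx : x ∈ posDom (LambdaM μ)
  · have e : ∀ n, kop (ks m (posDom (LambdaM μ))) (grn μ (LambdaM μ) (xs n)) x /
        grn μ (LambdaM μ) (xs n) 1 = ∑' z, m z * (grn μ (LambdaM μ) (xs n) (x + z) /
          grn μ (LambdaM μ) (xs n) 1) := fun n => by
      rw [kop_ks_of_mem hx fun y hy => grn_of_notMem hK.drift _ n hy, div_eq_mul_inv,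
        ← ENNReal.tsum_mul_right]
      exact tsum_congr fun z => by rw [div_eq_mul_inv, mul_assoc]
    simp only [e]
    rw [kop_ks_of_mem hx fun y hy => limit_of_notMem hK hy]
    refine tendsto_tsum_of_dominated (hs C hC x) (fun z => ?_) ?_
    · refine ENNReal.Tendsto.const_mul (hK.lim _) (Or.inr ?_)
      exact ne_top_of_le_ne_top ENNReal.ofReal_ne_top (hm z)
    · filter_upwards [hK.le H] with n hn z
      exact mul_le_mul' (hm z) (hn _)
  · simp only [kop_ks_apply, if_neg hx, ENNReal.zero_div]
    exact tendsto_const_nhds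

theorem limit_le_of_eventually (h : Standing μ) (hK : IsGrnLimit μ xs U K) {x : Fin d → ℤ}
    (hx : x ∈ posDom (LambdaM μ)) {v : ℕ → (Fin d → ℤ) → ℝ≥0∞} {c L : ℝ≥0∞} (hc : c ≠ ⊤)
    (hL : Tendsto (fun n => v n x / grn μ (LambdaM μ) (xs n) 1) U (𝓝 L))
    (hv : ∀ η > (0 : ℝ), ∀ᶠ δ in 𝓝[>] (0 : ℝ), ∀ᶠ n in atTop, ∀ y ∈ posDom (LambdaM μ),
      znorm y ≤ δ * znorm (xs n) →
        v n y ≤ (c + ENNReal.ofReal η) * grn μ (LambdaM μ) (xs n) y) :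
    L ≤ c * K x := by
  have := hK.neBot
  have h1 : ∀ η > (0 : ℝ), L ≤ (c + ENNReal.ofReal η) * K x := fun η hη => by
    obtain ⟨δ, hδ, hδ0⟩ := ((hv η hη).and self_mem_nhdsWithin).exists
    replace hδ0 : 0 < δ := hδ0
    refine le_of_tendsto_of_tendsto hL (ENNReal.Tendsto.const_mul (hK.lim x) (Or.inr ?_)) ?_
    · exact ENNReal.add_ne_top.2 ⟨hc, ENNReal.ofReal_ne_top⟩
    · filter_upwards [hK.le hδ, hK.le (hK.drift.norm.eventually_ge_atTop (znorm x / δ))]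
        with n hn hn2
      rw [← mul_div_assoc]
      refine ENNReal.div_le_div_right (hn x hx ?_) _
      rwa [div_le_iff₀' hδ0] at hn2
  have h2 : Tendsto (fun η : ℝ => (c + ENNReal.ofReal η) * K x) (𝓝[>] 0)
      (𝓝 ((c + ENNReal.ofReal 0) * K x)) := by
    refine ENNReal.Tendsto.mul_const (Tendsto.const_add _ ?_) (Or.inr (h.limit_ne_top hK x))
    exact (ENNReal.continuous_ofReal.tendsto 0).mono_left nhdsWithin_le_nhds
  rw [ENNReal.ofReal_zero, add_zero] at h2
  exact ge_of_tendsto h2 (eventually_nhdsWithin_of_forall fun η hη => h1 η hη)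

theorem limit_add_le (h : Standing μ) (hK : IsGrnLimit μ xs U K) {w : Fin d → ℤ}
    (hw : ∀ i ∈ LambdaM μ, w i = 0) {x : Fin d → ℤ} (hx : x ∈ posDom (LambdaM μ)) :
    K (x + w) ≤ K x := by
  rw [← one_mul (K x)]
  refine h.limit_le_of_eventually hK hx (v := fun n y => grn μ (LambdaM μ) (xs n) (y + w))
    ENNReal.one_ne_top (hK.lim _) fun η hη => ?_
  have := h.eventually_grn_add_le hK.drift (LambdaM μ) hw hη
  rwa [ENNReal.ofReal_add zero_le_one hη.le, ENNReal.ofReal_one] at this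

theorem limit_congr (h : Standing μ) (hK : IsGrnLimit μ xs U K) {x y : Fin d → ℤ}
    (hx : x ∈ posDom (LambdaM μ)) (hxy : ∀ i ∈ LambdaM μ, x i = y i) : K x = K y := by
  have hy : y ∈ posDom (LambdaM μ) := fun i hi => hxy i hi ▸ hx i hi
  have h1 := h.limit_add_le hK (w := x - y) (fun i hi => by simp [hxy i hi]) hy
  have h2 := h.limit_add_le hK (w := y - x) (fun i hi => by simp [hxy i hi]) hx
  rw [add_sub_cancel] at h1 h2
  exact le_antisymm h1 h2

theorem limit_eq_kop (h : Standing μ) (hK : IsGrnLimit μ xs U K) (x : Fin d → ℤ) :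
    kop (ks (wt μ) (posDom (LambdaM μ))) K x = K x := by
  have := hK.neBot
  refine tendsto_nhds_unique (h.tendsto_kop_ratio hK (fun _ => le_rfl) x) ((hK.lim x).congr' ?_)
  filter_upwards [hK.le (hK.drift.norm.eventually_gt_atTop (znorm x))] with n hn
  have hne : x ≠ xs n := fun e => by rw [← e] at hn; exact lt_irrefl _ hn
  have e := congrFun (pot_eq (ks (wt μ) (posDom (LambdaM μ))) (dl (xs n))) x
  rw [Pi.add_apply] at e
  rw [grn, e]
  simp [dl, hne]

theorem limit_kop_restr (h : Standing μ) (hK : IsGrnLimit μ xs U K) {i : Fin d}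
    (hi : Mvec μ i = 0) {x : Fin d → ℤ} (hx : x ∈ posDom (LambdaM μ)) :
    kop (ks (restr (wt μ) fun z => z i ≠ 0) (posDom (LambdaM μ))) K x +
      (∑' z, restr (wt μ) (fun z => ¬z i ≠ 0) z) * K x = K x := by
  have hfin : ∀ P, ∑' z, restr (wt μ) P z ≠ ⊤ := fun P =>
    ne_top_of_le_ne_top (h.tsum_wt ▸ ENNReal.one_ne_top)
      (ENNReal.tsum_le_tsum (restr_le (wt μ) P))
  have hA : kop (ks (restr (wt μ) fun z => z i ≠ 0) (posDom (LambdaM μ))) K x ≤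
      (∑' z, restr (wt μ) (fun z => z i ≠ 0) z) * K x :=
    h.limit_le_of_eventually hK hx (hfin _) (h.tendsto_kop_ratio hK (restr_le _ _) x)
      fun η hη => h.eventually_kop_restr_grn_le hK.drift le_rfl hi (Or.inl rfl) hη
  have hB : kop (ks (restr (wt μ) fun z => ¬z i ≠ 0) (posDom (LambdaM μ))) K x ≤
      (∑' z, restr (wt μ) (fun z => ¬z i ≠ 0) z) * K x :=
    h.limit_le_of_eventually hK hx (hfin _) (h.tendsto_kop_ratio hK (restr_le _ _) x)
      fun η hη => h.eventually_kop_restr_grn_le hK.drift le_rfl hi (Or.inr rfl) hη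
  have hAB := h.limit_eq_kop hK x
  rw [kop_ks_restr_add (wt μ) fun z => z i ≠ 0] at hAB
  have hs : (∑' z, restr (wt μ) (fun z => z i ≠ 0) z) +
      (∑' z, restr (wt μ) (fun z => ¬z i ≠ 0) z) = 1 := by
    have := tsum_restr_add (μ := μ) (fun z => z i ≠ 0) fun _ => 1
    simpa [h.tsum_wt] using this
  refine le_antisymm ?_ ?_
  · refine (add_le_add hA le_rfl).trans ?_
    rw [← add_mul, hs, one_mul]
  · conv_lhs => rw [← hAB]
    exact add_le_add le_rfl hB

end Standing

end

noncomputable section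

variable {d : ℕ} {μ : (Fin d → ℤ) → ℝ}

namespace Standing

variable {xs : ℕ → Fin d → ℤ} {U : Filter ℕ} {K : (Fin d → ℤ) → ℝ≥0∞}

theorem exists_limit_update_eq (h : Standing μ) (hK : IsGrnLimit μ xs U K) {i : Fin d}
    (hi : Mvec μ i = 0) {x : Fin d → ℤ} (hx : x ∈ posDom (LambdaM μ)) :
    ∃ c, ∀ s, 0 < s → K (Function.update x i s) = c * hfun μ i s := by
  set k : ℤ → ℝ≥0∞ := fun s => if 0 < s then K (Function.update x i s) else 0 with hkdef
  have hk0 : ∀ s ≤ 0, k s = 0 := fun s hs => if_neg (not_lt.2 hs)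
  have hk1 : ∀ s, 0 < s → k s = K (Function.update x i s) := fun s hs => if_pos hs
  have hk : nop μ i k = k := by
    funext s
    rcases le_or_gt s 0 with hs | hs
    · rw [nop_of_le i k hs, hk0 s hs]
    rw [nop_of_pos' i hk0 hs, hk1 s hs]
    have hxs : Function.update x i s ∈ posDom (LambdaM μ) := update_mem_posDom hx i fun _ => hs
    rw [← h.limit_kop_restr hK hi hxs, kop_ks_of_mem hxs fun y hy => limit_of_notMem hK hy,
      ← tsum_restr_add (fun z => z i ≠ 0), ← ENNReal.tsum_mul_right]
    congr 1
    · refine tsum_congr fun z => ?_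
      by_cases hzi : z i = 0
      · simp [restr, hzi]
      by_cases hμ : μ z = 0
      · simp [restr, wt, hμ]
      have hz : ∀ j ∈ LambdaM μ, j ≠ i → z j = 0 := fun j hj hji => by
        by_contra hzj
        exact hμ (h.mixed z i j hji.symm hi hj hzi hzj)
      congr 1
      rcases le_or_gt (s + z i) 0 with hsz | hsz
      · rw [hk0 _ hsz, limit_of_notMem hK]
        intro hmem
        have := hmem i hi
        simp only [Pi.add_apply, Function.update_self] at this
        omega
      · rw [hk1 _ hsz]
        refine h.limit_congr hK (update_mem_posDom hx i fun _ => hsz) fun j hj => ?_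
        by_cases hji : j = i
        · subst hji; simp
        · simp [hji, hz j hj hji]
    · refine tsum_congr fun z => ?_
      by_cases hzi : z i = 0
      · rw [hzi, add_zero, hk1 s hs]
      · simp [restr, hzi]
  have hk1t : k 1 ≠ ⊤ := by
    rw [hk1 1 one_pos]
    exact h.limit_ne_top hK _
  obtain ⟨c, hc⟩ := h.exists_eq_mul_hfun hi hk hk1t
  exact ⟨c, fun s hs => by rw [← hk1 s hs, hc s]⟩

theorem limit_mul_hfun (h : Standing μ) (hK : IsGrnLimit μ xs U K) {i : Fin d}
    (hi : Mvec μ i = 0) {x : Fin d → ℤ} (hx : x ∈ posDom (LambdaM μ)) :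
    K x * hfun μ i 1 = K (Function.update x i 1) * hfun μ i (x i) := by
  obtain ⟨c, hc⟩ := h.exists_limit_update_eq hK hi hx
  have h1 := hc (x i) (hx i hi)
  rw [Function.update_eq_self] at h1
  rw [h1, hc 1 one_pos]
  ring

theorem limit_mul_prod (h : Standing μ) (hK : IsGrnLimit μ xs U K) {x : Fin d → ℤ}
    (hx : x ∈ posDom (LambdaM μ)) (T : Finset (Fin d)) :
    K x * ∏ i ∈ T, (if Mvec μ i = 0 then hfun μ i 1 else 1) =
      K (T.piecewise 1 x) * ∏ i ∈ T, (if Mvec μ i = 0 then hfun μ i (x i) else 1) := by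
  induction T using Finset.induction_on with
  | empty => simp
  | insert i T hiT ih =>
    have hmem : T.piecewise 1 x ∈ posDom (LambdaM μ) := fun j hj => by
      by_cases hjT : j ∈ T <;> simp [hjT, hx j hj]
    rw [Finset.prod_insert hiT, Finset.prod_insert hiT, Finset.piecewise_insert]
    split_ifs with hi
    · have := h.limit_mul_hfun hK hi hmem
      rw [Finset.piecewise_eq_of_notMem _ _ _ hiT] at this
      calc _ = (K x * ∏ i ∈ T, (if Mvec μ i = 0 then hfun μ i 1 else 1)) * hfun μ i 1 := by ring
        _ = (K (T.piecewise 1 x) * hfun μ i 1) *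
            ∏ i ∈ T, (if Mvec μ i = 0 then hfun μ i (x i) else 1) := by rw [ih]; ring
        _ = _ := by rw [this, Pi.one_apply]; ring
    · rw [one_mul, one_mul, ih]
      congr 1
      refine h.limit_congr hK hmem fun j hj => ?_
      have hji : j ≠ i := fun e => hi (e ▸ hj)
      simp [hji]

theorem limit_eq (h : Standing μ) (hK : IsGrnLimit μ xs U K) (x : Fin d → ℤ) :
    K x = hprod μ x / hprod μ 1 := by
  by_cases hx : x ∈ posDom (LambdaM μ)
  · have := h.limit_mul_prod hK hx Finset.univ
    rw [Finset.piecewise_univ, h.limit_one hK, one_mul] at this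
    rw [ENNReal.eq_div_iff (hprod_ne_zero (one_mem_posDom _)) (h.hprod_ne_top 1), mul_comm]
    exact this
  · rw [limit_of_notMem hK hx, hprod_of_notMem hx, ENNReal.zero_div]

/-- The normalised Green functions of the walk killed only by the centred coordinates converge. -/
theorem tendsto_grn_ratio (h : Standing μ) (hx : AlongDrift μ xs) (x : Fin d → ℤ) :
    Tendsto (fun n => grn μ (LambdaM μ) (xs n) x / grn μ (LambdaM μ) (xs n) 1) atTop
      (𝓝 (hprod μ x / hprod μ 1)) := by
  refine (tendsto_iff_ultrafilter _ _ _).2 ?_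
  intro U hU
  have hK : IsGrnLimit μ xs U fun x =>
      (U.map fun n => grn μ (LambdaM μ) (xs n) x / grn μ (LambdaM μ) (xs n) 1).lim :=
    ⟨hU, U.neBot, hx, fun x => Ultrafilter.le_nhds_lim _⟩
  rw [← h.limit_eq hK x]
  exact hK.lim x

end Standing

end

noncomputable section

variable {d : ℕ} {μ : (Fin d → ℤ) → ℝ}

theorem prod_add_le {ι : Type*} [DecidableEq ι] (T : Finset ι) (a e : ι → ℝ≥0∞) :
    ∏ i ∈ T, (a i + e i) ≤
      ∏ i ∈ T, a i + ∑ i ∈ T, e i * ∏ j ∈ T.erase i, (a j + e j) := by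
  induction T using Finset.induction_on with
  | empty => simp
  | insert i T hi ih =>
    rw [Finset.prod_insert hi, Finset.prod_insert hi, Finset.sum_insert hi,
      Finset.erase_insert hi]
    have hs : ∑ k ∈ T, e k * ∏ j ∈ (insert i T).erase k, (a j + e j) =
        (a i + e i) * ∑ k ∈ T, e k * ∏ j ∈ T.erase k, (a j + e j) := by
      rw [Finset.mul_sum]
      refine Finset.sum_congr rfl fun k hk => ?_
      have hki : i ≠ k := fun e => hi (e ▸ hk)
      rw [Finset.erase_insert_of_ne hki, Finset.prod_insert (by simp [hi])]
      ring
    rw [hs, add_mul]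
    set P := ∏ j ∈ T, (a j + e j)
    set Q := ∑ k ∈ T, e k * ∏ j ∈ T.erase k, (a j + e j)
    calc a i * P + e i * P ≤ a i * (∏ j ∈ T, a j + Q) + e i * P := by gcongr
      _ ≤ a i * (∏ j ∈ T, a j + Q) + e i * P + e i * Q := le_self_add
      _ = _ := by ring

namespace Standing

/-- A jump of the walk changes at most one factor of a product of functions of the centred
coordinates. -/
theorem prod_add_sum (h : Standing μ) {R : Type*} [CommSemiring R] {g : Fin d → ℤ → R}
    (hg : ∀ i, Mvec μ i ≠ 0 → ∀ s t, g i s = g i t) {z : Fin d → ℤ} (hz : μ z ≠ 0)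
    (x : Fin d → ℤ) :
    ∏ i, g i (x i + z i) + ∑ _i : Fin d, ∏ j, g j (x j) =
      ∑ i, g i (x i + z i) * ∏ j ∈ Finset.univ.erase i, g j (x j) + ∏ j, g j (x j) := by
  obtain ⟨i₀, hi₀⟩ : ∃ i₀, ∀ j, j ≠ i₀ → g j (x j + z j) = g j (x j) := by
    by_cases hex : ∃ i, Mvec μ i = 0 ∧ z i ≠ 0
    · obtain ⟨i, hi, hzi⟩ := hex
      refine ⟨i, fun j hji => ?_⟩
      by_cases hj : Mvec μ j = 0
      · have : z j = 0 := by
          by_contra hzj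
          exact hz (h.mixed z i j hji.symm hi hj hzi hzj)
        rw [this, add_zero]
      · exact hg j hj _ _
    · obtain ⟨i, -⟩ := h.exists_pos_drift
      refine ⟨i, fun j _ => ?_⟩
      by_cases hj : Mvec μ j = 0
      · have : z j = 0 := by
          by_contra hzj
          exact hex ⟨j, hj, hzj⟩
        rw [this, add_zero]
      · exact hg j hj _ _
  have h1 : ∏ i, g i (x i + z i) =
      g i₀ (x i₀ + z i₀) * ∏ j ∈ Finset.univ.erase i₀, g j (x j) := by
    rw [← Finset.mul_prod_erase Finset.univ _ (Finset.mem_univ i₀)]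
    congr 1
    exact Finset.prod_congr rfl fun j hj => hi₀ j (Finset.ne_of_mem_erase hj)
  rw [← Finset.add_sum_erase Finset.univ
      (fun i => g i (x i + z i) * ∏ j ∈ Finset.univ.erase i, g j (x j)) (Finset.mem_univ i₀),
    ← Finset.add_sum_erase Finset.univ (fun _ => ∏ j, g j (x j)) (Finset.mem_univ i₀), h1]
  have h2 : ∑ i ∈ Finset.univ.erase i₀,
        g i (x i + z i) * ∏ j ∈ Finset.univ.erase i, g j (x j) =
      ∑ _i ∈ Finset.univ.erase i₀, ∏ j, g j (x j) := by
    refine Finset.sum_congr rfl fun i hi => ?_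
    rw [hi₀ i (Finset.ne_of_mem_erase hi),
      Finset.mul_prod_erase _ (fun j => g j (x j)) (Finset.mem_univ i)]
  rw [h2]
  ring

theorem tsum_wt_prod (h : Standing μ) {g : Fin d → ℤ → ℝ≥0∞}
    (hg : ∀ i, Mvec μ i ≠ 0 → ∀ s t, g i s = g i t) {x : Fin d → ℤ} {i : Fin d}
    (hgx : ∀ j, j ≠ i → ∑' z, wt μ z * g j (x j + z j) = g j (x j))
    (hfin : ∏ j, g j (x j) ≠ ⊤) :
    ∑' z, wt μ z * ∏ j, g j (x j + z j) =
      (∑' z, wt μ z * g i (x i + z i)) * ∏ j ∈ Finset.univ.erase i, g j (x j) := by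
  set F := ∏ j, g j (x j) with hF
  have hsF : ∑ _i : Fin d, F ≠ ⊤ := ENNReal.sum_ne_top.2 fun _ _ => hfin
  have h1 : ∑' z, wt μ z * ∏ j, g j (x j + z j) + ∑ _i : Fin d, F =
      ∑ i, (∑' z, wt μ z * g i (x i + z i)) * ∏ j ∈ Finset.univ.erase i, g j (x j) + F := by
    have e1 : ∑' z, wt μ z * (∏ j, g j (x j + z j) + ∑ _i : Fin d, F) =
        ∑' z, wt μ z * (∑ i, g i (x i + z i) * ∏ j ∈ Finset.univ.erase i, g j (x j) + F) := by
      refine tsum_congr fun z => ?_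
      by_cases hz : μ z = 0
      · simp [wt, hz]
      · rw [hF, h.prod_add_sum hg hz]
    simp only [mul_add, ENNReal.tsum_add, ENNReal.tsum_mul_right, h.tsum_wt, one_mul] at e1
    rw [e1]
    simp only [Finset.mul_sum]
    rw [Summable.tsum_finsetSum fun _ _ => ENNReal.summable]
    congr 1
    refine Finset.sum_congr rfl fun i _ => ?_
    rw [← ENNReal.tsum_mul_right]
    exact tsum_congr fun z => (mul_assoc _ _ _).symm
  rw [← Finset.add_sum_erase Finset.univ
    (fun i => (∑' z, wt μ z * g i (x i + z i)) * ∏ j ∈ Finset.univ.erase i, g j (x j))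
    (Finset.mem_univ i)] at h1
  have h2 : ∑ k ∈ Finset.univ.erase i,
        (∑' z, wt μ z * g k (x k + z k)) * ∏ j ∈ Finset.univ.erase k, g j (x j) =
      ∑ _i ∈ Finset.univ.erase i, F := by
    refine Finset.sum_congr rfl fun k hk => ?_
    rw [hgx k (Finset.ne_of_mem_erase hk), Finset.mul_prod_erase _ (fun j => g j (x j))
      (Finset.mem_univ k)]
  rw [h2, add_assoc, add_comm (∑ _i ∈ Finset.univ.erase i, F) F,
    Finset.add_sum_erase Finset.univ (fun _ => F) (Finset.mem_univ i)] at h1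
  exact (ENNReal.add_left_inj hsF).1 h1

/-- The factors of `hprod`. -/
def _root_.KilledWalk.hfac (μ : (Fin d → ℤ) → ℝ) (i : Fin d) (s : ℤ) : ℝ≥0∞ :=
  if Mvec μ i = 0 then hfun μ i s else 1

theorem hfac_ne_top (h : Standing μ) (i : Fin d) (s : ℤ) : hfac μ i s ≠ ⊤ := by
  unfold hfac
  split_ifs with hi
  · exact h.hfun_ne_top hi s
  · exact ENNReal.one_ne_top

theorem tsum_wt_hfac (h : Standing μ) (i : Fin d) {s : ℤ} (hs : Mvec μ i = 0 → 0 < s) :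
    ∑' z, wt μ z * hfac μ i (s + z i) = hfac μ i s := by
  unfold hfac
  by_cases hi : Mvec μ i = 0
  · simp only [hi, if_true]
    rw [← nop_of_pos' i (fun s hs => hfun_of_le i hs) (hs hi), h.nop_hfun hi]
  · simp [hi, h.tsum_wt]

/-- The walk killed by the centred coordinates acts on products coordinatewise. -/
theorem kop_prod_update (h : Standing μ) {i : Fin d} (hi : Mvec μ i = 0) {f : ℤ → ℝ≥0∞}
    (hf0 : ∀ s ≤ 0, f s = 0) (hf : ∀ s, f s ≠ ⊤) :
    kop (ks (wt μ) (posDom (LambdaM μ))) (fun x => ∏ j, Function.update (hfac μ) i f j (x j)) =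
      fun x => ∏ j, Function.update (hfac μ) i (nop μ i f) j (x j) := by
  have hzero : ∀ f : ℤ → ℝ≥0∞, (∀ s ≤ 0, f s = 0) → ∀ x ∉ posDom (LambdaM μ),
      ∏ j, Function.update (hfac μ) i f j (x j) = 0 := by
    intro f hf0 x hx
    obtain ⟨k, hk, hxk⟩ : ∃ k, ∃ _ : k ∈ LambdaM μ, ¬0 < x k := by simpa [posDom] using hx
    refine Finset.prod_eq_zero (Finset.mem_univ k) ?_
    by_cases hki : k = i
    · subst hki
      rw [Function.update_self, hf0 _ (not_lt.1 hxk)]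
    · rw [Function.update_of_ne hki, hfac, if_pos (show Mvec μ k = 0 from hk),
        hfun_of_le k (not_lt.1 hxk)]
  funext x
  by_cases hx : x ∈ posDom (LambdaM μ)
  · rw [kop_ks_of_mem hx (hzero f hf0)]
    simp only [Pi.add_apply]
    rw [h.tsum_wt_prod (g := Function.update (hfac μ) i f) (i := i)]
    · rw [← Finset.mul_prod_erase Finset.univ
        (fun j => Function.update (hfac μ) i (nop μ i f) j (x j)) (Finset.mem_univ i)]
      simp only [Function.update_self]
      rw [nop_of_pos' i hf0 (hx i hi)]
      congr 1
      refine Finset.prod_congr rfl fun j hj => ?_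
      rw [Function.update_of_ne (Finset.ne_of_mem_erase hj),
        Function.update_of_ne (Finset.ne_of_mem_erase hj)]
    · intro j hj s t
      have hji : j ≠ i := fun e => hj (e ▸ hi)
      simp [hfac, hji, hj]
    · intro j hji
      simp only [Function.update_of_ne hji]
      exact h.tsum_wt_hfac j fun hj => hx j hj
    · refine ENNReal.prod_ne_top fun j _ => ?_
      by_cases hji : j = i
      · subst hji
        rw [Function.update_self]
        exact hf _
      · rw [Function.update_of_ne hji]
        exact h.hfac_ne_top _ _
  · rw [kop_ks_of_notMem hx, hzero _ (fun s hs => nop_of_le i f hs) x hx]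

theorem kop_hprod (h : Standing μ) :
    kop (ks (wt μ) (posDom (LambdaM μ))) (hprod μ) = hprod μ := by
  funext x
  by_cases hx : x ∈ posDom (LambdaM μ)
  · obtain ⟨i, hi⟩ := h.exists_pos_drift
    rw [kop_ks_of_mem hx fun y hy => hprod_of_notMem hy]
    have := h.tsum_wt_prod (g := hfac μ) (fun i hi s t => by simp [hfac, hi]) (x := x) (i := i)
      (fun j _ => h.tsum_wt_hfac j fun hj => hx j hj) (h.hprod_ne_top x)
    rw [h.tsum_wt_hfac i fun hi' => hx i hi', Finset.mul_prod_erase _ (fun j => hfac μ j (x j))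
      (Finset.mem_univ i)] at this
    exact this
  · rw [kop_ks_of_notMem hx, hprod_of_notMem hx]

/-- Error terms in which one factor is the mean exit position of its coordinate. -/
def _root_.KilledWalk.exitProd (μ : (Fin d → ℤ) → ℝ) (i : Fin d) (x : Fin d → ℤ) : ℝ≥0∞ :=
  ∏ j, Function.update (hfac μ) i (exitMean μ i) j (x j)

theorem tendsto_kop_pow_exitProd (h : Standing μ) {i : Fin d} (hi : Mvec μ i = 0)
    (x : Fin d → ℤ) :
    Tendsto (fun n => (kop (ks (wt μ) (posDom (LambdaM μ))) ^ n) (exitProd μ i) x) atTop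
      (𝓝 0) := by
  have hle : exitMean μ i ≤ hfun μ i := fun s => le_add_self
  have hlen : ∀ n, (nop μ i ^ n) (exitMean μ i) ≤ hfun μ i := fun n => by
    refine (kop_pow_mono _ n hle).trans (le_of_eq ?_)
    induction n with
    | zero => rfl
    | succ n ih => rw [pow_succ, Module.End.mul_apply]; exact (congrArg _ (h.nop_hfun hi)).trans ih
  have hpow : ∀ n, (kop (ks (wt μ) (posDom (LambdaM μ))) ^ n) (exitProd μ i) =
      fun x => ∏ j, Function.update (hfac μ) i ((nop μ i ^ n) (exitMean μ i)) j (x j) := by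
    intro n
    induction n with
    | zero => rfl
    | succ n ih =>
      rw [pow_succ', Module.End.mul_apply, ih, h.kop_prod_update hi, pow_succ',
        Module.End.mul_apply]
      · intro s hs
        exact le_zero_iff.1 ((hlen n s).trans_eq (hfun_of_le i hs))
      · exact fun s => ne_top_of_le_ne_top (h.hfun_ne_top hi s) (hlen n s)
  have h0 : Tendsto (fun n => (nop μ i ^ n) (exitMean μ i) (x i)) atTop (𝓝 0) :=
    tendsto_kop_pow_pot (ne_top_of_le_ne_top (h.hfun_ne_top hi (x i)) (hle (x i)))
  have h1 := ENNReal.Tendsto.mul_const (b := ∏ j ∈ Finset.univ.erase i, hfac μ j (x j)) h0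
    (Or.inr (ENNReal.prod_ne_top fun j _ => h.hfac_ne_top j _))
  rw [zero_mul] at h1
  refine h1.congr fun n => ?_
  rw [hpow n]
  beta_reduce
  rw [← Finset.mul_prod_erase Finset.univ
    (fun j => Function.update (hfac μ) i ((nop μ i ^ n) (exitMean μ i)) j (x j))
    (Finset.mem_univ i)]
  rw [Function.update_self]
  congr 1
  refine Finset.prod_congr rfl fun j hj => ?_
  rw [Function.update_of_ne (Finset.ne_of_mem_erase hj)]

theorem hasSum_prodLam (h : Standing μ) (x : Fin d → ℤ) :
    HasSum (fun z => μ z * prodLam μ (x + z)) (prodLam μ x) := by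
  set g : Fin d → ℤ → ℝ := fun i s => if Mvec μ i = 0 then (s : ℝ) else 1 with hg
  have h1 : ∀ i, HasSum (fun z => μ z * g i (x i + z i)) (g i (x i)) := fun i => by
    by_cases hi : Mvec μ i = 0
    · simpa [hg, hi] using h.hasSum_coord hi (x i)
    · simpa [hg, hi] using h.sum
  have h2 := ((hasSum_sum fun i (_ : i ∈ Finset.univ) =>
    (h1 i).mul_right (∏ j ∈ Finset.univ.erase i, g j (x j))).add
      (h.sum.mul_right (∏ j, g j (x j)))).sub (h.sum.mul_right (∑ _i : Fin d, ∏ j, g j (x j)))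
  have e1 : ∑ i, g i (x i) * ∏ j ∈ Finset.univ.erase i, g j (x j) + 1 * ∏ j, g j (x j) -
      1 * ∑ _i : Fin d, ∏ j, g j (x j) = prodLam μ x := by
    simp only [Finset.mul_prod_erase _ (fun j => g j (x j)) (Finset.mem_univ _)]
    simp [prodLam, hg]
  rw [e1] at h2
  refine h2.congr_fun fun z => ?_
  by_cases hz : μ z = 0
  · simp [hz]
  have h3 := h.prod_add_sum (g := g) (fun i hi s t => by simp [hg, hi]) hz x
  have e2 : prodLam μ (x + z) = ∏ i, g i (x i + z i) := by simp [prodLam, hg]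
  rw [e2, eq_sub_of_add_eq h3, mul_sub, mul_add, Finset.mul_sum]
  simp only [mul_assoc]

end Standing

end

noncomputable section

variable {d : ℕ} {μ : (Fin d → ℤ) → ℝ}

/-- The mean of `f` over the jumps of the walk which leave the positive orthant. -/
def outK (μ : (Fin d → ℤ) → ℝ) (f : (Fin d → ℤ) → ℝ≥0∞) (x : Fin d → ℤ) : ℝ≥0∞ :=
  if x ∈ posAll then ∑' z, wt μ z * (if x + z ∉ posAll then f (x + z) else 0) else 0

theorem outK_of_notMem (f : (Fin d → ℤ) → ℝ≥0∞) {x : Fin d → ℤ} (hx : x ∉ posAll) :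
    outK μ f x = 0 := if_neg hx

theorem outK_add_kop (f : (Fin d → ℤ) → ℝ≥0∞) {x : Fin d → ℤ} (hx : x ∈ posAll) :
    outK μ f x + kop (ks (wt μ) posAll) f x = ∑' z, wt μ z * f (x + z) := by
  rw [outK, if_pos hx, kop_ks_apply, if_pos hx, ← ENNReal.tsum_add]
  refine tsum_congr fun z => ?_
  by_cases hz : x + z ∈ posAll <;> simp [hz]

theorem posAll_subset (Λ : Set (Fin d)) : (posAll : Set (Fin d → ℤ)) ⊆ posDom Λ :=
  fun _ hx i _ => hx i

theorem kern_of_notMem {V : Type*} [AddCommGroup V] (ν : V → ℝ) {S : Set V} {y : V} (hy : y ∉ S)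
    (n : ℕ) (x : V) : kern ν S n x y = 0 := by
  induction n generalizing x with
  | zero =>
    refine if_neg ?_
    rintro ⟨rfl, h⟩
    exact hy h
  | succ n ih => simp [kern, ih]

theorem hasSum_toReal {α : Type*} {f : α → ℝ≥0∞} {a : ℝ≥0∞} (hf : ∑' x, f x = a)
    (ha : a ≠ ⊤) : HasSum (fun x => (f x).toReal) a.toReal := by
  subst hf
  rw [ENNReal.tsum_toReal_eq (ENNReal.ne_top_of_tsum_ne_top ha)]
  exact ENNReal.hasSum_toReal ha

/-- The excess of `hprod` over the product of the centred coordinates. -/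
def excess (μ : (Fin d → ℤ) → ℝ) (x : Fin d → ℤ) : ℝ≥0∞ :=
  ENNReal.ofReal ((hprod μ x).toReal - prodLam μ x)

namespace Standing

theorem prodLam_nonneg {x : Fin d → ℤ} (hx : x ∈ posDom (LambdaM μ)) : 0 ≤ prodLam μ x := by
  refine Finset.prod_nonneg fun i _ => ?_
  split_ifs with hi
  · exact_mod_cast (hx i hi).le
  · exact zero_le_one

theorem ofReal_prodLam {x : Fin d → ℤ} (hx : x ∈ posDom (LambdaM μ)) :
    ENNReal.ofReal (prodLam μ x) =
      ∏ i, if Mvec μ i = 0 then ENNReal.ofReal (x i) else 1 := by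
  unfold prodLam
  rw [ENNReal.ofReal_prod_of_nonneg]
  · exact Finset.prod_congr rfl fun i _ => by split_ifs <;> simp
  · intro i _
    split_ifs with hi
    · exact_mod_cast (hx i hi).le
    · exact zero_le_one

theorem prodLam_le_hprod (h : Standing μ) {x : Fin d → ℤ} (hx : x ∈ posDom (LambdaM μ)) :
    prodLam μ x ≤ (hprod μ x).toReal := by
  refine (ENNReal.ofReal_le_iff_le_toReal (h.hprod_ne_top x)).1 ?_
  rw [ofReal_prodLam hx]
  refine Finset.prod_le_prod' fun i _ => ?_
  split_ifs with hi
  · exact ofReal_le_hfun i (x i)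
  · exact le_rfl

theorem prodLam_le_of_jump (h : Standing μ) {x z : Fin d → ℤ} (hx : x ∈ posAll) (hz : μ z ≠ 0) :
    prodLam μ (x + z) ≤ (hprod μ (x + z)).toReal := by
  by_cases hS : x + z ∈ posDom (LambdaM μ)
  · exact h.prodLam_le_hprod hS
  refine le_trans ?_ ENNReal.toReal_nonneg
  obtain ⟨i, hi, hxi⟩ : ∃ i, ∃ _ : i ∈ LambdaM μ, ¬0 < (x + z) i := by simpa [posDom] using hS
  have hi' : Mvec μ i = 0 := hi
  have hzi : z i ≠ 0 := fun h0 => by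
    rw [Pi.add_apply, h0, add_zero] at hxi
    exact hxi (hx i)
  rw [prodLam, ← Finset.mul_prod_erase Finset.univ _ (Finset.mem_univ i), if_pos hi']
  refine mul_nonpos_of_nonpos_of_nonneg (by exact_mod_cast not_lt.1 hxi) ?_
  refine Finset.prod_nonneg fun j hj => ?_
  split_ifs with hjΛ
  · have hzj : z j = 0 := by
      by_contra hzj
      exact hz (h.mixed z i j (Finset.ne_of_mem_erase hj).symm hi' hjΛ hzi hzj)
    rw [Pi.add_apply, hzj, add_zero]
    exact_mod_cast (hx j).le
  · exact zero_le_one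

theorem tsum_wt_hprod (h : Standing μ) {x : Fin d → ℤ} (hx : x ∈ posDom (LambdaM μ)) :
    ∑' z, wt μ z * hprod μ (x + z) = hprod μ x := by
  have := congrFun h.kop_hprod x
  rwa [kop_ks_of_mem hx fun y hy => hprod_of_notMem hy] at this

theorem outK_hprod_add (h : Standing μ) {x : Fin d → ℤ} (hx : x ∈ posAll) :
    outK μ (hprod μ) x + kop (ks (wt μ) posAll) (hprod μ) x = hprod μ x := by
  rw [outK_add_kop _ hx, h.tsum_wt_hprod (posAll_subset _ hx)]

theorem pot_outK_hprod_le (h : Standing μ) :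
    pot (ks (wt μ) posAll) (outK μ (hprod μ)) ≤ hprod μ := by
  refine pot_le fun x => ?_
  by_cases hx : x ∈ posAll
  · exact (h.outK_hprod_add hx).le
  · rw [Pi.add_apply, outK_of_notMem _ hx, kop_ks_of_notMem hx, add_zero]
    exact zero_le

theorem hasSum_excess (h : Standing μ) {x : Fin d → ℤ} (hx : x ∈ posAll) :
    HasSum (fun z => μ z * ((hprod μ (x + z)).toReal - prodLam μ (x + z)))
      ((hprod μ x).toReal - prodLam μ x) := by
  have h1 := h.tsum_wt_hprod (posAll_subset _ hx)
  have h2 := hasSum_toReal h1 (h.hprod_ne_top x)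
  refine (h2.sub (h.hasSum_prodLam x)).congr_fun fun z => ?_
  rw [ENNReal.toReal_mul, wt, ENNReal.toReal_ofReal (h.nonneg z), mul_sub]

theorem outK_excess_add (h : Standing μ) {x : Fin d → ℤ} (hx : x ∈ posAll) :
    outK μ (excess μ) x + kop (ks (wt μ) posAll) (excess μ) x = excess μ x := by
  rw [outK_add_kop _ hx, excess, ← (h.hasSum_excess hx).tsum_eq, ENNReal.ofReal_tsum_of_nonneg]
  · exact tsum_congr fun z => (ENNReal.ofReal_mul (h.nonneg z)).symm
  · intro z
    by_cases hz : μ z = 0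
    · simp [hz]
    · exact mul_nonneg (h.nonneg z) (sub_nonneg.2 (h.prodLam_le_of_jump hx hz))
  · exact (h.hasSum_excess hx).summable

theorem excess_le (h : Standing μ) {x : Fin d → ℤ} (hx : x ∈ posDom (LambdaM μ)) :
    excess μ x ≤ ∑ i, if Mvec μ i = 0 then exitProd μ i x else 0 := by
  unfold excess
  rw [ENNReal.ofReal_sub _ (prodLam_nonneg hx), ENNReal.ofReal_toReal (h.hprod_ne_top x),
    tsub_le_iff_left, ofReal_prodLam hx]
  have h1 := prod_add_le Finset.univ
    (fun i => if Mvec μ i = 0 then ENNReal.ofReal (x i) else 1)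
    (fun i => if Mvec μ i = 0 then exitMean μ i (x i) else 0)
  have h2 : ∀ i, (if Mvec μ i = 0 then ENNReal.ofReal (x i) else 1) +
      (if Mvec μ i = 0 then exitMean μ i (x i) else 0) = hfac μ i (x i) := fun i => by
    unfold hfac hfun
    split_ifs <;> simp
  simp only [h2] at h1
  refine h1.trans (add_le_add le_rfl (Finset.sum_le_sum fun i _ => ?_))
  split_ifs with hi
  · rw [exitProd, ← Finset.mul_prod_erase Finset.univ
      (fun j => Function.update (hfac μ) i (exitMean μ i) j (x j)) (Finset.mem_univ i)]
    rw [Function.update_self]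
    refine mul_le_mul' le_rfl (le_of_eq (Finset.prod_congr rfl fun j hj => ?_))
    rw [Function.update_of_ne (Finset.ne_of_mem_erase hj)]
  · rw [zero_mul]

theorem tendsto_kop_pow_excess (h : Standing μ) (x : Fin d → ℤ) :
    Tendsto (fun n => (kop (ks (wt μ) posAll) ^ n) (posAll.indicator (excess μ)) x) atTop
      (𝓝 0) := by
  have h1 : Tendsto (fun n => ∑ i, if Mvec μ i = 0 then
      (kop (ks (wt μ) (posDom (LambdaM μ))) ^ n) (exitProd μ i) x else 0) atTop (𝓝 0) := by
    rw [← Finset.sum_const_zero (ι := Fin d) (M := ℝ≥0∞) (s := Finset.univ)]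
    refine tendsto_finsetSum _ fun i _ => ?_
    by_cases hi : Mvec μ i = 0
    · simpa [hi] using h.tendsto_kop_pow_exitProd hi x
    · simp [hi]
  refine tendsto_of_tendsto_of_tendsto_of_le_of_le tendsto_const_nhds h1 (fun _ => zero_le)
    fun n => ?_
  have h2 : posAll.indicator (excess μ) ≤ ∑ i, if Mvec μ i = 0 then exitProd μ i else 0 := by
    intro y
    by_cases hy : y ∈ posAll
    · rw [Set.indicator_of_mem hy, Finset.sum_apply]
      refine (h.excess_le (posAll_subset _ hy)).trans_eq (Finset.sum_congr rfl fun i _ => ?_)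
      split_ifs <;> rfl
    · rw [Set.indicator_of_notMem hy]
      exact zero_le
  refine ((kop_pow_le_kop_pow (ks_mono (fun _ => le_rfl) (posAll_subset (LambdaM μ))) n _
    x).trans (kop_pow_mono _ n h2 x)).trans_eq ?_
  rw [map_sum, Finset.sum_apply]
  refine Finset.sum_congr rfl fun i _ => ?_
  split_ifs
  · rfl
  · rw [map_zero]; rfl

theorem pot_outK_excess (h : Standing μ) {x : Fin d → ℤ} (hx : x ∈ posAll) :
    pot (ks (wt μ) posAll) (outK μ (excess μ)) x = excess μ x := by
  rw [← Set.indicator_of_mem hx (excess μ)]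
  refine (eq_pot_of_tendsto ?_ (h.tendsto_kop_pow_excess x)).symm
  funext y
  by_cases hy : y ∈ posAll
  · rw [Set.indicator_of_mem hy, Pi.add_apply, ← h.outK_excess_add hy]
    congr 1
    rw [kop_ks_apply, kop_ks_apply, if_pos hy, if_pos hy]
    refine tsum_congr fun z => ?_
    by_cases hz : y + z ∈ posAll <;> simp [hz]
  · rw [Set.indicator_of_notMem hy, Pi.add_apply, outK_of_notMem _ hy, kop_ks_of_notMem hy,
      add_zero]

theorem outK_hprod_ne_top (h : Standing μ) (x : Fin d → ℤ) : outK μ (hprod μ) x ≠ ⊤ :=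
  ne_top_of_le_ne_top (h.hprod_ne_top x) ((dl_le_pot _ _ x).trans (h.pot_outK_hprod_le x))

theorem outK_excess_ne_top (h : Standing μ) (x : Fin d → ℤ) : outK μ (excess μ) x ≠ ⊤ := by
  by_cases hx : x ∈ posAll
  · refine ne_top_of_le_ne_top (b := excess μ x) ENNReal.ofReal_ne_top ?_
    rw [← h.outK_excess_add hx]
    exact le_self_add
  · rw [outK_of_notMem _ hx]
    exact ENNReal.zero_ne_top

theorem tsum_exit_prodLam (h : Standing μ) {x : Fin d → ℤ} (hx : x ∈ posAll)
    {B : Set (Fin d → ℤ)} (hB : ∀ y, y ∈ B) :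
    ∑' y, (if y ∉ posAll ∧ y ∈ B then μ (y - x) else 0) * prodLam μ y =
      (outK μ (hprod μ) x).toReal - (outK μ (excess μ) x).toReal := by
  have e1 : ∀ f, ∑' z, wt μ z * (if x + z ∉ posAll then f (x + z) else 0) = outK μ f x :=
    fun f => (if_pos hx).symm
  have hH := hasSum_toReal (e1 _) (h.outK_hprod_ne_top x)
  have hD := hasSum_toReal (e1 _) (h.outK_excess_ne_top x)
  rw [← (Equiv.addLeft x).tsum_eq, ← (hH.sub hD).tsum_eq]
  refine tsum_congr fun z => ?_
  rw [Equiv.coe_addLeft]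
  by_cases hz : x + z ∈ posAll
  · simp [hz]
  by_cases hμ : μ z = 0
  · simp [hμ, wt]
  · simp only [hz, not_false_eq_true, hB, and_self, if_true, ENNReal.toReal_mul,
      add_sub_cancel_left, wt, ENNReal.toReal_ofReal (h.nonneg z), excess]
    rw [ENNReal.toReal_ofReal (sub_nonneg.2 (h.prodLam_le_of_jump hx hμ))]
    ring

/-- The function `hM3` is the part of `hprod` which is lost at the boundary of the orthant. -/
theorem hM3_eq (h : Standing μ) {x : Fin d → ℤ} (hx : x ∈ posAll) :
    hM3 μ x = (hprod μ x).toReal - (pot (ks (wt μ) posAll) (outK μ (hprod μ)) x).toReal := by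
  have hHt : pot (ks (wt μ) posAll) (outK μ (hprod μ)) x ≠ ⊤ :=
    ne_top_of_le_ne_top (h.hprod_ne_top x) (h.pot_outK_hprod_le x)
  have hDt : pot (ks (wt μ) posAll) (outK μ (excess μ)) x ≠ ⊤ := by
    rw [h.pot_outK_excess hx]
    exact ENNReal.ofReal_ne_top
  have e0 : ∀ r, ∑' n, (kop (ks (wt μ) posAll) ^ n) r x = pot (ks (wt μ) posAll) r x :=
    fun _ => rfl
  have e : exitExp μ posAll Set.univ (prodLam μ) x =
      (pot (ks (wt μ) posAll) (outK μ (hprod μ)) x).toReal -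
        (pot (ks (wt μ) posAll) (outK μ (excess μ)) x).toReal := by
    rw [← ((hasSum_toReal (e0 _) hHt).sub (hasSum_toReal (e0 _) hDt)).tsum_eq]
    refine tsum_congr fun n => ?_
    have hHn := ENNReal.ne_top_of_tsum_ne_top hHt n
    have hDn := ENNReal.ne_top_of_tsum_ne_top hDt n
    rw [← ((hasSum_toReal (kop_pow_eq_tsum _ n _ x).symm hHn).sub
      (hasSum_toReal (kop_pow_eq_tsum _ n _ x).symm hDn)).tsum_eq]
    refine tsum_congr fun z => ?_
    by_cases hz : z ∈ posAll
    · rw [kern_eq h.nonneg h.sum hz, h.tsum_exit_prodLam hz Set.mem_univ, ENNReal.toReal_mul,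
        ENNReal.toReal_mul, mul_sub]
    · rw [kern_of_notMem μ hz, outK_of_notMem _ hz, outK_of_notMem _ hz]
      simp
  rw [hM3, e, h.pot_outK_excess hx, excess,
    ENNReal.toReal_ofReal (sub_nonneg.2 (h.prodLam_le_hprod (posAll_subset _ hx)))]
  ring

end Standing

end

noncomputable section

variable {d : ℕ} {μ : (Fin d → ℤ) → ℝ}

theorem add_dotZ (a b : Fin d → ℝ) (x : Fin d → ℤ) : dotZ (a + b) x = dotZ a x + dotZ b x := by
  simp only [dotZ, Pi.add_apply, add_mul, Finset.sum_add_distrib]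

/-- The vector of signs encoded by `s`. -/
def bsgn (s : Fin d → Bool) (i : Fin d) : ℝ := if s i then 1 else -1

theorem abs_bsgn (s : Fin d → Bool) (i : Fin d) : |bsgn s i| = 1 := by
  unfold bsgn
  split_ifs <;> simp

/-- A sum of exponentials which is excessive for the walk and large outside of the orthant. -/
def barrier (μ : (Fin d → ℤ) → ℝ) (κ : ℝ) (x : Fin d → ℤ) : ℝ≥0∞ :=
  ∑ j, ∑ s : Fin d → Bool,
    if Mvec μ j = 0 then 0 else ex (Pi.single j (-κ) + κ ^ 2 • bsgn s) x

theorem barrier_ne_top (κ : ℝ) (x : Fin d → ℤ) : barrier μ κ x ≠ ⊤ := by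
  refine ENNReal.sum_ne_top.2 fun j _ => ENNReal.sum_ne_top.2 fun s _ => ?_
  split_ifs
  · exact ENNReal.zero_ne_top
  · exact ENNReal.ofReal_ne_top

theorem le_barrier {κ : ℝ} (hκ : 0 < κ) {x : Fin d → ℤ} (hx : x ∈ posDom (LambdaM μ))
    (hxA : x ∉ posAll) : ENNReal.ofReal (Real.exp (κ ^ 2 * znorm x)) ≤ barrier μ κ x := by
  obtain ⟨j, hj⟩ : ∃ j, ¬0 < x j := by simpa [posAll] using hxA
  have hjM : Mvec μ j ≠ 0 := fun h0 => hj (hx j h0)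
  set s : Fin d → Bool := fun i => decide (0 ≤ x i)
  have hs : bsgn s = sgn x := funext fun i => by simp [bsgn, sgn, s]
  refine le_trans ?_ (Finset.single_le_sum (fun _ _ => zero_le) (Finset.mem_univ j))
  refine le_trans ?_ (Finset.single_le_sum (fun _ _ => zero_le) (Finset.mem_univ s))
  rw [if_neg hjM, ex, add_dotZ, hs, dotZ_smul_sgn, dotZ_single]
  refine ENNReal.ofReal_le_ofReal (Real.exp_le_exp.2 ?_)
  have : (x j : ℝ) ≤ 0 := by exact_mod_cast not_lt.1 hj
  nlinarith

/-- A point of the orthant far away from the walls which are not orthogonal to the drift. -/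
def farPoint (μ : (Fin d → ℤ) → ℝ) (N : ℕ) (i : Fin d) : ℤ := if Mvec μ i = 0 then 1 else N + 1

theorem farPoint_mem (N : ℕ) : farPoint μ N ∈ (posAll : Set (Fin d → ℤ)) := fun i => by
  unfold farPoint
  split_ifs <;> positivity

theorem hprod_farPoint (N : ℕ) : hprod μ (farPoint μ N) = hprod μ 1 := by
  refine Finset.prod_congr rfl fun i _ => ?_
  split_ifs with hi
  · simp [farPoint, hi]
  · rfl

theorem tendsto_barrier_farPoint {κ : ℝ} (hκ : 0 < κ) (hd : κ * d ≤ 1 / 2) :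
    Tendsto (fun N => barrier μ κ (farPoint μ N)) atTop (𝓝 0) := by
  have h0 : Tendsto (fun N : ℕ => ENNReal.ofReal (Real.exp (-(κ / 2 * (N + 1))))) atTop
      (𝓝 0) := by
    rw [← ENNReal.ofReal_zero]
    refine ENNReal.tendsto_ofReal (Real.tendsto_exp_neg_atTop_nhds_zero.comp ?_)
    exact (tendsto_atTop_add_const_right _ _ tendsto_natCast_atTop_atTop).const_mul_atTop
      (by positivity)
  have h1 : Tendsto (fun N : ℕ => ∑ _j : Fin d, ∑ _s : Fin d → Bool,
      ENNReal.ofReal (Real.exp (-(κ / 2 * (N + 1))))) atTop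
      (𝓝 (∑ _j : Fin d, ∑ _s : Fin d → Bool, 0)) :=
    tendsto_finsetSum _ fun _ _ => tendsto_finsetSum _ fun _ _ => h0
  simp only [Finset.sum_const_zero] at h1
  refine tendsto_of_tendsto_of_tendsto_of_le_of_le tendsto_const_nhds h1 (fun _ => zero_le)
    fun N => Finset.sum_le_sum fun j _ => Finset.sum_le_sum fun s _ => ?_
  split_ifs with hj
  · exact zero_le
  refine ENNReal.ofReal_le_ofReal (Real.exp_le_exp.2 ?_)
  have h2 : dotZ (κ ^ 2 • bsgn s) (farPoint μ N) ≤ ∑ _i : Fin d, κ ^ 2 * ((N : ℝ) + 1) := by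
    refine Finset.sum_le_sum fun i _ => ?_
    have hb := abs_le.1 (abs_bsgn s i).le
    have hp : (1 : ℝ) ≤ farPoint μ N i ∧ (farPoint μ N i : ℝ) ≤ N + 1 := by
      unfold farPoint
      split_ifs <;> simp
    rw [Pi.smul_apply, smul_eq_mul, mul_assoc]
    refine mul_le_mul_of_nonneg_left ?_ (sq_nonneg κ)
    nlinarith
  rw [add_dotZ, dotZ_single]
  have h3 : (farPoint μ N j : ℝ) = N + 1 := by simp [farPoint, hj]
  rw [Finset.sum_const, Finset.card_univ, Fintype.card_fin, nsmul_eq_mul] at h2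
  rw [h3]
  have h4 : κ * d * (κ * ((N : ℝ) + 1)) ≤ 1 / 2 * (κ * ((N : ℝ) + 1)) :=
    mul_le_mul_of_nonneg_right hd (by positivity)
  nlinarith

theorem outK_mono {f g : (Fin d → ℤ) → ℝ≥0∞} (hfg : ∀ y ∉ posAll, f y ≤ g y) :
    outK μ f ≤ outK μ g := fun x => by
  unfold outK
  split_ifs with hx
  · refine ENNReal.tsum_le_tsum fun z => mul_le_mul' le_rfl ?_
    by_cases hz : x + z ∈ posAll
    · simp [hz]
    · simpa [hz] using hfg _ hz
  · exact le_rfl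

theorem outK_smul (c : ℝ≥0∞) (f : (Fin d → ℤ) → ℝ≥0∞) : outK μ (c • f) = c • outK μ f := by
  funext x
  simp only [outK, Pi.smul_apply, smul_eq_mul]
  split_ifs with hx
  · rw [← ENNReal.tsum_mul_left]
    refine tsum_congr fun z => ?_
    split_ifs <;> ring
  · rw [mul_zero]

namespace Standing

theorem exists_mgf_barrier_le_one (h : Standing μ) : ∀ᶠ κ : ℝ in 𝓝[>] 0, ∀ j, Mvec μ j ≠ 0 →
    ∀ s : Fin d → Bool, mgf (wt μ) (Pi.single j (-κ) + κ ^ 2 • bsgn s) ≤ 1 := by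
  obtain ⟨c, hc, C, hC, H⟩ := h.exists_mgf_le
  refine eventually_all.2 fun j => ?_
  by_cases hj : Mvec μ j = 0
  · exact Eventually.of_forall fun κ hj' => absurd hj hj'
  have hj0 : 0 < Mvec μ j := lt_of_le_of_ne (h.driftNonneg j) (Ne.symm hj)
  set T := ∑ i, Mvec μ i
  have hT : 0 ≤ T := Finset.sum_nonneg fun i _ => h.driftNonneg i
  have h1 : (0 : ℝ) < min (min 1 (c / 2)) (Mvec μ j / (T + 4 * C)) := by positivity
  filter_upwards [Ioc_mem_nhdsGT h1] with κ hκ _ s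
  obtain ⟨hκ0, hκ⟩ := hκ
  have hκ1 : κ ≤ 1 := hκ.trans ((min_le_left _ _).trans (min_le_left _ _))
  have hκc : κ ≤ c / 2 := hκ.trans ((min_le_left _ _).trans (min_le_right _ _))
  have hκM : κ * (T + 4 * C) ≤ Mvec μ j :=
    (le_div_iff₀ (by positivity)).1 (hκ.trans (min_le_right _ _))
  refine (H (2 * κ) (by linarith) _ fun i => ?_).trans ?_
  · rw [Pi.add_apply, Pi.smul_apply, smul_eq_mul]
    refine (abs_add_le _ _).trans ?_
    rw [abs_mul, abs_bsgn, mul_one, abs_of_nonneg (sq_nonneg κ)]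
    have : |(Pi.single j (-κ) : Fin d → ℝ) i| ≤ κ := by
      by_cases hij : i = j
      · subst hij
        rw [Pi.single_eq_same, abs_neg, abs_of_pos hκ0]
      · rw [Pi.single_eq_of_ne hij, abs_zero]
        exact hκ0.le
    nlinarith
  · rw [← ENNReal.ofReal_one, ← Real.exp_zero]
    refine ENNReal.ofReal_le_ofReal (Real.exp_le_exp.2 ?_)
    have h2 : dotR (Pi.single j (-κ) + κ ^ 2 • bsgn s) (Mvec μ) ≤ -κ * Mvec μ j + κ ^ 2 * T := by
      rw [← dotR_single]
      simp only [dotR, T, Finset.mul_sum, ← Finset.sum_add_distrib, Pi.add_apply, Pi.smul_apply,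
        smul_eq_mul]
      refine Finset.sum_le_sum fun i _ => ?_
      have hb := (abs_le.1 (abs_bsgn s i).le).2
      have := mul_le_mul_of_nonneg_right hb (h.driftNonneg i)
      nlinarith [sq_nonneg κ]
    nlinarith

theorem eventually_kop_barrier_le (h : Standing μ) : ∀ᶠ κ : ℝ in 𝓝[>] 0,
    ∀ S, kop (ks (wt μ) S) (barrier μ κ) ≤ barrier μ κ := by
  filter_upwards [h.exists_mgf_barrier_le_one] with κ hκ S
  have e : barrier μ κ = ∑ j, ∑ s : Fin d → Bool,
      if Mvec μ j = 0 then 0 else ex (Pi.single j (-κ) + κ ^ 2 • bsgn s) := by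
    funext x
    simp only [barrier, Finset.sum_apply]
    refine Finset.sum_congr rfl fun j _ => Finset.sum_congr rfl fun s _ => ?_
    split_ifs <;> rfl
  rw [e]
  simp only [map_sum]
  refine Finset.sum_le_sum fun j _ => Finset.sum_le_sum fun s _ => ?_
  split_ifs with hj
  · rw [map_zero]
  · refine (kop_ks_ex_le _ _ _).trans fun x => ?_
    rw [Pi.smul_apply, smul_eq_mul]
    exact mul_le_of_le_one_left' (hκ j hj s)

theorem pot_outK_le_of_excessive {W : (Fin d → ℤ) → ℝ≥0∞}
    (hW : kop (ks (wt μ) Set.univ) W ≤ W) : pot (ks (wt μ) posAll) (outK μ W) ≤ W := by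
  refine pot_le fun x => ?_
  rw [Pi.add_apply]
  by_cases hx : x ∈ posAll
  · rw [outK_add_kop _ hx]
    have := hW x
    rwa [kop_ks_of_mem (Set.mem_univ x) fun y hy => absurd (Set.mem_univ y) hy] at this
  · rw [outK_of_notMem _ hx, kop_ks_of_notMem hx, add_zero]
    exact zero_le

theorem exists_hfac_le (h : Standing μ) (i : Fin d) {θ : ℝ} (hθ : 0 < θ) :
    ∃ C ≥ 0, ∀ s, hfac μ i s ≤ ENNReal.ofReal (C * Real.exp (θ * |(s : ℝ)|)) := by
  by_cases hi : Mvec μ i = 0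
  · obtain ⟨C, hC, H⟩ := h.exists_hfun_le hi
    refine ⟨C / θ, by positivity, fun s => ?_⟩
    rw [hfac, if_pos hi]
    rcases le_or_gt s 0 with hs | hs
    · rw [hfun_of_le i hs]
      exact zero_le
    · refine (H s hs).trans (ENNReal.ofReal_le_ofReal ?_)
      have hs' : (0 : ℝ) < s := by exact_mod_cast hs
      rw [abs_of_pos hs', div_mul_eq_mul_div, le_div_iff₀ hθ]
      have := Real.add_one_le_exp (θ * s)
      nlinarith
  · refine ⟨1, zero_le_one, fun s => ?_⟩
    rw [hfac, if_neg hi, ← ENNReal.ofReal_one]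
    refine ENNReal.ofReal_le_ofReal ?_
    rw [one_mul]
    exact Real.one_le_exp (by positivity)

theorem exists_hprod_le (h : Standing μ) {θ : ℝ} (hθ : 0 < θ) :
    ∃ C ≥ 0, ∀ x, hprod μ x ≤ ENNReal.ofReal (C * Real.exp (θ * znorm x)) := by
  choose C hC H using fun i => h.exists_hfac_le i hθ
  refine ⟨∏ i, C i, Finset.prod_nonneg fun i _ => hC i, fun x => ?_⟩
  rw [znorm, Finset.mul_sum, Real.exp_sum, ← Finset.prod_mul_distrib,
    ENNReal.ofReal_prod_of_nonneg fun i _ => mul_nonneg (hC i) (Real.exp_pos _).le]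
  exact Finset.prod_le_prod' fun i _ => H i (x i)

theorem le_smul_barrier {κ C : ℝ} (hκ : 0 < κ) (hC : 0 ≤ C)
    {f : (Fin d → ℤ) → ℝ≥0∞} (hf : ∀ y ∉ posDom (LambdaM μ), f y = 0)
    (hfC : ∀ y, f y ≤ ENNReal.ofReal (C * Real.exp (κ ^ 2 * znorm y))) (y : Fin d → ℤ)
    (hy : y ∉ posAll) : f y ≤ (ENNReal.ofReal C • barrier μ κ) y := by
  by_cases hyS : y ∈ posDom (LambdaM μ)
  · refine (hfC y).trans ?_
    rw [ENNReal.ofReal_mul hC]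
    exact mul_le_mul' le_rfl (le_barrier hκ hyS hy)
  · rw [hf y hyS]
    exact zero_le

end Standing

end

noncomputable section

theorem tendsto_pot {X ι : Type*} {F : Filter ι} {k : X → X → ℝ≥0∞} {f : ι → X → ℝ≥0∞}
    {g b : X → ℝ≥0∞} {x : X} (hb : pot k b x ≠ ⊤) (hlim : ∀ y, Tendsto (fun n => f n y) F (𝓝 (g y)))
    (hle : ∀ᶠ n in F, f n ≤ b) : Tendsto (fun n => pot k (f n) x) F (𝓝 (pot k g x)) := by
  refine tendsto_tsum_of_dominated hb (fun j => ?_) (hle.mono fun n hn j => kop_pow_mono k j hn x)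
  have hj : (kop k ^ j) b x ≠ ⊤ := ENNReal.ne_top_of_tsum_ne_top hb j
  rw [kop_pow_eq_tsum] at hj
  have e : ∀ u, (kop k ^ j) u x = ∑' y, (kop k ^ j) (dl y) x * u y :=
    fun u => kop_pow_eq_tsum k j u x
  rw [e g, funext fun n => e (f n)]
  have hfin : ∀ y, (kop k ^ j) (dl y) x * b y ≠ ⊤ := ENNReal.ne_top_of_tsum_ne_top hj
  have hle' : ∀ᶠ n in F, ∀ y, (kop k ^ j) (dl y) x * f n y ≤ (kop k ^ j) (dl y) x * b y :=
    hle.mono fun n hn y => mul_le_mul' le_rfl (hn y)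
  refine tendsto_tsum_of_dominated hj (fun y => ?_) hle'
  by_cases hc : (kop k ^ j) (dl y) x = ⊤
  · have hb0 : b y = 0 := by
      by_contra h0
      exact hfin y (by rw [hc, ENNReal.top_mul h0])
    have h1 : ∀ᶠ n in F, 0 = f n y := hle.mono fun n hn =>
      (le_antisymm ((hn y).trans hb0.le) zero_le).symm
    have h2 : ∀ᶠ n in F, 0 = (kop k ^ j) (dl y) x * f n y := h1.mono fun n hn => by
      rw [← hn, mul_zero]
    rcases F.eq_or_neBot with rfl | hF
    · exact tendsto_bot
    · rw [tendsto_nhds_unique (hlim y) (tendsto_const_nhds.congr' h1), mul_zero]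
      exact tendsto_const_nhds.congr' h2
  · exact ENNReal.Tendsto.const_mul (hlim y) (Or.inr hc)

variable {d : ℕ} {μ : (Fin d → ℤ) → ℝ}

theorem tendsto_outK {ι : Type*} {F : Filter ι} {f : ι → (Fin d → ℤ) → ℝ≥0∞}
    {g b : (Fin d → ℤ) → ℝ≥0∞} {x : Fin d → ℤ} (hb : outK μ b x ≠ ⊤)
    (hlim : ∀ y, Tendsto (fun n => f n y) F (𝓝 (g y)))
    (hle : ∀ᶠ n in F, ∀ y ∉ posAll, f n y ≤ b y) :
    Tendsto (fun n => outK μ (f n) x) F (𝓝 (outK μ g x)) := by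
  unfold outK at hb ⊢
  by_cases hx : x ∈ posAll
  · simp only [hx, if_true] at hb ⊢
    refine tendsto_tsum_of_dominated hb (fun z => ?_) (hle.mono fun n hn z => ?_)
    · by_cases hz : x + z ∈ posAll
      · simpa [hz] using tendsto_const_nhds
      · simp only [hz, not_false_eq_true, if_true]
        exact ENNReal.Tendsto.const_mul (hlim _) (Or.inr ENNReal.ofReal_ne_top)
    · by_cases hz : x + z ∈ posAll
      · simp [hz]
      · simp only [hz, not_false_eq_true, if_true]
        exact mul_le_mul' le_rfl (hn _ hz)
  · simp only [hx, if_false]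
    exact tendsto_const_nhds

/-- The harmonic function `h_M` with values in `ℝ≥0∞`. -/
def hdrift (μ : (Fin d → ℤ) → ℝ) (x : Fin d → ℤ) : ℝ≥0∞ :=
  hprod μ x - pot (ks (wt μ) posAll) (outK μ (hprod μ)) x

namespace Standing

theorem hdrift_add (h : Standing μ) :
    hdrift μ + pot (ks (wt μ) posAll) (outK μ (hprod μ)) = hprod μ := by
  funext x
  exact tsub_add_cancel_of_le (h.pot_outK_hprod_le x)

theorem hdrift_ne_top (h : Standing μ) (x : Fin d → ℤ) : hdrift μ x ≠ ⊤ :=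
  ne_top_of_le_ne_top (h.hprod_ne_top x) tsub_le_self

theorem hM3_eq_toReal (h : Standing μ) {x : Fin d → ℤ} (hx : x ∈ posAll) :
    hM3 μ x = (hdrift μ x).toReal := by
  rw [h.hM3_eq hx, hdrift, ENNReal.toReal_sub_of_le (h.pot_outK_hprod_le x) (h.hprod_ne_top x)]

theorem kop_hdrift (h : Standing μ) {x : Fin d → ℤ} (hx : x ∈ posAll) :
    kop (ks (wt μ) posAll) (hdrift μ) x = hdrift μ x := by
  set E := pot (ks (wt μ) posAll) (outK μ (hprod μ)) with hE
  have h1 : E x = outK μ (hprod μ) x + kop (ks (wt μ) posAll) E x :=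
    congrFun (pot_eq (ks (wt μ) posAll) (outK μ (hprod μ))) x
  have h2 := h.outK_hprod_add hx
  have h3 : hdrift μ x + E x = hprod μ x := congrFun h.hdrift_add x
  have hEt : E x ≠ ⊤ := ne_top_of_le_ne_top (h.hprod_ne_top x) (h.pot_outK_hprod_le x)
  have h4 : kop (ks (wt μ) posAll) (hprod μ) x =
      kop (ks (wt μ) posAll) (hdrift μ) x + kop (ks (wt μ) posAll) E x := by
    conv_lhs => rw [← h.hdrift_add, map_add]
    rfl
  rw [← ENNReal.add_left_inj hEt, h3, ← h2, h4]
  conv_lhs => rw [h1]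
  ring

theorem harmOn_hM3 (h : Standing μ) : HarmOn μ posAll (hM3 μ) := fun x hx => by
  have h1 := h.kop_hdrift hx
  have h2 := h.hdrift_ne_top x
  rw [← h1, kop_apply] at h2
  rw [h.hM3_eq_toReal hx, ← h1, kop_apply,
    ENNReal.tsum_toReal_eq (ENNReal.ne_top_of_tsum_ne_top h2)]
  refine tsum_congr fun y => ?_
  by_cases hy : y ∈ posAll
  · rw [if_pos hy, ks, if_pos ⟨hx, hy⟩, ENNReal.toReal_mul, wt,
      ENNReal.toReal_ofReal (h.nonneg _), h.hM3_eq_toReal hy]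
  · rw [if_neg hy, ks, if_neg fun hc => hy hc.2, zero_mul, ENNReal.toReal_zero]

theorem exists_barrier (h : Standing μ) : ∃ κ : ℝ, 0 < κ ∧ κ * d ≤ 1 / 2 ∧
    kop (ks (wt μ) Set.univ) (barrier μ κ) ≤ barrier μ κ := by
  have h1 : ∀ᶠ κ : ℝ in 𝓝[>] 0, κ * d ≤ 1 / 2 := by
    have hc : Tendsto (fun κ : ℝ => κ * d) (𝓝[>] 0) (𝓝 (0 * d)) :=
      (tendsto_nhdsWithin_of_tendsto_nhds tendsto_id).mul_const _
    rw [zero_mul] at hc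
    exact hc.eventually_le_const (by norm_num)
  obtain ⟨κ, hκ, hd, hb⟩ :=
    (eventually_mem_nhdsWithin.and (h1.and h.eventually_kop_barrier_le)).exists
  exact ⟨κ, hκ, hd, hb _⟩

theorem hdrift_ne_zero (h : Standing μ) {x : Fin d → ℤ} (hx : x ∈ posAll) : hdrift μ x ≠ 0 := by
  obtain ⟨κ, hκ, hd, hb⟩ := h.exists_barrier
  obtain ⟨C, hC, hH⟩ := h.exists_hprod_le (θ := κ ^ 2) (by positivity)
  have hE : pot (ks (wt μ) posAll) (outK μ (hprod μ)) ≤ ENNReal.ofReal C • barrier μ κ := fun y => by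
    have h1 := pot_mono (ks (wt μ) posAll) (outK_mono (μ := μ)
      (le_smul_barrier hκ hC (fun y hy => hprod_of_notMem hy) hH)) y
    rw [outK_smul, pot_smul] at h1
    exact h1.trans (mul_le_mul' le_rfl (pot_outK_le_of_excessive hb y))
  have h0 : Tendsto (fun N => ENNReal.ofReal C * barrier μ κ (farPoint μ N)) atTop (𝓝 0) := by
    have := ENNReal.Tendsto.const_mul (tendsto_barrier_farPoint (μ := μ) hκ hd)
      (Or.inr (ENNReal.ofReal_ne_top (r := C)))
    rwa [mul_zero] at this
  have hpos : hprod μ 1 ≠ 0 := hprod_ne_zero (one_mem_posDom _)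
  obtain ⟨N, hN⟩ := (h0.eventually_lt_const (pos_iff_ne_zero.2 hpos)).exists
  have hfar : hdrift μ (farPoint μ N) ≠ 0 := by
    rw [hdrift, hprod_farPoint]
    exact (tsub_pos_of_lt ((hE _).trans_lt hN)).ne'
  obtain ⟨θ, -, H⟩ := h.exists_harnack Set.univ
  rw [← posAll_eq] at H
  have hexc : kop (ks (wt μ) posAll) (hdrift μ) ≤ hdrift μ := fun y => by
    by_cases hy : y ∈ posAll
    · exact (h.kop_hdrift hy).le
    · rw [kop_ks_of_notMem hy]
      exact zero_le
  intro hx0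
  have h1 := H _ hexc x hx _ (farPoint_mem (μ := μ) N)
  rw [hx0, mul_zero] at h1
  exact hfar (le_antisymm h1 zero_le)

theorem hM3_pos (h : Standing μ) {x : Fin d → ℤ} (hx : x ∈ posAll) : 0 < hM3 μ x := by
  rw [h.hM3_eq_toReal hx]
  exact ENNReal.toReal_pos (h.hdrift_ne_zero hx) (h.hdrift_ne_top x)

variable {xs : ℕ → Fin d → ℤ}

theorem grn_univ_add (h : Standing μ) {y : Fin d → ℤ} (hy : y ∈ posAll) (Λ : Set (Fin d))
    {x : Fin d → ℤ} (hx : x ∈ posAll) :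
    pot (ks (wt μ) posAll) (dl y) x + pot (ks (wt μ) posAll) (outK μ (grn μ Λ y)) x =
      grn μ Λ y x := by
  set u : (Fin d → ℤ) → ℝ≥0∞ := fun z => if z ∈ posAll then grn μ Λ y z else 0 with hu
  have hule : u ≤ grn μ Λ y := fun z => by
    simp only [hu]
    split_ifs
    exacts [le_rfl, zero_le]
  have hyΛ : y ∈ posDom Λ := posAll_subset Λ hy
  have hku : ∀ z, kop (ks (wt μ) posAll) u z = kop (ks (wt μ) posAll) (grn μ Λ y) z := fun z => by
    rw [kop_ks_apply, kop_ks_apply]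
    refine if_congr Iff.rfl (tsum_congr fun w => ?_) rfl
    by_cases hw : z + w ∈ posAll <;> simp [hu, hw]
  have hrec : u = (dl y + outK μ (grn μ Λ y)) + kop (ks (wt μ) posAll) u := by
    funext z
    by_cases hz : z ∈ posAll
    · have h1 : grn μ Λ y z = dl y z + kop (ks (wt μ) (posDom Λ)) (grn μ Λ y) z :=
        congrFun (pot_eq (ks (wt μ) (posDom Λ)) (dl y)) z
      rw [kop_ks_of_mem (posAll_subset Λ hz)
        (f := grn μ Λ y) (fun w hw => pot_ks_of_notMem (dl_of_notMem hyΛ) hw), ← outK_add_kop _ hz] at h1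
      simp only [Pi.add_apply, hku]
      rw [add_assoc, ← h1]
      simp [hu, hz]
    · simp only [Pi.add_apply, kop_ks_of_notMem hz, outK_of_notMem _ hz, dl_of_notMem hy z hz]
      simp [hu, hz]
  have h0 : Tendsto (fun n => (kop (ks (wt μ) posAll) ^ n) u x) atTop (𝓝 0) := by
    refine tendsto_of_tendsto_of_tendsto_of_le_of_le tendsto_const_nhds
      (tendsto_kop_pow_pot (h.grn_ne_top Λ y x)) (fun n => zero_le) fun n => ?_
    exact (kop_pow_mono _ n hule x).trans
      (kop_pow_le_kop_pow (ks_mono (fun z => le_rfl) (posAll_subset Λ)) n _ x)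
  have h1 := eq_pot_of_tendsto hrec h0
  have h2 : u x = grn μ Λ y x := by simp [hu, hx]
  rw [← h2, h1]
  unfold pot
  rw [← ENNReal.tsum_add]
  exact tsum_congr fun n => by rw [map_add, Pi.add_apply]

theorem tendsto_pot_ratio (h : Standing μ) (hx : AlongDrift μ xs) {x : Fin d → ℤ}
    (hxA : x ∈ posAll) :
    Tendsto (fun n => pot (ks (wt μ) posAll) (dl (xs n)) x / grn μ (LambdaM μ) (xs n) 1) atTop
      (𝓝 (hdrift μ x / hprod μ 1)) := by
  have hmem : ∀ n, xs n ∈ posAll := fun n => by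
    rw [posAll_eq]
    exact hx.mem n
  obtain ⟨κ, hκ, hd, hb⟩ := h.exists_barrier
  obtain ⟨C, hC, hR⟩ := h.exists_ratio_le hx (κ := κ ^ 2) (by positivity)
  set f : ℕ → (Fin d → ℤ) → ℝ≥0∞ := fun n =>
    (grn μ (LambdaM μ) (xs n) 1)⁻¹ • grn μ (LambdaM μ) (xs n) with hf
  have hfdiv : ∀ n y, f n y = grn μ (LambdaM μ) (xs n) y / grn μ (LambdaM μ) (xs n) 1 :=
    fun n y => by rw [hf, div_eq_mul_inv, mul_comm]; rfl
  have hpos : hprod μ 1 ≠ 0 := hprod_ne_zero (one_mem_posDom _)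
  have hlim : ∀ y, Tendsto (fun n => f n y) atTop (𝓝 (((hprod μ 1)⁻¹ • hprod μ) y)) := fun y => by
    simp only [hfdiv]
    have := h.tendsto_grn_ratio hx y
    rwa [div_eq_mul_inv, mul_comm] at this
  have hle : ∀ᶠ n in atTop, ∀ y ∉ posAll, f n y ≤ (ENNReal.ofReal C • barrier μ κ) y :=
    hR.mono fun n hn => le_smul_barrier hκ hC
      (fun y hy => by rw [hfdiv, grn_of_notMem hx _ n hy, ENNReal.zero_div])
      fun y => (hfdiv n y).trans_le (hn y)
  have hpotb : ∀ y, pot (ks (wt μ) posAll) (outK μ (ENNReal.ofReal C • barrier μ κ)) y ≠ ⊤ :=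
    fun y => by
      rw [outK_smul, pot_smul]
      exact ENNReal.mul_ne_top ENNReal.ofReal_ne_top
        (ne_top_of_le_ne_top (barrier_ne_top κ y) (pot_outK_le_of_excessive hb y))
  have hP : Tendsto (fun n => pot (ks (wt μ) posAll) (outK μ (f n)) x) atTop
      (𝓝 (pot (ks (wt μ) posAll) (outK μ ((hprod μ 1)⁻¹ • hprod μ)) x)) :=
    tendsto_pot (hpotb x) (fun y => tendsto_outK
      (ne_top_of_le_ne_top (hpotb y) (dl_le_pot _ _ y)) hlim hle)
      (hle.mono fun n hn => outK_mono hn)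
  have hinv : (hprod μ 1)⁻¹ ≠ ⊤ := ENNReal.inv_ne_top.2 hpos
  have hsub := ENNReal.Tendsto.sub (hlim x) hP
    (Or.inl (ENNReal.mul_ne_top hinv (h.hprod_ne_top x)))
  rw [outK_smul, pot_smul, Pi.smul_apply, smul_eq_mul,
    ← ENNReal.mul_sub fun _ _ => hinv, mul_comm, ← div_eq_mul_inv] at hsub
  refine hsub.congr' ?_
  filter_upwards [h.eventually_grn_one_ne_zero hx (LambdaM μ)] with n hn
  have hadd : pot (ks (wt μ) posAll) (dl (xs n)) x / grn μ (LambdaM μ) (xs n) 1 +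
      pot (ks (wt μ) posAll) (outK μ (f n)) x = f n x := by
    rw [hf]
    simp only [outK_smul, pot_smul, Pi.smul_apply, smul_eq_mul]
    rw [← h.grn_univ_add (hmem n) (LambdaM μ) hxA, mul_add, div_eq_mul_inv, mul_comm]
  have hft : f n x ≠ ⊤ := ENNReal.mul_ne_top (ENNReal.inv_ne_top.2 hn) (h.grn_ne_top _ _ _)
  refine (ENNReal.eq_sub_of_add_eq (ne_top_of_le_ne_top hft ?_) hadd).symm
  exact hadd ▸ le_add_self

theorem tendsto_green_div (h : Standing μ) (hx : AlongDrift μ xs) {x x₀ : Fin d → ℤ}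
    (hxA : x ∈ posAll) (hx₀ : x₀ ∈ posAll) :
    Tendsto (fun n => green μ posAll x (xs n) / green μ posAll x₀ (xs n)) atTop
      (𝓝 (hM3 μ x / hM3 μ x₀)) := by
  have hpos : hprod μ 1 ≠ 0 := hprod_ne_zero (one_mem_posDom _)
  have hpos' : (hprod μ 1).toReal ≠ 0 := (ENNReal.toReal_pos hpos (h.hprod_ne_top 1)).ne'
  have key : ∀ y ∈ posAll, Tendsto (fun n => green μ posAll y (xs n) /
      (grn μ (LambdaM μ) (xs n) 1).toReal) atTop (𝓝 (hM3 μ y / (hprod μ 1).toReal)) := by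
    intro y hy
    have h1 := (ENNReal.tendsto_toReal
      (ENNReal.div_ne_top (h.hdrift_ne_top y) hpos)).comp (h.tendsto_pot_ratio hx hy)
    rw [ENNReal.toReal_div, ← h.hM3_eq_toReal hy] at h1
    refine h1.congr fun n => ?_
    have hmem : xs n ∈ posAll := by
      rw [posAll_eq]
      exact hx.mem n
    rw [Function.comp_apply, ENNReal.toReal_div, ← green_eq h.nonneg h.sum hmem]
  have h2 := (key x hxA).div (key x₀ hx₀) (div_ne_zero (h.hM3_pos hx₀).ne' hpos')
  rw [div_div_div_cancel_right₀ hpos'] at h2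
  refine h2.congr' ?_
  filter_upwards [h.eventually_grn_one_ne_zero hx (LambdaM μ)] with n hn
  exact div_div_div_cancel_right₀ (ENNReal.toReal_pos hn (h.grn_ne_top _ _ _)).ne' _ _

end Standing

end

end KilledWalk

theorem statement3 {d : ℕ} (μ : (Fin d → ℤ) → ℝ)
    (hnn : ∀ z, 0 ≤ μ z) (hsum : HasSum μ 1)
    (hA1 : A1 μ) (hA2 : A2 μ) (hA3 : A3 μ)
    (hA4 : ∀ u : ↥(LambdaM μ) → ℤ,
      (∃ i j : ↥(LambdaM μ), i ≠ j ∧ u i ≠ 0 ∧ u j ≠ 0) → muL μ (LambdaM μ) u = 0)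
    (hM : ∀ i, 0 ≤ Mvec μ i) (x₀ : Fin d → ℤ) (hx₀ : x₀ ∈ posAll) :
    -- (i)
    ((∀ x ∈ posAll, 0 < hM3 μ x) ∧ HarmOn μ posAll (hM3 μ)) ∧
    -- (ii)
    (∀ xs : ℕ → (Fin d → ℤ), (∀ n, xs n ∈ posAll) →
      Tendsto (fun n => znorm (xs n)) atTop atTop →
      Tendsto (fun n i => (xs n i : ℝ) / znorm (xs n)) atTop
        (𝓝 (fun i => Mvec μ i / rnorm (Mvec μ))) →
      Fundamental μ posAll x₀ xs ∧
      ∀ x ∈ posAll,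
        Tendsto (fun n => green μ posAll x (xs n) / green μ posAll x₀ (xs n)) atTop
          (𝓝 (hM3 μ x / hM3 μ x₀))) := by
  have h : KilledWalk.Standing μ :=
    ⟨hnn, hsum, hA1, hA2, hA3, KilledWalk.eq_zero_of_muL hnn hsum hA4, hM⟩
  refine ⟨⟨fun x hx => h.hM3_pos hx, h.harmOn_hM3⟩, fun xs hmem hnorm hdir => ?_⟩
  have hxs : KilledWalk.AlongDrift μ xs :=
    ⟨fun n => KilledWalk.posAll_subset _ (hmem n), hnorm, hdir⟩
  have key := fun x hx => h.tendsto_green_div hxs (x := x) hx hx₀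
  exact ⟨fun x hx => ⟨_, key x hx⟩, key⟩
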